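/- arXiv:0712.1081 — 2 statements merged into one kernel-verified Lean document; each statement's English description precedes it below -/
import Mathlib

section
/- Fix any constant c > log 8. For every ε > 0 there exists x₀ such that for all real x ≥ x₀, every real A ≥ 0, and every real N ≥ exp(c·x/log log x), one has |#(S_x ∩ (A, A+N]) − (N/M(x))·#(S_x ∩ (0, M(x)])| ≤ ε·(N/M(x))·#(S_x ∩ (0, M(x)]). That is, the equidistribution of x-pseudosquares holds uniformly in intervals of length at least exp(c·x/log log x) for any fixed c > log 8. -/
open scoped BigOperators

/-- The finset of primes `p ≤ x`. -/
noncomputable def primesUpTo (x : ℝ) : Finset ℕ := (Finset.Iic ⌊x⌋₊).filter Nat.Prime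

/-- `M(x)`: the product of all primes `p ≤ x`. -/
noncomputable def Mx (x : ℝ) : ℕ := ∏ p ∈ primesUpTo x, p

/-- `π(x)`: the number of primes `p ≤ x`. -/
noncomputable def piX (x : ℝ) : ℕ := (primesUpTo x).card

/-- The Legendre symbol `(a/p)` (junk value `0` if `p` is not prime). -/
noncomputable def legendre (p : ℕ) (a : ℤ) : ℤ :=
  if hp : p.Prime then @legendreSym p ⟨hp⟩ a else 0

/-- An `x`-pseudosquare: a positive integer that is not a perfect square, is `≡ 1 (mod 8)`,
and has Legendre symbol `(n/p) = 1` for every odd prime `p ≤ x`. -/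
def IsPseudosquare (x : ℝ) (n : ℕ) : Prop :=
  0 < n ∧ ¬ IsSquare n ∧ n % 8 = 1 ∧
    ∀ p : ℕ, p.Prime → p ≠ 2 → (p : ℝ) ≤ x → legendre p (n : ℤ) = 1

/-- `#(S_x ∩ (A, A+N])`: the number of `x`-pseudosquares in the interval `(A, A+N]`. -/
noncomputable def pseudosquaresIn (x A N : ℝ) : ℕ :=
  Set.ncard {n : ℕ | IsPseudosquare x n ∧ A < (n : ℝ) ∧ (n : ℝ) ≤ A + N}

open Polynomial in
/-- The operator sending `r` to the derivative of `f ^ c * r` divided by `f ^ (c - 1)`. -/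
noncomputable def twistedDerivative {F : Type*} [Field F] (f : F[X]) (c : ℕ) : F[X] →ₗ[F] F[X] :=
  LinearMap.mulLeft F ((c : F[X]) * derivative f) + (LinearMap.mulLeft F f).comp derivative

open Polynomial in
/-- The operator `r ↦ f ^ (i - c) (f ^ c r)⁽ⁱ⁾`. -/
noncomputable def iterTwistedDerivative {F : Type*} [Field F] (f : F[X]) (c : ℕ) :
    ℕ → F[X] →ₗ[F] F[X]
  | 0 => LinearMap.id
  | i + 1 => (twistedDerivative f (c - i)).comp (iterTwistedDerivative f c i)

section Stepanov

open Polynomial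

variable {F : Type*} [Field F]

theorem twistedDerivative_apply (f : F[X]) (c : ℕ) (r : F[X]) :
    twistedDerivative f c r = (c : F[X]) * derivative f * r + f * derivative r := by
  simp [twistedDerivative, mul_assoc]

theorem iterate_derivative_pow_mul (f r : F[X]) (c i : ℕ) (hi : i ≤ c) :
    derivative^[i] (f ^ c * r) = f ^ (c - i) * iterTwistedDerivative f c i r := by
  induction i with
  | zero => simp [iterTwistedDerivative]
  | succ i ih =>
    rw [Function.iterate_succ_apply', ih (by omega)]
    obtain ⟨d, rfl⟩ : ∃ d, c = i + 1 + d := ⟨c - (i + 1), by omega⟩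
    have h1 : i + 1 + d - i = d + 1 := by omega
    have h2 : i + 1 + d - (i + 1) = d := by omega
    simp only [iterTwistedDerivative, LinearMap.comp_apply, twistedDerivative_apply, h1, h2,
      derivative_mul, derivative_pow]
    simp
    ring

theorem iterTwistedDerivative_mem_degreeLT {f r : F[X]} {K m : ℕ} (hf : f.natDegree ≤ m)
    (hr : r ∈ degreeLT F K) (c i : ℕ) :
    iterTwistedDerivative f c i r ∈ degreeLT F (K + i * m) := by
  induction i with
  | zero => simpa [iterTwistedDerivative] using hr
  | succ i ih =>
    simp only [iterTwistedDerivative, LinearMap.comp_apply, twistedDerivative_apply]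
    set q := iterTwistedDerivative f c i r
    have hfd : f.degree ≤ m := natDegree_le_iff_degree_le.mp hf
    rw [mem_degreeLT] at ih ⊢
    by_cases hq : q = 0
    · simp [hq]
      exact WithBot.bot_lt_coe _
    have hqn : q.natDegree < K + i * m := (natDegree_lt_iff_degree_lt hq).mpr ih
    have hf' := natDegree_derivative_le f
    have hq' := natDegree_derivative_le q
    refine lt_of_le_of_lt degree_le_natDegree ?_
    have : ((c - i : ℕ) * derivative f * q + f * derivative q).natDegree ≤ m + q.natDegree := by
      refine natDegree_add_le_of_degree_le ?_ ?_
      · refine natDegree_mul_le_of_le ?_ le_rfl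
        refine (natDegree_mul_le).trans ?_
        rw [natDegree_natCast]
        omega
      · refine natDegree_mul_le_of_le hf ?_
        omega
    rw [Nat.cast_lt]
    calc _ ≤ _ := this
      _ < _ := by rw [Nat.succ_mul]; omega

variable {p : ℕ} [Fact p.Prime]

theorem X_pow_dvd_pow_char_sub (f : (ZMod p)[X]) :
    X ^ p ∣ f ^ p - C (f.coeff 0 ^ p) := by
  have h : X ∣ f - C (f.coeff 0) := by
    rw [X_dvd_iff]; simp
  have := pow_dvd_pow_of_dvd h p
  rwa [sub_pow_char, ← C_pow] at this

theorem eq_zero_of_X_pow_dvd_add_mul_pow (hp : Odd p) {f r s : (ZMod p)[X]} {m K : ℕ}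
    (hf : f.natDegree ≤ m) (h0 : f.coeff 0 ≠ 0) {a : ZMod p} (ha : Odd (f.rootMultiplicity a))
    (hK : 2 * K + m ≤ p + 1) (hr : r ∈ degreeLT (ZMod p) K) (hs : s ∈ degreeLT (ZMod p) K)
    (hdvd : X ^ p ∣ r + s * f ^ (p / 2)) : r = 0 ∧ s = 0 := by
  have hf0 : f ≠ 0 := by rintro rfl; simp at h0
  have hpp : p / 2 + p / 2 + 1 = p := by obtain ⟨t, rfl⟩ := hp; omega
  set c := f.coeff 0 ^ p with hc
  have hc0 : c ≠ 0 := pow_ne_zero _ h0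
  have h1 : X ^ p ∣ r ^ 2 * f - C c * s ^ 2 := by
    have e : r ^ 2 * f - C c * s ^ 2 =
        (r + s * f ^ (p / 2)) * ((r - s * f ^ (p / 2)) * f) + s ^ 2 * (f ^ p - C c) := by
      have : f ^ p = f ^ (p / 2) * f ^ (p / 2) * f := by
        rw [← pow_add, ← pow_succ, hpp]
      rw [this]; ring
    rw [e]
    exact dvd_add (hdvd.mul_right _) ((X_pow_dvd_pow_char_sub f).mul_left _)
  have key : r ^ 2 * f = C c * s ^ 2 := by
    rw [← sub_eq_zero]
    by_contra hne
    have h2 := natDegree_le_of_dvd h1 hne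
    rw [natDegree_X_pow] at h2
    have h3 : ∀ u : (ZMod p)[X], u ∈ degreeLT (ZMod p) K → u = 0 ∨ u.natDegree < K := by
      intro u hu
      by_cases h : u = 0
      · exact Or.inl h
      · exact Or.inr ((natDegree_lt_iff_degree_lt h).mpr (mem_degreeLT.mp hu))
    have h4 : (r ^ 2 * f).natDegree < p := by
      rcases h3 r hr with h | h
      · simp [h, (Fact.out : p.Prime).pos]
      · have := natDegree_mul_le_of_le (natDegree_pow_le (p := r) (n := 2)) hf
        omega
    have h5 : (C c * s ^ 2).natDegree < p := by
      rcases h3 s hs with h | h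
      · simp [h, (Fact.out : p.Prime).pos]
      · have := (natDegree_C_mul_le c (s ^ 2)).trans (natDegree_pow_le (p := s) (n := 2))
        omega
    have := natDegree_sub_le (r ^ 2 * f) (C c * s ^ 2)
    have := max_lt h4 h5
    omega
  have hcs : s = 0 → r = 0 := by
    rintro rfl
    simpa [hf0] using key
  by_cases hs0 : s = 0
  · exact ⟨hcs hs0, hs0⟩
  exfalso
  have hr0 : r ≠ 0 := by
    rintro rfl
    simp [hc0, hs0] at key
  have := congrArg (rootMultiplicity a) key
  rw [rootMultiplicity_mul (by positivity), rootMultiplicity_mul (by simp [hc0, hs0]),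
    rootMultiplicity_C, pow_two, pow_two, rootMultiplicity_mul (by positivity),
    rootMultiplicity_mul (by positivity)] at this
  obtain ⟨t, ht⟩ := ha
  omega

theorem eq_zero_of_sum_eq_zero (hp : Odd p) {f : (ZMod p)[X]} {m K : ℕ}
    (hf : f.natDegree ≤ m) (h0 : f.coeff 0 ≠ 0) {a : ZMod p} (ha : Odd (f.rootMultiplicity a))
    (hK : 2 * K + m ≤ p + 1) (J : ℕ) (r s : ℕ → (ZMod p)[X])
    (hr : ∀ j, r j ∈ degreeLT (ZMod p) K) (hs : ∀ j, s j ∈ degreeLT (ZMod p) K)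
    (hsum : ∑ j ∈ Finset.range J, X ^ (p * j) * (r j + s j * f ^ (p / 2)) = 0) :
    ∀ j < J, r j = 0 ∧ s j = 0 := by
  induction J generalizing r s with
  | zero => simp
  | succ J ih =>
    rw [Finset.sum_range_succ'] at hsum
    have e : ∑ j ∈ Finset.range J, X ^ (p * (j + 1)) * (r (j + 1) + s (j + 1) * f ^ (p / 2)) =
        X ^ p * ∑ j ∈ Finset.range J, X ^ (p * j) * (r (j + 1) + s (j + 1) * f ^ (p / 2)) := by
      rw [Finset.mul_sum]
      refine Finset.sum_congr rfl fun j _ => ?_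
      rw [show p * (j + 1) = p + p * j by ring, pow_add]; ring
    rw [e, mul_zero, pow_zero, one_mul] at hsum
    have hd : X ^ p ∣ r 0 + s 0 * f ^ (p / 2) := by
      rw [eq_neg_of_add_eq_zero_right hsum]
      exact (Dvd.intro _ rfl).neg_right
    have hz := eq_zero_of_X_pow_dvd_add_mul_pow hp hf h0 ha hK (hr 0) (hs 0) hd
    rw [hz.1, hz.2, zero_mul, add_zero, add_zero] at hsum
    have hrest := (mul_eq_zero.mp hsum).resolve_left (pow_ne_zero _ X_ne_zero)
    have := ih (fun j => r (j + 1)) (fun j => s (j + 1)) (fun j => hr _) (fun j => hs _) hrest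
    intro j hj
    rcases j with _ | j
    · exact hz
    · exact this j (by omega)

theorem iterate_derivative_X_pow_char_mul (j i : ℕ) (q : (ZMod p)[X]) :
    derivative^[i] (X ^ (p * j) * q) = X ^ (p * j) * derivative^[i] q := by
  induction i with
  | zero => rfl
  | succ i ih =>
    rw [Function.iterate_succ_apply', ih, Function.iterate_succ_apply', derivative_mul]
    simp [derivative_X_pow]

/-- Existence of Stepanov's auxiliary coefficients. -/
theorem exists_auxiliary_coefficients {f : (ZMod p)[X]} {m K w : ℕ} (hf : f.natDegree ≤ m)
    (hw : w * (2 * w * m + w + 1) < K) (ε : ZMod p) (c d : ℕ) :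
    ∃ r s : ℕ → (ZMod p)[X], (∀ j, r j ∈ degreeLT (ZMod p) K) ∧
      (∀ j, s j ∈ degreeLT (ZMod p) K) ∧ (∃ j < w + 1, r j ≠ 0 ∨ s j ≠ 0) ∧
      ∀ i < 2 * w, ∑ j ∈ Finset.range (w + 1), X ^ j * (iterTwistedDerivative f c i (r j) +
        C ε * iterTwistedDerivative f d i (s j)) = 0 := by
  classical
  let V := degreeLT (ZMod p) K
  let D := K + 2 * w * m + (w + 1)
  let Ψ : ℕ → ((Fin (w + 1) → V) × (Fin (w + 1) → V)) →ₗ[ZMod p] (ZMod p)[X] := fun i =>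
    ∑ j : Fin (w + 1), (LinearMap.mulLeft (ZMod p) (X ^ (j : ℕ))).comp
      ((iterTwistedDerivative f c i).comp (V.subtype.comp
          ((LinearMap.proj j).comp (LinearMap.fst _ _ _))) +
        (LinearMap.mulLeft (ZMod p) (C ε)).comp ((iterTwistedDerivative f d i).comp (V.subtype.comp
          ((LinearMap.proj j).comp (LinearMap.snd _ _ _)))))
  have hΨ : ∀ i v, Ψ i v = ∑ j : Fin (w + 1), X ^ (j : ℕ) *
      (iterTwistedDerivative f c i (v.1 j) + C ε * iterTwistedDerivative f d i (v.2 j)) := by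
    intro i v
    simp [Ψ]
  have hdeg : ∀ i < 2 * w, ∀ v, Ψ i v ∈ degreeLT (ZMod p) D := by
    intro i hi v
    rw [hΨ]
    refine Submodule.sum_mem _ fun j _ => ?_
    have hmono : K + i * m ≤ K + 2 * w * m := by gcongr
    have h1 := degreeLT_mono hmono (iterTwistedDerivative_mem_degreeLT hf (v.1 j).2 c i)
    have h2 := degreeLT_mono hmono (iterTwistedDerivative_mem_degreeLT hf (v.2 j).2 d i)
    have h3 : C ε * iterTwistedDerivative f d i (v.2 j) ∈ degreeLT (ZMod p) (K + 2 * w * m) := by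
      rw [← smul_eq_C_mul]; exact Submodule.smul_mem _ _ h2
    have h4 := Submodule.add_mem _ h1 h3
    rw [mem_degreeLT] at h4 ⊢
    refine (degree_mul_le _ _).trans_lt ?_
    rw [degree_X_pow]
    set q := iterTwistedDerivative f c i (v.1 j) + C ε * iterTwistedDerivative f d i (v.2 j)
    by_cases hq : q = 0
    · simp [hq]
    rw [degree_eq_natDegree hq] at h4 ⊢
    have h4' : q.natDegree < K + 2 * w * m := by exact_mod_cast h4
    have : (j : ℕ) + q.natDegree < D := by have := j.2; omega
    exact_mod_cast this
  let Φ : ((Fin (w + 1) → V) × (Fin (w + 1) → V)) →ₗ[ZMod p] (Fin (2 * w) × Fin D → ZMod p) :=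
    LinearMap.pi fun t => (lcoeff (ZMod p) (t.2 : ℕ)).comp (Ψ t.1)
  have hfin : Module.finrank (ZMod p) V = K := by
    rw [(degreeLTEquiv (ZMod p) K).finrank_eq]; simp
  have : Module.Finite (ZMod p) V := Module.Finite.equiv (degreeLTEquiv (ZMod p) K).symm
  have hlt : Module.finrank (ZMod p) (Fin (2 * w) × Fin D → ZMod p) <
      Module.finrank (ZMod p) ((Fin (w + 1) → V) × (Fin (w + 1) → V)) := by
    rw [Module.finrank_prod, Module.finrank_fintype_fun_eq_card, Module.finrank_pi_fintype]
    simp only [hfin, Fintype.card_prod, Fintype.card_fin, Finset.sum_const, Finset.card_univ,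
      smul_eq_mul, D]
    nlinarith
  have hker := LinearMap.ker_ne_bot_of_finrank_lt (f := Φ) hlt
  obtain ⟨v, hv, hv0⟩ := Submodule.exists_mem_ne_zero_of_ne_bot hker
  have hΨ0 : ∀ i < 2 * w, Ψ i v = 0 := by
    intro i hi
    ext n
    by_cases hn : n < D
    · have := congrFun (LinearMap.mem_ker.mp hv) (⟨i, hi⟩, ⟨n, hn⟩)
      simpa [Φ] using this
    · rw [coeff_zero]
      refine coeff_eq_zero_of_degree_lt ((mem_degreeLT.mp (hdeg i hi v)).trans_le ?_)
      exact_mod_cast not_lt.mp hn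
  let ext : (Fin (w + 1) → V) → ℕ → (ZMod p)[X] := fun u j => if h : j < w + 1 then u ⟨j, h⟩ else 0
  have hext : ∀ u j, ext u j ∈ degreeLT (ZMod p) K := by
    intro u j
    by_cases h : j < w + 1
    · simp only [ext, h, dite_true]; exact (u _).2
    · simp only [ext, h, dite_false]; exact Submodule.zero_mem _
  have hextF : ∀ u (j : Fin (w + 1)), ext u j = u j := by
    intro u j
    simp only [ext, j.2, dite_true]
  refine ⟨ext v.1, ext v.2, hext _, hext _, ?_, ?_⟩
  · by_contra hcon
    push Not at hcon
    apply hv0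
    refine Prod.ext (funext fun j => Subtype.ext ?_) (funext fun j => Subtype.ext ?_)
    · rw [← hextF]; exact (hcon j j.2).1
    · rw [← hextF]; exact (hcon j j.2).2
  · intro i hi
    rw [← hΨ0 i hi, hΨ, Finset.sum_range]
    simp only [hextF]

theorem two_mul_card_eval_pow_eq_le (hp : Odd p) {f : (ZMod p)[X]} {m K w : ℕ}
    (hf : f.natDegree ≤ m) (h0 : f.coeff 0 ≠ 0) {a : ZMod p} (ha : Odd (f.rootMultiplicity a))
    (hK : 2 * K + m ≤ p + 1) (hw : w * (2 * w * m + w + 1) < K) (hwp : 2 * w ≤ p) (ε : ZMod p) :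
    2 * w * (Finset.univ.filter fun x : ZMod p => f.eval x ^ (p / 2) = ε).card ≤
      p * w + K + (2 * w + p / 2) * m := by
  classical
  have hf0 : f ≠ 0 := by rintro rfl; simp at h0
  obtain ⟨r, s, hr, hs, ⟨j₀, hj₀, hne⟩, hsum⟩ :=
    exists_auxiliary_coefficients hf hw ε (2 * w) (2 * w + p / 2)
  set R : (ZMod p)[X] := ∑ j ∈ Finset.range (w + 1),
    X ^ (p * j) * (f ^ (2 * w) * r j + f ^ (2 * w + p / 2) * s j) with hR
  have hR0 : R ≠ 0 := by
    intro h
    have e : R = f ^ (2 * w) *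
        ∑ j ∈ Finset.range (w + 1), X ^ (p * j) * (r j + s j * f ^ (p / 2)) := by
      rw [hR, Finset.mul_sum]
      refine Finset.sum_congr rfl fun j _ => ?_
      rw [pow_add]; ring
    rw [e] at h
    have h' := (mul_eq_zero.mp h).resolve_left (pow_ne_zero _ hf0)
    have := eq_zero_of_sum_eq_zero hp hf h0 ha hK (w + 1) r s hr hs h' j₀ hj₀
    tauto
  have hdeg : R.natDegree ≤ p * w + K + (2 * w + p / 2) * m := by
    rw [hR]
    refine natDegree_sum_le_of_forall_le _ _ fun j hj => ?_
    have hj' : p * j ≤ p * w := Nat.mul_le_mul_left _ (by simpa [Nat.lt_succ_iff] using hj)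
    have hb : ∀ u : (ZMod p)[X], u ∈ degreeLT (ZMod p) K → u.natDegree ≤ K := fun u hu =>
      natDegree_le_iff_degree_le.mpr (mem_degreeLT.mp hu).le
    have hpow : ∀ n, (f ^ n).natDegree ≤ n * m := fun n =>
      (natDegree_pow_le).trans (Nat.mul_le_mul_left _ hf)
    have h1 := natDegree_mul_le_of_le (hpow (2 * w)) (hb _ (hr j))
    have h2 := natDegree_mul_le_of_le (hpow (2 * w + p / 2)) (hb _ (hs j))
    have h3 : 2 * w * m + K ≤ (2 * w + p / 2) * m + K := by gcongr; omega
    have h4 := natDegree_add_le_of_degree_le (h1.trans h3) h2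
    have h5 := natDegree_mul_le_of_le (natDegree_X_pow_le (R := ZMod p) (p * j)) h4
    omega
  have hder : ∀ x : ZMod p, f.eval x ^ (p / 2) = ε → ∀ i < 2 * w,
      (derivative^[i] R).IsRoot x := by
    intro x hx i hi
    have h := congrArg (eval x) (hsum i hi)
    rw [hR, iterate_derivative_sum, IsRoot.def, eval_finsetSum]
    rw [eval_finsetSum] at h
    have : ∀ j ∈ Finset.range (w + 1), eval x (derivative^[i]
        (X ^ (p * j) * (f ^ (2 * w) * r j + f ^ (2 * w + p / 2) * s j))) =
        f.eval x ^ (2 * w - i) * eval x (X ^ j * (iterTwistedDerivative f (2 * w) i (r j) +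
          C ε * iterTwistedDerivative f (2 * w + p / 2) i (s j))) := by
      intro j _
      rw [iterate_derivative_X_pow_char_mul, iterate_map_add,
        iterate_derivative_pow_mul _ _ _ _ hi.le, iterate_derivative_pow_mul _ _ _ _ (by omega)]
      have e : 2 * w + p / 2 - i = (2 * w - i) + p / 2 := by omega
      simp only [eval_mul, eval_pow, eval_X, eval_add, eval_C, e, pow_add, hx, pow_mul,
        ZMod.pow_card]
      ring
    rw [Finset.sum_congr rfl this, ← Finset.mul_sum, h]
    simp
  have hmult : ∀ x : ZMod p, f.eval x ^ (p / 2) = ε → 2 * w ≤ R.rootMultiplicity x := by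
    intro x hx
    rcases Nat.eq_zero_or_pos w with rfl | hwpos
    · simp
    have h2 : 2 * w - 1 < R.rootMultiplicity x := by
      refine lt_rootMultiplicity_of_isRoot_iterate_derivative_of_mem_nonZeroDivisors hR0
        (fun i hi => hder x hx i (by omega)) ?_
      rw [mem_nonZeroDivisors_iff_ne_zero, Ne, ZMod.natCast_eq_zero_iff,
        (Fact.out : p.Prime).dvd_factorial]
      omega
    omega
  have hcard : ∑ x ∈ Finset.univ.filter (fun x : ZMod p => f.eval x ^ (p / 2) = ε), 2 * w ≤
      R.natDegree := by
    calc _ ≤ ∑ x ∈ Finset.univ.filter (fun x : ZMod p => f.eval x ^ (p / 2) = ε),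
          R.roots.count x := by
          refine Finset.sum_le_sum fun x hx => ?_
          rw [count_roots]
          exact hmult x (Finset.mem_filter.mp hx).2
      _ ≤ ∑ x : ZMod p, R.roots.count x :=
          Finset.sum_le_sum_of_subset (Finset.subset_univ _)
      _ = Multiset.card R.roots := by
          rw [Multiset.sum_count_eq_card]; simp
      _ ≤ _ := card_roots' R
  rw [Finset.sum_const, smul_eq_mul, mul_comm] at hcard
  exact hcard.trans hdeg

end Stepanov

open Polynomial in
/-- The polynomial `∏ (X + ∑ i ∈ I, h i)`, the product being over all subsets `I` of the list. -/
noncomputable def cubePoly {F : Type*} [Field F] : List F → F[X]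
  | [] => X
  | h :: hs => cubePoly hs * (cubePoly hs).comp (X + C h)

section CharacterSum

open Polynomial

variable {p : ℕ} [Fact p.Prime]

theorem natDegree_cubePoly {F : Type*} [Field F] (hs : List F) :
    (cubePoly hs).natDegree = 2 ^ hs.length ∧ cubePoly hs ≠ 0 := by
  induction hs with
  | nil => simp [cubePoly]
  | cons h hs ih =>
    have h1 : (cubePoly hs).comp (X + C h) ≠ 0 := by
      intro h0
      have h2 : ((cubePoly hs).comp (X + C h)).natDegree = 2 ^ hs.length := by
        rw [natDegree_comp, natDegree_X_add_C, mul_one, ih.1]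
      rw [h0, natDegree_zero] at h2
      exact (pow_pos two_pos _).ne h2
    refine ⟨?_, mul_ne_zero ih.2 h1⟩
    rw [cubePoly, natDegree_mul ih.2 h1, natDegree_comp, natDegree_X_add_C, mul_one, ih.1,
      List.length_cons, pow_succ]
    ring

theorem rootMultiplicity_comp_X_add_C_eq {F : Type*} [Field F] (f : F[X]) (b x : F) :
    (f.comp (X + C b)).rootMultiplicity x = f.rootMultiplicity (x + b) := by
  rw [rootMultiplicity_eq_rootMultiplicity, comp_assoc,
    rootMultiplicity_eq_rootMultiplicity (p := f)]
  congr 2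
  simp
  ring

theorem rootMultiplicity_cubePoly_cons {F : Type*} [Field F] (h : F) (hs : List F) (x : F) :
    (cubePoly (h :: hs)).rootMultiplicity x =
      (cubePoly hs).rootMultiplicity x + (cubePoly hs).rootMultiplicity (x + h) := by
  have h0 := (natDegree_cubePoly (h :: hs)).2
  rw [cubePoly] at h0 ⊢
  rw [rootMultiplicity_mul h0, rootMultiplicity_comp_X_add_C_eq]

theorem sum_rootMultiplicity_cubePoly (hs : List (ZMod p)) :
    ∑ x : ZMod p, (cubePoly hs).rootMultiplicity x = 2 ^ hs.length := by
  induction hs with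
  | nil =>
    have : ∀ x : ZMod p, (cubePoly ([] : List (ZMod p))).rootMultiplicity x =
        if x = 0 then 1 else 0 := by
      intro x
      have := rootMultiplicity_X_sub_C (x := x) (y := (0 : ZMod p))
      simpa [cubePoly] using this
    simp [this]
  | cons h hs ih =>
    simp_rw [rootMultiplicity_cubePoly_cons]
    have hshift := Equiv.sum_comp (Equiv.addRight h) fun x => (cubePoly hs).rootMultiplicity x
    simp only [Equiv.coe_addRight] at hshift
    rw [Finset.sum_add_distrib, hshift, ih, List.length_cons, pow_succ]
    ring

/-- Shifting by nonzero elements never makes all the root multiplicities even. -/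
theorem exists_odd_rootMultiplicity_cubePoly (hp : Odd p) (hs : List (ZMod p))
    (hne : ∀ h ∈ hs, h ≠ 0) : ∃ a, Odd ((cubePoly hs).rootMultiplicity a) := by
  induction hs with
  | nil =>
    refine ⟨0, ?_⟩
    have := rootMultiplicity_X_sub_C_self (x := (0 : ZMod p))
    rw [C_0, sub_zero] at this
    rw [cubePoly, this]
    exact odd_one
  | cons h hs ih =>
    by_contra hcon
    push Not at hcon
    simp only [Nat.not_odd_iff_even] at hcon
    obtain ⟨a, ha⟩ := ih fun h' hh' => hne h' (List.mem_cons_of_mem _ hh')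
    have h0 : h ≠ 0 := hne h List.mem_cons_self
    set μ : ZMod p → ℕ := fun x => (cubePoly hs).rootMultiplicity x with hμ
    have hstep : ∀ x, Odd (μ x) → Odd (μ (x + h)) := by
      intro x hx
      have := hcon x
      rw [rootMultiplicity_cubePoly_cons] at this
      exact (Nat.even_add'.mp this).mp hx
    have hiter : ∀ n : ℕ, Odd (μ (a + n * h)) := by
      intro n
      induction n with
      | zero => simpa using ha
      | succ n ihn =>
        have := hstep _ ihn
        rwa [show a + ((n + 1 : ℕ) : ZMod p) * h = a + n * h + h by push_cast; ring]
    have hall : ∀ x, Odd (μ x) := by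
      intro x
      have := hiter ((x - a) / h).val
      rw [ZMod.natCast_zmod_val, div_mul_cancel₀ _ h0] at this
      simpa using this
    have hsum := sum_rootMultiplicity_cubePoly hs
    have hodd : Odd (∑ x : ZMod p, μ x) := by
      rw [Finset.odd_sum_iff_odd_card_odd]
      simpa [hall, ZMod.card] using hp
    rw [hsum] at hodd
    rcases hs with _ | ⟨h', hs'⟩
    · have h1 := sum_rootMultiplicity_cubePoly ([] : List (ZMod p))
      have h2 : (Finset.univ : Finset (ZMod p)).card • 1 ≤ ∑ x : ZMod p, μ x :=
        Finset.card_nsmul_le_sum _ _ _ fun x _ => (hall x).pos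
      rw [hsum] at h2
      simp [ZMod.card] at h2
      have := (Fact.out : p.Prime).two_le
      omega
    · rw [List.length_cons, pow_succ] at hodd
      exact (Nat.not_odd_iff_even.mpr (even_two.mul_left _)) hodd

theorem eval_pow_half_eq_quadraticChar (hp : Odd p) (y : ZMod p) :
    ((quadraticChar (ZMod p) y : ℤ) : ZMod p) = y ^ (p / 2) := by
  have h2 : ringChar (ZMod p) ≠ 2 := by
    rw [ZMod.ringChar_zmod_n]
    rintro rfl
    exact absurd hp (by decide)
  rw [quadraticChar_eq_pow_of_char_ne_two' h2, ZMod.card]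

theorem exists_stepanov_parameters {p m : ℕ} (hm : 1 ≤ m) (hpm : 64 * m ^ 2 ≤ p) :
    ∃ w K : ℕ, 2 * K + m ≤ p + 1 ∧ w * (2 * w * m + w + 1) < K ∧ 2 * w ≤ p ∧
      ∀ z : ℕ, 2 * w * z ≤ p * w + K + (2 * w + p / 2) * m →
        (z : ℝ) ≤ p / 2 + m + 4 * m ^ 2 * Real.sqrt p := by
  set y := Real.sqrt p with hy
  have hyy : y * y = p := Real.mul_self_sqrt (Nat.cast_nonneg _)
  have hm' : (1 : ℝ) ≤ m := by exact_mod_cast hm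
  have hy8 : 8 * (m : ℝ) ≤ y := by
    apply Real.le_sqrt_of_sq_le
    have : ((64 * m ^ 2 : ℕ) : ℝ) ≤ p := by exact_mod_cast hpm
    push_cast at this
    nlinarith
  set w := ⌊y / (4 * m)⌋₊ with hwdef
  have hw1 : 4 * m * (w : ℝ) ≤ y := by
    have := Nat.floor_le (a := y / (4 * m)) (by positivity)
    rw [← hwdef, le_div_iff₀ (by positivity)] at this
    linarith
  have hw2 : y ≤ 8 * m * (w : ℝ) := by
    have h := Nat.lt_floor_add_one (y / (4 * m))
    rw [← hwdef, div_lt_iff₀ (by positivity)] at h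
    nlinarith
  have hwpos : (0 : ℝ) < w := by
    by_contra h
    have : (w : ℝ) = 0 := le_antisymm (not_lt.mp h) (Nat.cast_nonneg _)
    rw [this] at hw2
    linarith
  set K := (p + 1 - m) / 2 with hK
  have hmp : m ≤ p := by nlinarith
  have hK1 : 2 * K + m ≤ p + 1 := by omega
  have hK2 : p ≤ 2 * K + m := by omega
  have hwK : w * (2 * w * m + w + 1) < K := by
    have hK2' : (p : ℝ) ≤ 2 * K + m := by exact_mod_cast hK2
    have h1 : (4 * m * (w : ℝ)) * (4 * m * w) ≤ y * y :=
      mul_le_mul hw1 hw1 (by positivity) (by positivity)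
    have h2 : (w : ℝ) * w * m ≤ w * w * (m * m) := by nlinarith [mul_pos hwpos hwpos]
    have h3 : (w : ℝ) * w ≤ w * w * (m * m) := by nlinarith [mul_pos hwpos hwpos]
    have h4 : (w : ℝ) ≤ y / 4 := by nlinarith
    have h5 : y / 4 ≤ p / 32 := by nlinarith
    have h6 : (m : ℝ) ≤ p / 64 := by nlinarith
    have h7 : (w : ℝ) * (2 * w * m + w + 1) < K := by
      rw [hyy] at h1
      have : (w : ℝ) * (2 * w * m + w + 1) = 2 * (w * w * m) + w * w + w := by ring
      rw [this]
      have hp0 : (0 : ℝ) < p := by nlinarith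
      nlinarith
    exact_mod_cast h7
  have hwp : 2 * w ≤ p := by
    have : (2 * w : ℝ) ≤ p := by nlinarith
    exact_mod_cast this
  refine ⟨w, K, hK1, hwK, hwp, fun z h3 => ?_⟩
  have h3' : 2 * (w : ℝ) * z ≤ p * w + K + (2 * w + (p / 2 : ℕ)) * m := by
    exact_mod_cast h3
  have h4 : ((p / 2 : ℕ) : ℝ) ≤ p / 2 := Nat.cast_div_le
  have h5 : (K : ℝ) ≤ p / 2 := by
    have : ((2 * K + m : ℕ) : ℝ) ≤ ((p + 1 : ℕ) : ℝ) := by exact_mod_cast hK1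
    push_cast at this
    linarith
  have h6 : (p : ℝ) * m ≤ 2 * w * (4 * m ^ 2 * y) := by
    calc (p : ℝ) * m = y * (m * y) := by rw [← hyy]; ring
      _ ≤ 8 * m * w * (m * y) := by gcongr
      _ = _ := by ring
  have h7 : ((p / 2 : ℕ) : ℝ) * m ≤ p / 2 * m := by gcongr
  have h8 : 2 * (w : ℝ) * z ≤ 2 * w * (p / 2 + m + 4 * m ^ 2 * y) := by
    have : (p : ℝ) ≤ p * m := le_mul_of_one_le_right (Nat.cast_nonneg _) hm'
    linarith
  exact le_of_mul_le_mul_left h8 (by positivity)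

theorem abs_sum_quadraticChar_le_of_coeff_zero_ne_zero (hp : Odd p) {f : (ZMod p)[X]} {m : ℕ}
    (hm : 1 ≤ m) (hf : f.natDegree ≤ m) (h0 : f.coeff 0 ≠ 0) {a : ZMod p}
    (ha : Odd (f.rootMultiplicity a)) (hpm : 64 * m ^ 2 ≤ p) :
    |((∑ x : ZMod p, quadraticChar (ZMod p) (f.eval x) : ℤ) : ℝ)| ≤
      11 * (m : ℝ) ^ 2 * Real.sqrt p := by
  classical
  set Z : ℤ → Finset (ZMod p) := fun e =>
    Finset.univ.filter fun x => quadraticChar (ZMod p) (f.eval x) = e with hZ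
  have hsum : ∑ x : ZMod p, quadraticChar (ZMod p) (f.eval x) =
      ((Z 1).card : ℤ) - ((Z (-1)).card : ℤ) := by
    have h1 : ∀ x : ZMod p, quadraticChar (ZMod p) (f.eval x) =
        (if quadraticChar (ZMod p) (f.eval x) = 1 then 1 else 0) -
        (if quadraticChar (ZMod p) (f.eval x) = -1 then 1 else 0) := by
      intro x
      rcases quadraticChar_isQuadratic (ZMod p) (f.eval x) with h | h | h <;> rw [h] <;> norm_num
    rw [Finset.sum_congr rfl fun x _ => h1 x, Finset.sum_sub_distrib]
    simp [hZ]
  have htot : ((Z 1).card : ℤ) + (Z (-1)).card + (Z 0).card = p := by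
    have h1 : ∀ x : ZMod p, (1 : ℤ) =
        (if quadraticChar (ZMod p) (f.eval x) = 1 then 1 else 0) +
        (if quadraticChar (ZMod p) (f.eval x) = -1 then 1 else 0) +
        (if quadraticChar (ZMod p) (f.eval x) = 0 then 1 else 0) := by
      intro x
      rcases quadraticChar_isQuadratic (ZMod p) (f.eval x) with h | h | h <;> rw [h] <;> norm_num
    have h2 : ∑ x : ZMod p, (1 : ℤ) = p := by simp [ZMod.card]
    rw [← h2, Finset.sum_congr rfl fun x _ => h1 x, Finset.sum_add_distrib,
      Finset.sum_add_distrib]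
    simp [hZ]
  have hf0 : f ≠ 0 := by rintro rfl; simp at h0
  have hZ0 : (Z 0).card ≤ m := by
    have h1 : Z 0 ⊆ f.roots.toFinset := by
      intro x hx
      simp only [hZ, Finset.mem_filter, quadraticChar_eq_zero_iff] at hx
      simp [hf0, hx.2]
    exact (Finset.card_le_card h1).trans
      ((Multiset.toFinset_card_le _).trans ((card_roots' f).trans hf))
  obtain ⟨w, K, hK1, hwK, hwp, hz⟩ := exists_stepanov_parameters hm hpm
  have hbound : ∀ e : ℤ, ((Z e).card : ℝ) ≤ p / 2 + m + 4 * m ^ 2 * Real.sqrt p := by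
    intro e
    have h2 : Z e ⊆ Finset.univ.filter fun x : ZMod p => f.eval x ^ (p / 2) = (e : ZMod p) := by
      intro x hx
      simp only [hZ, Finset.mem_filter] at hx ⊢
      exact ⟨hx.1, by rw [← eval_pow_half_eq_quadraticChar hp, hx.2]⟩
    exact hz _ ((Nat.mul_le_mul_left _ (Finset.card_le_card h2)).trans
      (two_mul_card_eval_pow_eq_le hp hf h0 ha hK1 hwK hwp ((e : ℤ) : ZMod p)))
  have hb1 := hbound 1
  have hb2 := hbound (-1)
  have htot' : ((Z 1).card : ℝ) + (Z (-1)).card + (Z 0).card = p := by exact_mod_cast htot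
  have hZ0' : ((Z 0).card : ℝ) ≤ m := by exact_mod_cast hZ0
  have hZ0n : (0 : ℝ) ≤ (Z 0).card := Nat.cast_nonneg _
  have hm' : (1 : ℝ) ≤ m := by exact_mod_cast hm
  have hy : 1 ≤ Real.sqrt p := by
    rw [Real.one_le_sqrt]
    exact_mod_cast (Fact.out : p.Prime).one_lt.le
  have hmy : (m : ℝ) ≤ m ^ 2 * Real.sqrt p := by nlinarith
  rw [hsum]
  push_cast
  rw [abs_le]
  constructor <;> linarith

theorem abs_sum_quadraticChar_eval_le (hp : Odd p) {f : (ZMod p)[X]} {m : ℕ} (hm : 1 ≤ m)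
    (hf : f.natDegree ≤ m) {a : ZMod p} (ha : Odd (f.rootMultiplicity a)) :
    |((∑ x : ZMod p, quadraticChar (ZMod p) (f.eval x) : ℤ) : ℝ)| ≤
      11 * (m : ℝ) ^ 2 * Real.sqrt p := by
  have hm' : (1 : ℝ) ≤ m := by exact_mod_cast hm
  by_cases hpm : 64 * m ^ 2 ≤ p
  · have hf0 : f ≠ 0 := by rintro rfl; simp at ha
    obtain ⟨b, hb⟩ : ∃ b, f.eval b ≠ 0 := by
      by_contra hcon
      push Not at hcon
      have h1 : (Finset.univ : Finset (ZMod p)) ⊆ f.roots.toFinset := by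
        intro x _
        simp [hf0, hcon x]
      have h2 := (Finset.card_le_card h1).trans
        ((Multiset.toFinset_card_le _).trans ((card_roots' f).trans hf))
      rw [Finset.card_univ, ZMod.card] at h2
      nlinarith
    have key := abs_sum_quadraticChar_le_of_coeff_zero_ne_zero (f := f.comp (X + C b)) hp hm
      (by rw [natDegree_comp, natDegree_X_add_C, mul_one]; exact hf)
      (by rw [coeff_zero_eq_eval_zero, eval_comp]; simpa using hb)
      (a := a - b) (by rw [rootMultiplicity_comp_X_add_C_eq, sub_add_cancel]; exact ha) hpm
    have e : ∑ x : ZMod p, quadraticChar (ZMod p) ((f.comp (X + C b)).eval x) =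
        ∑ x : ZMod p, quadraticChar (ZMod p) (f.eval x) := by
      rw [← Equiv.sum_comp (Equiv.addRight b) fun x => quadraticChar (ZMod p) (f.eval x)]
      simp
    rwa [e] at key
  · have h1 : |((∑ x : ZMod p, quadraticChar (ZMod p) (f.eval x) : ℤ) : ℝ)| ≤ p := by
      push_cast
      refine (Finset.abs_sum_le_sum_abs _ _).trans ?_
      have : ∀ x ∈ (Finset.univ : Finset (ZMod p)),
          |((quadraticChar (ZMod p) (f.eval x) : ℤ) : ℝ)| ≤ 1 := by
        intro x _
        rcases quadraticChar_isQuadratic (ZMod p) (f.eval x) with h | h | h <;> rw [h] <;> norm_num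
      refine (Finset.sum_le_sum this).trans ?_
      simp [ZMod.card]
    refine h1.trans ?_
    have h2 : Real.sqrt p ≤ 8 * m := by
      rw [Real.sqrt_le_left (by positivity)]
      have : (p : ℝ) ≤ ((64 * m ^ 2 : ℕ) : ℝ) := by exact_mod_cast (not_le.mp hpm).le
      push_cast at this
      nlinarith
    have h3 : Real.sqrt p * Real.sqrt p = p := Real.mul_self_sqrt (Nat.cast_nonneg _)
    have h4 := Real.sqrt_nonneg (p : ℝ)
    calc (p : ℝ) = Real.sqrt p * Real.sqrt p := h3.symm
      _ ≤ 8 * m * Real.sqrt p := by gcongr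
      _ ≤ 11 * (m : ℝ) ^ 2 * Real.sqrt p := by
        gcongr ?_ * _
        nlinarith

end CharacterSum

/-- The product of the values of `G` at `n + ∑ i ∈ I, h i` over all subsets `I` of the list. -/
def cubeProd (G : ℤ → ℝ) : List ℤ → ℤ → ℝ
  | [] => G
  | h :: hs => fun n => cubeProd G hs n * cubeProd G hs (n + h)

/-- The Jacobi symbol `(n/q)` as a real-valued function of `n`. -/
def jacobiReal (q : ℕ) (n : ℤ) : ℝ := (jacobiSym n q : ℝ)

section CubeProd

theorem cubeProd_mul (G G' : ℤ → ℝ) (hs : List ℤ) (n : ℤ) :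
    cubeProd (fun n => G n * G' n) hs n = cubeProd G hs n * cubeProd G' hs n := by
  induction hs generalizing n with
  | nil => rfl
  | cons h hs ih => simp only [cubeProd, ih]; ring

theorem cubeProd_periodic {G : ℤ → ℝ} {q : ℤ} (hG : ∀ n, G (n + q) = G n) (hs : List ℤ) (n : ℤ) :
    cubeProd G hs (n + q) = cubeProd G hs n := by
  induction hs generalizing n with
  | nil => exact hG n
  | cons h hs ih => simp only [cubeProd, ih, add_right_comm n q h]

theorem abs_cubeProd_le_one {G : ℤ → ℝ} (hG : ∀ n, |G n| ≤ 1) (hs : List ℤ) (n : ℤ) :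
    |cubeProd G hs n| ≤ 1 := by
  induction hs generalizing n with
  | nil => exact hG n
  | cons h hs ih =>
    simp only [cubeProd, abs_mul]
    exact mul_le_one₀ (ih n) (abs_nonneg _) (ih _)

theorem abs_jacobiReal_le_one (q : ℕ) (n : ℤ) : |jacobiReal q n| ≤ 1 := by
  unfold jacobiReal
  rcases jacobiSym.trichotomy n q with h | h | h <;> rw [h] <;> norm_num

theorem jacobiReal_periodic (q : ℕ) (n : ℤ) : jacobiReal q (n + q) = jacobiReal q n := by
  unfold jacobiReal
  rw [jacobiSym.mod_left, Int.add_emod_right, ← jacobiSym.mod_left]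

theorem jacobiReal_mul {a b : ℕ} (ha : a ≠ 0) (hb : b ≠ 0) (n : ℤ) :
    jacobiReal (a * b) n = jacobiReal a n * jacobiReal b n := by
  have : NeZero a := ⟨ha⟩
  have : NeZero b := ⟨hb⟩
  unfold jacobiReal
  rw [jacobiSym.mul_right]
  push_cast
  rfl

theorem cubeProd_jacobiReal_mul {a b : ℕ} (ha : a ≠ 0) (hb : b ≠ 0) (hs : List ℤ) (n : ℤ) :
    cubeProd (jacobiReal (a * b)) hs n =
      cubeProd (jacobiReal a) hs n * cubeProd (jacobiReal b) hs n := by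
  rw [← cubeProd_mul]
  congr 1
  funext n
  exact jacobiReal_mul ha hb n

theorem cubeProd_jacobiReal_prime (p : ℕ) [Fact p.Prime] (hs : List ℤ) (n : ℤ) :
    cubeProd (jacobiReal p) hs n =
      ((quadraticChar (ZMod p) ((cubePoly (hs.map fun h : ℤ => (h : ZMod p))).eval (n : ZMod p)) :
        ℤ) : ℝ) := by
  induction hs generalizing n with
  | nil =>
    simp only [cubeProd, cubePoly, List.map_nil, Polynomial.eval_X, jacobiReal]
    rw [← jacobiSym.legendreSym.to_jacobiSym]
    rfl
  | cons h hs ih =>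
    simp only [cubeProd, cubePoly, List.map_cons, Polynomial.eval_mul, Polynomial.eval_comp,
      Polynomial.eval_add, Polynomial.eval_X, Polynomial.eval_C, map_mul, ih]
    push_cast
    rfl

end CubeProd

section CompleteSum

theorem sum_range_natCast_zmod (p : ℕ) [NeZero p] (g : ZMod p → ℝ) :
    ∑ n ∈ Finset.range p, g (n : ZMod p) = ∑ x : ZMod p, g x := by
  refine Finset.sum_nbij' (fun n => (n : ZMod p)) ZMod.val (by simp) ?_ ?_ (by simp) (by simp)
  · intro x _
    simpa using ZMod.val_lt x
  · intro n hn
    exact ZMod.val_natCast_of_lt (by simpa using hn)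

theorem abs_sum_range_cubeProd_prime_le {p : ℕ} (hp : p.Prime) (hodd : Odd p) (hs : List ℤ)
    (hne : ∀ h ∈ hs, ¬ (p : ℤ) ∣ h) :
    |∑ n ∈ Finset.range p, cubeProd (jacobiReal p) hs n| ≤
      11 * 4 ^ hs.length * Real.sqrt p := by
  have : Fact p.Prime := ⟨hp⟩
  set l := hs.map fun h : ℤ => (h : ZMod p) with hl
  have hl0 : ∀ h ∈ l, h ≠ 0 := by
    intro h hh
    obtain ⟨t, ht, rfl⟩ := List.mem_map.mp hh
    rw [Ne, ZMod.intCast_zmod_eq_zero_iff_dvd]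
    exact hne t ht
  obtain ⟨a, ha⟩ := exists_odd_rootMultiplicity_cubePoly hodd l hl0
  have key := abs_sum_quadraticChar_eval_le hodd (Nat.one_le_two_pow (n := l.length))
    (natDegree_cubePoly l).1.le ha
  simp_rw [cubeProd_jacobiReal_prime p hs]
  have e := sum_range_natCast_zmod p fun x =>
    ((quadraticChar (ZMod p) ((cubePoly l).eval x) : ℤ) : ℝ)
  simp only [Int.cast_natCast]
  rw [e]
  push_cast at key
  refine key.trans (le_of_eq ?_)
  rw [hl, List.length_map, ← pow_mul, mul_comm _ 2, pow_mul]
  norm_num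

theorem eq_emod_of_periodic {u : ℤ → ℝ} {q : ℕ} (hu : ∀ n, u (n + q) = u n) (k : ℕ) :
    u k = u ((k % q : ℕ) : ℤ) := by
  have h : ∀ t : ℕ, ∀ n, u (n + q * t) = u n := by
    intro t
    induction t with
    | zero => simp
    | succ t ih =>
      intro n
      rw [Nat.cast_succ, mul_add, mul_one, ← add_assoc, hu, ih]
  conv_lhs => rw [← Nat.mod_add_div k q]
  rw [Nat.cast_add, Nat.cast_mul, h]

theorem sum_range_mul_of_periodic {u v : ℤ → ℝ} {a b : ℕ} (ha : a ≠ 0) (hb : b ≠ 0)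
    (hab : a.Coprime b) (hu : ∀ n, u (n + a) = u n) (hv : ∀ n, v (n + b) = v n) :
    ∑ n ∈ Finset.range (a * b), u n * v n =
      (∑ n ∈ Finset.range a, u n) * ∑ n ∈ Finset.range b, v n := by
  rw [Finset.sum_mul_sum, ← Finset.sum_product']
  refine Finset.sum_nbij' (fun n => (n % a, n % b))
    (fun t => (Nat.chineseRemainder hab t.1 t.2 : ℕ)) ?_ ?_ ?_ ?_ ?_
  · intro n _
    simp [Nat.mod_lt _ (Nat.pos_of_ne_zero ha), Nat.mod_lt _ (Nat.pos_of_ne_zero hb)]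
  · intro t _
    simpa using Nat.chineseRemainder_lt_mul hab t.1 t.2 ha hb
  · intro n hn
    have h := (Nat.chineseRemainder hab (n % a) (n % b)).2
    have h1 := h.1.trans (Nat.mod_modEq n a)
    have h2 := h.2.trans (Nat.mod_modEq n b)
    have h3 := (Nat.modEq_and_modEq_iff_modEq_mul hab).mp ⟨h1, h2⟩
    exact h3.eq_of_lt_of_lt (Nat.chineseRemainder_lt_mul hab _ _ ha hb) (by simpa using hn)
  · intro t ht
    simp only [Finset.mem_product, Finset.mem_range] at ht
    have h := (Nat.chineseRemainder hab t.1 t.2).2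
    refine Prod.ext ?_ ?_
    · exact (show _ % a = t.1 % a from h.1).trans (Nat.mod_eq_of_lt ht.1)
    · exact (show _ % b = t.2 % b from h.2).trans (Nat.mod_eq_of_lt ht.2)
  · intro n _
    rw [eq_emod_of_periodic hu n, eq_emod_of_periodic hv n]

theorem abs_sum_range_cubeProd_le (P : Finset ℕ) (hP : ∀ p ∈ P, p.Prime ∧ Odd p) (hs : List ℤ)
    (B : ℕ → ℝ)
    (hB : ∀ p ∈ P, |∑ n ∈ Finset.range p, cubeProd (jacobiReal p) hs n| ≤ B p) :
    |∑ n ∈ Finset.range (∏ p ∈ P, p), cubeProd (jacobiReal (∏ p ∈ P, p)) hs n| ≤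
      ∏ p ∈ P, B p := by
  classical
  induction P using Finset.induction_on with
  | empty =>
    simpa using abs_cubeProd_le_one (fun n => abs_jacobiReal_le_one 1 n) hs 0
  | insert q P hq ih =>
    have hP' : ∀ p ∈ P, p.Prime ∧ Odd p := fun p hp => hP p (Finset.mem_insert_of_mem hp)
    have hqp := (hP q (Finset.mem_insert_self _ _)).1
    have h0 : ∏ p ∈ P, p ≠ 0 := Finset.prod_ne_zero_iff.mpr fun p hp => (hP' p hp).1.ne_zero
    have hco : q.Coprime (∏ p ∈ P, p) := by
      refine Nat.Coprime.prod_right fun p hp => ?_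
      rw [Nat.coprime_primes hqp (hP' p hp).1]
      rintro rfl
      exact hq hp
    rw [Finset.prod_insert hq, Finset.prod_insert hq]
    simp_rw [cubeProd_jacobiReal_mul hqp.ne_zero h0]
    rw [sum_range_mul_of_periodic hqp.ne_zero h0 hco
      (cubeProd_periodic (jacobiReal_periodic q) hs) (cubeProd_periodic (jacobiReal_periodic _) hs),
      abs_mul]
    have h1 := hB q (Finset.mem_insert_self _ _)
    exact mul_le_mul h1 (ih hP' fun p hp => hB p (Finset.mem_insert_of_mem hp)) (abs_nonneg _)
      ((abs_nonneg _).trans h1)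

theorem abs_sum_range_le_of_abs_le_one {f : ℤ → ℝ} (hf : ∀ n, |f n| ≤ 1) (a : ℤ) (K : ℕ) :
    |∑ i ∈ Finset.range K, f (a + i)| ≤ K := by
  refine (Finset.abs_sum_le_sum_abs _ _).trans ((Finset.sum_le_sum fun i _ => hf _).trans ?_)
  simp

/-- Bound for a complete sum; `E` absorbs the primes modulo which a shift degenerates. -/
theorem abs_sum_range_cubeProd_le_sqrt (P : Finset ℕ) (hP : ∀ p ∈ P, p.Prime ∧ Odd p)
    (hs : List ℤ) (E : ℕ) (hE : E ≠ 0) (hne : ∀ p ∈ P, ¬ p ∣ E → ∀ h ∈ hs, ¬ (p : ℤ) ∣ h) :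
    |∑ n ∈ Finset.range (∏ p ∈ P, p), cubeProd (jacobiReal (∏ p ∈ P, p)) hs n| ≤
      (11 * 4 ^ hs.length) ^ P.card * Real.sqrt (∏ p ∈ P, p : ℕ) * Real.sqrt E := by
  classical
  have hone : (1 : ℝ) ≤ 11 * 4 ^ hs.length := by
    have : (1 : ℝ) ≤ 4 ^ hs.length := one_le_pow₀ (by norm_num)
    linarith
  set B : ℕ → ℝ := fun p =>
    11 * 4 ^ hs.length * (Real.sqrt p * if p ∣ E then Real.sqrt p else 1) with hBdef
  refine (abs_sum_range_cubeProd_le P hP hs B ?_).trans ?_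
  · intro p hp
    by_cases hd : p ∣ E
    · have h1 := abs_sum_range_le_of_abs_le_one
        (abs_cubeProd_le_one (abs_jacobiReal_le_one p) hs) 0 p
      simp only [zero_add] at h1
      simp only [hBdef, hd, if_true, Real.mul_self_sqrt (Nat.cast_nonneg p)]
      exact h1.trans (le_mul_of_one_le_left (Nat.cast_nonneg _) hone)
    · simp only [hBdef, hd, if_false, mul_one]
      exact abs_sum_range_cubeProd_prime_le (hP p hp).1 (hP p hp).2 hs (hne p hp hd)
  · simp only [hBdef]
    rw [Finset.prod_mul_distrib, Finset.prod_const, Finset.prod_mul_distrib, mul_assoc]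
    have h1 : ∏ p ∈ P, Real.sqrt p = Real.sqrt (∏ p ∈ P, p : ℕ) := by
      push_cast
      rw [Real.sqrt_eq_rpow, ← Real.finsetProd_rpow _ _ fun i _ => Nat.cast_nonneg i]
      simp [Real.sqrt_eq_rpow]
    have h2 : (∏ p ∈ P, if p ∣ E then Real.sqrt p else 1) ≤ Real.sqrt E := by
      rw [← Finset.prod_filter]
      have h3 : ∏ p ∈ P.filter (· ∣ E), p ∣ E :=
        Finset.prod_primes_dvd E (fun p hp => (hP p (Finset.mem_filter.mp hp).1).1.prime)
          fun p hp => (Finset.mem_filter.mp hp).2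
      have h4 := Nat.le_of_dvd (Nat.pos_of_ne_zero hE) h3
      have h5 : ∏ p ∈ P.filter (· ∣ E), Real.sqrt p =
          Real.sqrt (∏ p ∈ P.filter (· ∣ E), p : ℕ) := by
        push_cast
        rw [Real.sqrt_eq_rpow, ← Real.finsetProd_rpow _ _ fun i _ => Nat.cast_nonneg i]
        simp [Real.sqrt_eq_rpow]
      rw [h5]
      exact Real.sqrt_le_sqrt (by exact_mod_cast h4)
    rw [h1]
    gcongr

theorem sum_range_shift_of_periodic {f : ℤ → ℝ} {q : ℕ} (hf : ∀ n, f (n + q) = f n) (a : ℤ) :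
    ∑ i ∈ Finset.range q, f (a + i) = ∑ i ∈ Finset.range q, f i := by
  have step : ∀ a : ℤ, ∑ i ∈ Finset.range q, f (a + 1 + i) = ∑ i ∈ Finset.range q, f (a + i) := by
    intro a
    have h1 := Finset.sum_range_succ (fun i : ℕ => f (a + i)) q
    have h2 := Finset.sum_range_succ' (fun i : ℕ => f (a + i)) q
    rw [h1] at h2
    simp only [hf, Nat.cast_zero, add_zero] at h2
    rw [add_left_inj] at h2
    rw [h2]
    refine Finset.sum_congr rfl fun i _ => ?_
    congr 1
    push_cast
    ring
  induction a using Int.induction_on with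
  | zero => simp
  | succ i ih => rw [step, ih]
  | pred i ih =>
    rw [← ih, ← step (-(i : ℤ) - 1)]
    simp

theorem abs_sum_range_le_of_periodic {f : ℤ → ℝ} {q : ℕ} (hq : q ≠ 0) (hf : ∀ n, |f n| ≤ 1)
    (hper : ∀ n, f (n + q) = f n) (a : ℤ) (K : ℕ) :
    |∑ i ∈ Finset.range K, f (a + i)| ≤
      q + K / q * |∑ i ∈ Finset.range q, f i| := by
  have hq' : (0 : ℝ) < q := by exact_mod_cast Nat.pos_of_ne_zero hq
  induction K using Nat.strong_induction_on generalizing a with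
  | _ K ih =>
    rcases lt_or_ge K q with h | h
    · refine (abs_sum_range_le_of_abs_le_one hf a K).trans ?_
      have : (K : ℝ) ≤ q := by exact_mod_cast h.le
      have : 0 ≤ (K : ℝ) / q * |∑ i ∈ Finset.range q, f i| := by positivity
      linarith
    · obtain ⟨K', rfl⟩ := Nat.exists_eq_add_of_le h
      rw [Finset.sum_range_add, sum_range_shift_of_periodic hper]
      have h1 := ih K' (by omega) (a + q)
      have h2 : ∑ x ∈ Finset.range K', f (a + ((q + x : ℕ) : ℤ)) =
          ∑ i ∈ Finset.range K', f (a + q + i) :=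
        Finset.sum_congr rfl fun i _ => by push_cast; rw [add_assoc]
      rw [h2]
      refine (abs_add_le _ _).trans ?_
      have h3 : ((q + K' : ℕ) : ℝ) / q = 1 + K' / q := by
        push_cast
        field_simp
      rw [h3]
      linarith

theorem sum_Ico_int_eq_sum_range (f : ℤ → ℝ) (a b : ℤ) :
    ∑ n ∈ Finset.Ico a b, f n = ∑ i ∈ Finset.range (b - a).toNat, f (a + i) := by
  refine Finset.sum_nbij' (fun n => (n - a).toNat) (fun i => a + i) ?_ ?_ ?_ ?_ ?_
  · intro n hn
    simp only [Finset.mem_Ico, Finset.mem_range] at hn ⊢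
    omega
  · intro n hn
    simp only [Finset.mem_Ico, Finset.mem_range] at hn ⊢
    omega
  · intro n hn
    simp only [Finset.mem_Ico] at hn
    omega
  · intro n hn
    simp
  · intro n hn
    simp only [Finset.mem_Ico] at hn
    congr 1
    omega

theorem abs_sum_Ico_le_of_periodic {f : ℤ → ℝ} {q : ℕ} (hq : q ≠ 0) (hf : ∀ n, |f n| ≤ 1)
    (hper : ∀ n, f (n + q) = f n) {L : ℝ} (hL : 0 ≤ L) {a b : ℤ} (hab : (b : ℝ) - a ≤ L) :
    |∑ n ∈ Finset.Ico a b, f n| ≤ q + L / q * |∑ i ∈ Finset.range q, f i| := by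
  rw [sum_Ico_int_eq_sum_range]
  refine (abs_sum_range_le_of_periodic hq hf hper a _).trans ?_
  have : (((b - a).toNat : ℕ) : ℝ) ≤ L := by
    rcases le_total (b - a) 0 with h | h
    · rw [Int.toNat_of_nonpos h]; simpa using hL
    · have h' : (((b - a).toNat : ℤ) : ℝ) = ((b - a : ℤ) : ℝ) := by rw [Int.toNat_of_nonneg h]
      rw [Int.cast_natCast] at h'
      rw [h']
      push_cast
      exact hab
  gcongr

end CompleteSum

section VanDerCorput

/-- The correlation of two shifts of `G` over an interval is a correlation sum over an interval. -/
theorem exists_Ico_sum_correlation (G : ℤ → ℝ) {a b A B x y : ℤ} (hA : A + x ≤ a)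
    (hB : b ≤ B + x) :
    ∃ a' b' : ℤ, (b' : ℝ) - a' ≤ (b : ℝ) - a ∧
      ∑ n ∈ Finset.Ico A B, (if n + x ∈ Finset.Ico a b then G (n + x) else 0) *
        (if n + y ∈ Finset.Ico a b then G (n + y) else 0) =
      ∑ m ∈ Finset.Ico a' b', G m * G (m + (y - x)) := by
  classical
  refine ⟨max a (a - (y - x)), min b (b - (y - x)), ?_, ?_⟩
  · have : min b (b - (y - x)) - max a (a - (y - x)) ≤ b - a := by omega
    exact_mod_cast this
  have e : ∀ n : ℤ, (if n + x ∈ Finset.Ico a b then G (n + x) else 0) *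
      (if n + y ∈ Finset.Ico a b then G (n + y) else 0) =
      if n + x ∈ Finset.Ico a b ∧ n + y ∈ Finset.Ico a b then G (n + x) * G (n + y) else 0 := by
    intro n
    by_cases h1 : n + x ∈ Finset.Ico a b <;> by_cases h2 : n + y ∈ Finset.Ico a b <;>
      simp [h1, h2]
  rw [Finset.sum_congr rfl fun n _ => e n, ← Finset.sum_filter]
  refine Finset.sum_nbij' (fun n => n + x) (fun m => m - x) ?_ ?_ ?_ ?_ ?_
  · intro n hn
    simp only [Finset.mem_filter, Finset.mem_Ico] at hn ⊢
    omega
  · intro n hn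
    simp only [Finset.mem_filter, Finset.mem_Ico] at hn ⊢
    omega
  · intro n _
    ring
  · intro n _
    ring
  · intro n _
    congr 2
    ring

theorem sum_Ico_eq_sum_shift {u G : ℤ → ℝ} {a b A B x : ℤ} (hu : ∀ n, u (n + x) = u n)
    (hA : A + x ≤ a) (hB : b ≤ B + x) :
    ∑ n ∈ Finset.Ico a b, u n * G n =
      ∑ n ∈ Finset.Ico A B, u n * if n + x ∈ Finset.Ico a b then G (n + x) else 0 := by
  have e : ∀ n : ℤ, (u n * if n + x ∈ Finset.Ico a b then G (n + x) else 0) =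
      if n + x ∈ Finset.Ico a b then u (n + x) * G (n + x) else 0 := by
    intro n
    rw [hu, mul_ite, mul_zero]
  rw [Finset.sum_congr rfl fun n _ => e n, ← Finset.sum_filter]
  refine Finset.sum_nbij' (fun m => m - x) (fun n => n + x) ?_ ?_ ?_ ?_ ?_
  · intro n hn
    simp only [Finset.mem_filter, Finset.mem_Ico] at hn ⊢
    omega
  · intro n hn
    simp only [Finset.mem_filter, Finset.mem_Ico] at hn ⊢
    omega
  · intro n _
    ring
  · intro n _
    ring
  · intro n _
    rw [sub_add_cancel]

/-- The van der Corput inequality with shifts by multiples of the period `q` of `u`. -/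
theorem sq_sum_Ico_le_of_correlation_le {u G : ℤ → ℝ} {q H : ℕ} (hH : 0 < H)
    (hu : ∀ n, |u n| ≤ 1) (hper : ∀ n, u (n + q) = u n) (hG : ∀ n, |G n| ≤ 1) {L D : ℝ}
    (hL : 0 ≤ L) (hD0 : 0 ≤ D) (hqH : (H : ℝ) * q ≤ L)
    (hD : ∀ t : ℤ, t ≠ 0 → |t| < H → ∀ a b : ℤ, (b : ℝ) - a ≤ L →
      |∑ n ∈ Finset.Ico a b, G n * G (n + t * q)| ≤ D)
    {a b : ℤ} (hab : (b : ℝ) - a ≤ L) :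
    (∑ n ∈ Finset.Ico a b, u n * G n) ^ 2 ≤ 2 * L * (L / H + D) := by
  classical
  rcases lt_or_ge b a with hba | hba
  · rw [Finset.Ico_eq_empty (by omega)]
    simp only [Finset.sum_empty, ne_eq, OfNat.ofNat_ne_zero, not_false_eq_true, zero_pow]
    positivity
  have hH' : (0 : ℝ) < H := by exact_mod_cast hH
  set S := ∑ n ∈ Finset.Ico a b, u n * G n with hS
  set W := Finset.Ico (a - H * q) b with hW
  set g : ℕ → ℤ → ℝ := fun h n =>
    if n + (h * q : ℕ) ∈ Finset.Ico a b then G (n + (h * q : ℕ)) else 0 with hg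
  have hperh : ∀ (h : ℕ) (n : ℤ), u (n + (h * q : ℕ)) = u n := by
    intro h
    induction h with
    | zero => simp
    | succ h ih =>
      intro n
      rw [Nat.succ_mul, Nat.cast_add, ← add_assoc, hper, ih]
  have hbd : ∀ h ∈ Finset.range H, (a - H * q) + ((h * q : ℕ) : ℤ) ≤ a ∧
      b ≤ b + ((h * q : ℕ) : ℤ) := by
    intro h hh
    have h1 : h * q ≤ H * q := Nat.mul_le_mul_right _ (Finset.mem_range.mp hh).le
    have h2 : ((h * q : ℕ) : ℤ) ≤ (H * q : ℕ) := by exact_mod_cast h1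
    have h3 : (0 : ℤ) ≤ ((h * q : ℕ) : ℤ) := Int.natCast_nonneg _
    push_cast at h2 h3 ⊢
    constructor <;> linarith
  have hshift : (H : ℝ) * S = ∑ n ∈ W, u n * ∑ h ∈ Finset.range H, g h n := by
    have h1 : ∀ h ∈ Finset.range H, S = ∑ n ∈ W, u n * g h n := fun h hh =>
      sum_Ico_eq_sum_shift (hperh h) (hbd h hh).1 (hbd h hh).2
    have h2 : (H : ℝ) * S = ∑ _h ∈ Finset.range H, S := by simp
    rw [h2, Finset.sum_congr rfl h1, Finset.sum_comm]
    simp_rw [Finset.mul_sum]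
  have hWcard : (W.card : ℝ) ≤ 2 * L := by
    rw [hW, Int.card_Ico]
    have h0 : (0 : ℤ) ≤ b - (a - H * q) := by
      have : (0 : ℤ) ≤ (H : ℤ) * q := by positivity
      linarith
    have h' : (((b - (a - H * q)).toNat : ℤ) : ℝ) = ((b - (a - H * q) : ℤ) : ℝ) := by
      rw [Int.toNat_of_nonneg h0]
    rw [Int.cast_natCast] at h'
    rw [h']
    push_cast
    linarith
  have hpair : ∀ h ∈ Finset.range H, ∀ h' ∈ Finset.range H,
      ∑ n ∈ W, g h n * g h' n ≤ if h = h' then L else D := by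
    intro h hh h' hh'
    obtain ⟨a', b', hab', e⟩ := exists_Ico_sum_correlation G (y := ((h' * q : ℕ) : ℤ))
      (hbd h hh).1 (hbd h hh).2
    have e' : ∑ n ∈ W, g h n * g h' n =
        ∑ m ∈ Finset.Ico a' b', G m * G (m + (((h' * q : ℕ) : ℤ) - (h * q : ℕ))) := e
    rw [e']
    split_ifs with heq
    · subst heq
      simp only [sub_self, add_zero]
      have h1 : ∀ m, G m * G m ≤ 1 := fun m => by
        have := abs_le.mp (hG m)
        nlinarith
      refine (Finset.sum_le_sum fun m _ => h1 m).trans ?_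
      rw [Finset.sum_const, Int.card_Ico, nsmul_eq_mul, mul_one]
      rcases le_total (b' - a') 0 with h0 | h0
      · rw [Int.toNat_of_nonpos h0]; simpa using hL
      · have h' : (((b' - a').toNat : ℤ) : ℝ) = ((b' - a' : ℤ) : ℝ) := by
          rw [Int.toNat_of_nonneg h0]
        rw [Int.cast_natCast] at h'
        rw [h']
        push_cast
        linarith
    · have e2 : ((h' * q : ℕ) : ℤ) - (h * q : ℕ) = ((h' : ℤ) - h) * q := by push_cast; ring
      rw [e2]
      rw [Finset.mem_range] at hh hh'
      refine (le_abs_self _).trans (hD _ ?_ ?_ a' b' (hab'.trans hab))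
      · omega
      · rw [abs_lt]; omega
  have hsq : ∑ n ∈ W, (∑ h ∈ Finset.range H, g h n) ^ 2 ≤ H * L + (H : ℝ) ^ 2 * D := by
    have h1 : ∑ n ∈ W, (∑ h ∈ Finset.range H, g h n) ^ 2 =
        ∑ h ∈ Finset.range H, ∑ h' ∈ Finset.range H, ∑ n ∈ W, g h n * g h' n := by
      simp_rw [pow_two, Finset.sum_mul_sum]
      rw [Finset.sum_comm]
      refine Finset.sum_congr rfl fun h _ => ?_
      rw [Finset.sum_comm]
    rw [h1]
    have h2 : ∀ h ∈ Finset.range H, ∑ h' ∈ Finset.range H, ∑ n ∈ W, g h n * g h' n ≤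
        L + H * D := by
      intro h hh
      calc _ ≤ ∑ h' ∈ Finset.range H, ((if h = h' then L else 0) + D) := by
            refine Finset.sum_le_sum fun h' hh' => (hpair h hh h' hh').trans ?_
            split_ifs <;> linarith
        _ = L + H * D := by
            rw [Finset.sum_add_distrib, Finset.sum_ite_eq, if_pos hh]
            simp
    refine (Finset.sum_le_sum h2).trans (le_of_eq ?_)
    simp
    ring
  have hcs : ((H : ℝ) * S) ^ 2 ≤ W.card * ∑ n ∈ W, (∑ h ∈ Finset.range H, g h n) ^ 2 := by
    rw [hshift]
    refine (Finset.sum_mul_sq_le_sq_mul_sq W _ _).trans ?_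
    gcongr
    have : ∀ n ∈ W, u n ^ 2 ≤ 1 := fun n _ => by
      have := abs_le.mp (hu n)
      nlinarith
    refine (Finset.sum_le_sum this).trans ?_
    simp
  have hfin : (H : ℝ) ^ 2 * S ^ 2 ≤ (H : ℝ) ^ 2 * (2 * L * (L / H + D)) := by
    calc (H : ℝ) ^ 2 * S ^ 2 = (H * S) ^ 2 := by ring
      _ ≤ W.card * ∑ n ∈ W, (∑ h ∈ Finset.range H, g h n) ^ 2 := hcs
      _ ≤ 2 * L * (H * L + (H : ℝ) ^ 2 * D) := by
          gcongr
      _ = _ := by field_simp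
  exact le_of_mul_le_mul_left hfin (by positivity)

/-- All sums of `f` over integer intervals of length at most `L` are at most `δ L`. -/
def ShortSumsLE (L δ : ℝ) (f : ℤ → ℝ) : Prop :=
  ∀ a b : ℤ, (b : ℝ) - a ≤ L → |∑ n ∈ Finset.Ico a b, f n| ≤ δ * L

theorem ShortSumsLE.of_correlations {L δ : ℝ} {q Q H : ℕ} {hs : List ℤ} (hq : q ≠ 0) (hQ : Q ≠ 0)
    (hH : 0 < H) (hL : 0 ≤ L) (hHδ : 1 / (H : ℝ) ≤ δ) (hqH : (H : ℝ) * q ≤ L)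
    (h : ∀ t : ℤ, t ≠ 0 → |t| < H →
      ShortSumsLE L δ (cubeProd (jacobiReal Q) ((t * q) :: hs))) :
    ShortSumsLE L (2 * Real.sqrt δ) (cubeProd (jacobiReal (q * Q)) hs) := by
  have hδ : 0 ≤ δ := le_trans (by positivity) hHδ
  intro a b hab
  simp_rw [cubeProd_jacobiReal_mul hq hQ]
  have key := sq_sum_Ico_le_of_correlation_le hH
    (abs_cubeProd_le_one (abs_jacobiReal_le_one q) hs)
    (cubeProd_periodic (jacobiReal_periodic q) hs)
    (abs_cubeProd_le_one (abs_jacobiReal_le_one Q) hs) hL (mul_nonneg hδ hL) hqH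
    (fun t ht htH => h t ht htH) hab
  apply abs_le_of_sq_le_sq _ (by positivity)
  refine key.trans ?_
  rw [mul_pow, mul_pow, Real.sq_sqrt hδ]
  have : L / H ≤ δ * L := by
    rw [div_eq_mul_one_div, mul_comm]
    gcongr
  nlinarith

theorem ShortSumsLE.of_complete_sums {L δ : ℝ} {H k : ℕ} {P : Finset ℕ}
    (hP : ∀ p ∈ P, p.Prime) (hH : 0 < H) (hL : 0 ≤ L) (hHδ : 1 / (H : ℝ) ≤ δ) (hδ1 : δ ≤ 1)
    (hbase : ∀ (hs : List ℤ) (E : ℕ), hs.length = k → E ≠ 0 → E ≤ H ^ k →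
      (∀ p ∈ P, ¬ p ∣ E → ∀ h ∈ hs, ¬ (p : ℤ) ∣ h) →
      ShortSumsLE L δ (cubeProd (jacobiReal (∏ p ∈ P, p)) hs))
    (qs : List ℕ) (hqs : ∀ q ∈ qs, q ≠ 0 ∧ (∀ p ∈ P, ¬ p ∣ q) ∧ (H : ℝ) * q ≤ L)
    (hs : List ℤ) (E : ℕ) (hlen : hs.length + qs.length = k) (hE : E ≠ 0)
    (hEH : E ≤ H ^ hs.length) (hne : ∀ p ∈ P, ¬ p ∣ E → ∀ h ∈ hs, ¬ (p : ℤ) ∣ h) :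
    ShortSumsLE L (4 * δ ^ ((1 / 2 : ℝ) ^ qs.length))
      (cubeProd (jacobiReal (qs.prod * ∏ p ∈ P, p)) hs) := by
  have hH' : (0 : ℝ) < H := by exact_mod_cast hH
  have hδ0 : 0 < δ := lt_of_lt_of_le (by positivity) hHδ
  have hQ : ∏ p ∈ P, p ≠ 0 := Finset.prod_ne_zero_iff.mpr fun p hp => (hP p hp).ne_zero
  induction qs generalizing hs E with
  | nil =>
    have h := hbase hs E (by simpa using hlen) hE (by simp at hlen; rwa [← hlen]) hne
    intro a b hab
    have h1 := h a b hab
    simp only [List.prod_nil, one_mul, List.length_nil, pow_zero, Real.rpow_one]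
    refine h1.trans ?_
    nlinarith [mul_nonneg hδ0.le hL]
  | cons q qs ih =>
    have hq := hqs q List.mem_cons_self
    have hqs' : ∀ q ∈ qs, q ≠ 0 ∧ (∀ p ∈ P, ¬ p ∣ q) ∧ (H : ℝ) * q ≤ L := fun q' h' =>
      hqs q' (List.mem_cons_of_mem _ h')
    have hprod : qs.prod ≠ 0 := by
      rw [Ne, List.prod_eq_zero_iff]
      intro h0
      exact (hqs' 0 h0).1 rfl
    set y := δ ^ ((1 / 2 : ℝ) ^ qs.length) with hy
    have hy0 : 0 < y := Real.rpow_pos_of_pos hδ0 _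
    have hyδ : δ ≤ y := by
      have h1 : (1 / 2 : ℝ) ^ qs.length ≤ 1 := pow_le_one₀ (by norm_num) (by norm_num)
      calc δ = δ ^ (1 : ℝ) := (Real.rpow_one δ).symm
        _ ≤ y := Real.rpow_le_rpow_of_exponent_ge hδ0 hδ1 h1
    have step := ShortSumsLE.of_correlations (hs := hs) (δ := 4 * y) hq.1 (mul_ne_zero hprod hQ)
      hH hL (by linarith) hq.2.2 (by
        intro t ht htH
        refine ih hqs' ((t * q) :: hs) (E * t.natAbs) ?_ ?_ ?_ ?_
        · simp only [List.length_cons] at hlen ⊢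
          omega
        · exact mul_ne_zero hE (Int.natAbs_ne_zero.mpr ht)
        · rw [List.length_cons, pow_succ]
          refine Nat.mul_le_mul hEH ?_
          rw [Int.abs_eq_natAbs] at htH
          omega
        · intro p hp hpE h hh
          have hpE1 : ¬ p ∣ E := fun hd => hpE (hd.mul_right _)
          rcases List.mem_cons.mp hh with rfl | hh
          · intro hd
            rcases Int.Prime.dvd_mul' (hP p hp) hd with h1 | h1
            · exact hpE ((Int.natCast_dvd.mp h1).mul_left _)
            · exact hq.2.1 p hp (by exact_mod_cast h1)
          · exact hne p hp hpE1 h hh)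
    have e : 2 * Real.sqrt (4 * y) = 4 * δ ^ ((1 / 2 : ℝ) ^ (q :: qs).length) := by
      have h4 : Real.sqrt 4 = 2 := by
        rw [show (4 : ℝ) = 2 ^ 2 by norm_num, Real.sqrt_sq (by norm_num)]
      rw [Real.sqrt_mul (by norm_num), h4, hy, Real.sqrt_eq_rpow, ← Real.rpow_mul hδ0.le,
        List.length_cons, pow_succ]
      ring
    rw [e, ← mul_assoc, ← List.prod_cons] at step
    exact step

end VanDerCorput

section Factorization

/-- Greedy splitting of a product of numbers at most `y` into factors from `[Q / y, Q]`, up to one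
leftover factor. -/
theorem exists_factors_of_le {Q y : ℝ} (hy : 1 ≤ y) (hyQ : y ≤ Q) (D : Finset ℕ)
    (hD : ∀ p ∈ D, p ≠ 0 ∧ (p : ℝ) ≤ y) :
    ∃ (r : ℕ) (qs : List ℕ), r * qs.prod = ∏ p ∈ D, p ∧ r ≠ 0 ∧ (r : ℝ) ≤ Q ∧
      ∀ q ∈ qs, (q : ℝ) ≤ Q ∧ Q / y ≤ q := by
  classical
  induction D using Finset.induction_on with
  | empty => exact ⟨1, [], by simp, one_ne_zero, by simpa using hy.trans hyQ, by simp⟩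
  | insert p D hp ih =>
    obtain ⟨r, qs, hprod, hr, hrQ, hqs⟩ := ih fun p hp => hD p (Finset.mem_insert_of_mem hp)
    obtain ⟨hp0, hpy⟩ := hD p (Finset.mem_insert_self _ _)
    rcases le_or_gt ((p : ℝ) * r) Q with h | h
    · refine ⟨p * r, qs, ?_, mul_ne_zero hp0 hr, by exact_mod_cast h, hqs⟩
      rw [Finset.prod_insert hp, ← hprod, mul_assoc]
    · refine ⟨p, r :: qs, ?_, hp0, hpy.trans hyQ, ?_⟩
      · rw [Finset.prod_insert hp, ← hprod, List.prod_cons]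
      · intro q hq
        rcases List.mem_cons.mp hq with rfl | hq
        · refine ⟨hrQ, ?_⟩
          rw [div_le_iff₀ (by linarith), mul_comm]
          exact h.le.trans (by gcongr)
        · exact hqs q hq

theorem pow_length_le_prod {R : ℝ} (hR : 0 ≤ R) (qs : List ℕ) (h : ∀ q ∈ qs, R ≤ (q : ℝ)) :
    R ^ qs.length ≤ (qs.prod : ℝ) := by
  induction qs with
  | nil => simp
  | cons q qs ih =>
    rw [List.length_cons, pow_succ', List.prod_cons, Nat.cast_mul]
    have h1 := h q List.mem_cons_self
    have h2 := ih fun q hq => h q (List.mem_cons_of_mem _ hq)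
    exact mul_le_mul h1 h2 (pow_nonneg hR _) (hR.trans h1)

/-- A product of distinct primes exceeding `Q` has a subproduct in `[Q / y, Q]` whose cofactor
splits into few factors of size at most `Q`. -/
theorem exists_subset_and_factors {Q y : ℝ} (hy : 1 ≤ y) (hyQ : y ≤ Q) (D : Finset ℕ)
    (hD : ∀ p ∈ D, p.Prime ∧ (p : ℝ) ≤ y) (hDQ : Q < (∏ p ∈ D, p : ℕ)) :
    ∃ (P : Finset ℕ) (qs : List ℕ), P ⊆ D ∧ qs.prod * ∏ p ∈ P, p = ∏ p ∈ D, p ∧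
      ((∏ p ∈ P, p : ℕ) : ℝ) ≤ Q ∧ Q / y ≤ ((∏ p ∈ P, p : ℕ) : ℝ) ∧
      (∀ q ∈ qs, q ≠ 0 ∧ (∀ p ∈ P, ¬ p ∣ q) ∧ (q : ℝ) ≤ Q) ∧
      (Q / y) ^ qs.length ≤ ((∏ p ∈ D, p : ℕ) : ℝ) := by
  classical
  have hR : 0 ≤ Q / y := div_nonneg (by linarith) (by linarith)
  obtain ⟨P, hPmem, hPmax⟩ := Finset.exists_max_image
    (D.powerset.filter fun P => ((∏ p ∈ P, p : ℕ) : ℝ) ≤ Q) Finset.card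
    ⟨∅, by simpa using hy.trans hyQ⟩
  simp only [Finset.mem_filter, Finset.mem_powerset] at hPmem hPmax
  obtain ⟨hPD, hPQ⟩ := hPmem
  have hne : (D \ P).Nonempty := by
    rw [Finset.sdiff_nonempty]
    intro h
    rw [Finset.Subset.antisymm h hPD] at hDQ
    linarith
  obtain ⟨p, hp⟩ := hne
  obtain ⟨hpD, hpP⟩ := Finset.mem_sdiff.mp hp
  have hPlow : Q / y ≤ ((∏ p ∈ P, p : ℕ) : ℝ) := by
    have h1 : Q < ((∏ p ∈ insert p P, p : ℕ) : ℝ) := by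
      by_contra! h
      have h2 := hPmax (insert p P) ⟨Finset.insert_subset hpD hPD, h⟩
      rw [Finset.card_insert_of_notMem hpP] at h2
      omega
    rw [Finset.prod_insert hpP, Nat.cast_mul] at h1
    rw [div_le_iff₀ (by linarith), mul_comm]
    have := (hD p hpD).2
    exact h1.le.trans (by gcongr)
  obtain ⟨r, qs, hprod, hr, hrQ, hqs⟩ := exists_factors_of_le hy hyQ (D \ P) fun p hp =>
    ⟨(hD p (Finset.mem_sdiff.mp hp).1).1.ne_zero, (hD p (Finset.mem_sdiff.mp hp).1).2⟩
  have hsplit : (r :: qs).prod * ∏ p ∈ P, p = ∏ p ∈ D, p := by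
    rw [List.prod_cons, hprod, Finset.prod_sdiff hPD]
  have hD0 : ∏ p ∈ D, p ≠ 0 := Finset.prod_ne_zero_iff.mpr fun p hp => (hD p hp).1.ne_zero
  refine ⟨P, r :: qs, hPD, hsplit, hPQ, hPlow, ?_, ?_⟩
  · intro q hq
    have hqd : q ∣ ∏ p ∈ D \ P, p := by
      rw [← hprod, ← List.prod_cons]
      exact List.dvd_prod hq
    refine ⟨?_, ?_, ?_⟩
    · rintro rfl
      rw [List.prod_eq_zero hq, zero_mul] at hsplit
      exact hD0 hsplit.symm
    · intro s hs hsq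
      obtain ⟨t, ht, hst⟩ := (Prime.dvd_finsetProd_iff (hD s (hPD hs)).1.prime _).mp
        (hsq.trans hqd)
      obtain ⟨ht1, ht2⟩ := Finset.mem_sdiff.mp ht
      rw [(Nat.prime_dvd_prime_iff_eq (hD s (hPD hs)).1 (hD t ht1).1).mp hst] at hs
      exact ht2 hs
    · rcases List.mem_cons.mp hq with rfl | hq
      · exact hrQ
      · exact (hqs q hq).1
  · rw [← hsplit, List.length_cons, pow_succ, List.prod_cons, Nat.cast_mul]
    refine mul_le_mul ?_ hPlow hR (Nat.cast_nonneg _)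
    refine (pow_length_le_prod hR qs fun q hq => (hqs q hq).2).trans ?_
    exact_mod_cast Nat.le_mul_of_pos_left _ (Nat.pos_of_ne_zero hr)

end Factorization

section ShortCharacterSums

theorem sum_range_jacobiReal_prime {p : ℕ} (hp : p.Prime) (hodd : Odd p) :
    ∑ n ∈ Finset.range p, jacobiReal p n = 0 := by
  have : Fact p.Prime := ⟨hp⟩
  have e := sum_range_natCast_zmod p fun x => ((quadraticChar (ZMod p) x : ℤ) : ℝ)
  have h1 : ∑ x : ZMod p, quadraticChar (ZMod p) x = 0 := by
    refine quadraticChar_sum_zero ?_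
    rw [ZMod.ringChar_zmod_n]
    rintro rfl
    exact absurd hodd (by decide)
  have h3 : ∑ x : ZMod p, ((quadraticChar (ZMod p) x : ℤ) : ℝ) = 0 := by exact_mod_cast h1
  rw [← h3, ← e]
  refine Finset.sum_congr rfl fun n _ => ?_
  have h2 := cubeProd_jacobiReal_prime p [] n
  simpa [cubeProd, cubePoly] using h2

theorem sum_range_jacobiReal_eq_zero {D : Finset ℕ} (hD : ∀ p ∈ D, p.Prime ∧ Odd p)
    (hne : D.Nonempty) :
    ∑ n ∈ Finset.range (∏ p ∈ D, p), jacobiReal (∏ p ∈ D, p) n = 0 := by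
  have h := abs_sum_range_cubeProd_le D hD [] (fun _ => 0) fun p hp => by
    simp only [cubeProd]
    rw [sum_range_jacobiReal_prime (hD p hp).1 (hD p hp).2, abs_zero]
  rw [Finset.prod_const, zero_pow (Finset.card_ne_zero.mpr hne)] at h
  exact abs_nonpos_iff.mp h

theorem shortSumsLE_jacobiReal {Q y L : ℝ} {H K : ℕ} (hy : 1 ≤ y) (hyQ : y ≤ Q) (hH : 2 ≤ H)
    (hHQ : H * Q ≤ L) {D : Finset ℕ} (hD : ∀ p ∈ D, p.Prime ∧ Odd p ∧ (p : ℝ) ≤ y)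
    (hne : D.Nonempty) (hK : ∀ k : ℕ, (Q / y) ^ k ≤ ((∏ p ∈ D, p : ℕ) : ℝ) → k ≤ K)
    (hbound : (11 * 4 ^ K : ℝ) ^ D.card * Real.sqrt (H ^ K) * H ≤ Real.sqrt (Q / y)) :
    ShortSumsLE L (4 * (2 / H : ℝ) ^ ((1 / 2 : ℝ) ^ K)) (jacobiReal (∏ p ∈ D, p)) := by
  have hH0 : (0 : ℝ) < H := by positivity
  have hH2 : (2 : ℝ) ≤ H := by exact_mod_cast hH
  have hδ1 : (2 / H : ℝ) ≤ 1 := (div_le_one hH0).mpr hH2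
  have hδ0 : (0 : ℝ) < 2 / H := by positivity
  have hL : 0 < L := lt_of_lt_of_le (mul_pos hH0 (by linarith)) hHQ
  have hQL : Q ≤ 1 / H * L := by
    rw [one_div, inv_mul_eq_div, le_div_iff₀ hH0]
    linarith
  have hδle : ∀ t : ℝ, t ≤ 1 → (2 / H : ℝ) ≤ (2 / H : ℝ) ^ t := fun t ht => by
    conv_lhs => rw [← Real.rpow_one (2 / H : ℝ)]
    exact Real.rpow_le_rpow_of_exponent_ge hδ0 hδ1 ht
  have hD0 : ∏ p ∈ D, p ≠ 0 := Finset.prod_ne_zero_iff.mpr fun p hp => (hD p hp).1.ne_zero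
  rcases le_or_gt (((∏ p ∈ D, p : ℕ) : ℝ)) Q with hsmall | hlarge
  · intro a b hab
    have h := abs_sum_Ico_le_of_periodic hD0 (abs_jacobiReal_le_one _) (jacobiReal_periodic _)
      hL.le hab
    rw [sum_range_jacobiReal_eq_zero (fun p hp => ⟨(hD p hp).1, (hD p hp).2.1⟩) hne, abs_zero,
      mul_zero, add_zero] at h
    have h2 := hδle ((1 / 2 : ℝ) ^ K) (pow_le_one₀ (by norm_num) (by norm_num))
    have h3 : (1 / H : ℝ) ≤ 2 / H := by gcongr; norm_num
    calc _ ≤ _ := h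
      _ ≤ Q := hsmall
      _ ≤ 1 / H * L := hQL
      _ ≤ _ := by gcongr; linarith
  · obtain ⟨P, qs, hPD, hprod, hPQ, hPlow, hqs, hlen⟩ := exists_subset_and_factors hy hyQ D
      (fun p hp => ⟨(hD p hp).1, (hD p hp).2.2⟩) hlarge
    have hkK := hK _ hlen
    have hP : ∀ p ∈ P, p.Prime ∧ Odd p := fun p hp => ⟨(hD p (hPD hp)).1, (hD p (hPD hp)).2.1⟩
    have hP0 : ∏ p ∈ P, p ≠ 0 := Finset.prod_ne_zero_iff.mpr fun p hp => (hP p hp).1.ne_zero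
    have hPpos : (0 : ℝ) < (∏ p ∈ P, p : ℕ) := by exact_mod_cast Nat.pos_of_ne_zero hP0
    have main := ShortSumsLE.of_complete_sums (L := L) (δ := 2 / H) (H := H) (k := qs.length)
      (P := P) (fun p hp => (hP p hp).1) (by omega) hL.le (by gcongr; norm_num) hδ1 (by
        intro hs E hl hE hEH hnd a b hab
        have h1 := abs_sum_Ico_le_of_periodic hP0
          (abs_cubeProd_le_one (abs_jacobiReal_le_one _) hs)
          (cubeProd_periodic (jacobiReal_periodic (∏ p ∈ P, p)) hs) hL.le hab
        have h2 := abs_sum_range_cubeProd_le_sqrt P hP hs E hE hnd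
        set q : ℝ := ((∏ p ∈ P, p : ℕ) : ℝ) with hq
        have h3 : (11 * 4 ^ hs.length : ℝ) ^ P.card * Real.sqrt E * H ≤ Real.sqrt q := by
          refine le_trans ?_ (hbound.trans (Real.sqrt_le_sqrt hPlow))
          have e1 : (11 * 4 ^ hs.length : ℝ) ^ P.card ≤ (11 * 4 ^ K) ^ D.card := by
            have h4 : (4 : ℝ) ^ hs.length ≤ 4 ^ K :=
              pow_le_pow_right₀ (by norm_num) (by omega)
            have h5 : (1 : ℝ) ≤ 4 ^ K := one_le_pow₀ (by norm_num)
            calc (11 * 4 ^ hs.length : ℝ) ^ P.card ≤ (11 * 4 ^ K) ^ P.card := by gcongr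
              _ ≤ _ := pow_le_pow_right₀ (by linarith) (Finset.card_le_card hPD)
          have e2 : Real.sqrt E ≤ Real.sqrt (H ^ K) := by
            refine Real.sqrt_le_sqrt ?_
            have : E ≤ H ^ K := hEH.trans (Nat.pow_le_pow_right (by omega) (by omega))
            exact_mod_cast this
          gcongr
        have h4 : L / q * |∑ i ∈ Finset.range (∏ p ∈ P, p),
            cubeProd (jacobiReal (∏ p ∈ P, p)) hs i| ≤ 1 / H * L := by
          have hsq : Real.sqrt q * Real.sqrt q = q := Real.mul_self_sqrt hPpos.le
          calc _ ≤ L / q * ((11 * 4 ^ hs.length) ^ P.card * Real.sqrt q * Real.sqrt E) := by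
                gcongr
            _ = L / q * Real.sqrt q * ((11 * 4 ^ hs.length) ^ P.card * Real.sqrt E * H) / H := by
                field_simp
            _ ≤ L / q * Real.sqrt q * Real.sqrt q / H := by gcongr
            _ = 1 / H * L := by rw [mul_assoc, hsq]; field_simp
        have h5 : (2 / H : ℝ) = 1 / H + 1 / H := by ring
        rw [h5, add_mul]
        linarith)
      qs (fun q hq => ⟨(hqs q hq).1, (hqs q hq).2.1,
        (mul_le_mul_of_nonneg_left (hqs q hq).2.2 hH0.le).trans hHQ⟩)
      [] 1 (by simp) one_ne_zero (by simp) (by simp)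
    rw [hprod] at main
    intro a b hab
    refine (main a b hab).trans ?_
    have h6 : (1 / 2 : ℝ) ^ K ≤ (1 / 2 : ℝ) ^ qs.length :=
      pow_le_pow_of_le_one (by norm_num) (by norm_num) hkK
    have h7 := Real.rpow_le_rpow_of_exponent_ge hδ0 hδ1 h6
    gcongr

end ShortCharacterSums

section Asymptotics

open Filter

theorem Mx_eq_primorial (x : ℝ) : Mx x = primorial ⌊x⌋₊ := by
  unfold Mx primesUpTo primorial
  refine Finset.prod_congr ?_ fun _ _ => rfl
  ext p
  simp

theorem mem_primesUpTo {x : ℝ} (hx : 0 ≤ x) {p : ℕ} :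
    p ∈ primesUpTo x ↔ p.Prime ∧ (p : ℝ) ≤ x := by
  simp [primesUpTo, Nat.le_floor_iff hx, and_comm]

theorem card_primesUpTo (x : ℝ) : (primesUpTo x).card = Nat.primeCounting ⌊x⌋₊ := by
  rw [Nat.primeCounting, Nat.primeCounting', Nat.count_eq_card_filter_range, primesUpTo]
  congr 1
  ext p
  simp

theorem eventually_card_primesUpTo_le :
    ∀ᶠ x : ℝ in atTop, ((primesUpTo x).card : ℝ) ≤ 2 * (x / Real.log x) := by
  have h4 : Real.log 4 < 1.5 := by
    rw [show (4 : ℝ) = 2 ^ 2 by norm_num, Real.log_pow]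
    have := Real.log_two_lt_d9
    norm_num at this ⊢
    linarith
  filter_upwards [Chebyshev.eventually_primeCounting_le (ε := 0.5) (by norm_num),
    eventually_ge_atTop 2] with x hx hx2
  rw [card_primesUpTo]
  refine hx.trans ?_
  rw [mul_div_assoc]
  have : 0 ≤ x / Real.log x := div_nonneg (by linarith) (Real.log_nonneg (by linarith))
  gcongr
  linarith

/-- Writing `v = log log x`, the numbers `v`, `log x = exp v` and `x` are widely separated. -/
theorem eventually_scales (B : ℝ) : ∀ᶠ x : ℝ in atTop, ∃ v w : ℝ, B ≤ v ∧ 1000 ≤ v ∧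
    v = Real.log (Real.log x) ∧ w = Real.exp (v / 4) ∧ w ^ 4 = Real.log x ∧ 1000 * v ^ 2 ≤ w ∧
    (w ^ 4) ^ 3 ≤ x ∧ x = Real.exp (w ^ 4) := by
  have hv : Tendsto (fun x : ℝ => Real.log (Real.log x)) atTop atTop :=
    Real.tendsto_log_atTop.comp Real.tendsto_log_atTop
  have hu := Real.tendsto_log_atTop
  filter_upwards [hv.eventually_ge_atTop B, hv.eventually_ge_atTop 384000,
    hu.eventually_ge_atTop 24, eventually_gt_atTop 0] with x h1 h2 h3 h4
  have hw4 : Real.exp (Real.log (Real.log x) / 4) ^ 4 = Real.log x := by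
    rw [← Real.exp_nat_mul]
    push_cast
    rw [mul_div_cancel₀ _ (by norm_num), Real.exp_log (by linarith)]
  refine ⟨_, _, h1, by linarith, rfl, rfl, hw4, ?_, ?_, ?_⟩
  · set v := Real.log (Real.log x)
    have h := Real.pow_div_factorial_le_exp (v / 4) (by linarith) 3
    refine le_trans ?_ h
    norm_num [Nat.factorial]
    nlinarith [sq_nonneg v]
  · rw [hw4]
    have h := Real.pow_div_factorial_le_exp (Real.log x) (by linarith) 4
    rw [Real.exp_log h4] at h
    refine le_trans ?_ h
    norm_num [Nat.factorial]
    have : 0 ≤ Real.log x ^ 3 := by positivity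
    nlinarith
  · rw [hw4, Real.exp_log h4]

theorem prod_le_four_rpow {x : ℝ} (hx : 0 ≤ x) {D : Finset ℕ} (hD : D ⊆ primesUpTo x) :
    ((∏ p ∈ D, p : ℕ) : ℝ) ≤ Real.exp (x * Real.log 4) := by
  have h1 : ∏ p ∈ D, p ≤ Mx x :=
    Finset.prod_le_prod_of_subset_of_one_le' hD fun p hp _ =>
      ((mem_primesUpTo hx).mp hp).1.one_le
  rw [Mx_eq_primorial] at h1
  have h2 := h1.trans (primorial_le_four_pow _)
  calc ((∏ p ∈ D, p : ℕ) : ℝ) ≤ (4 : ℝ) ^ ⌊x⌋₊ := by exact_mod_cast h2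
    _ = Real.exp (⌊x⌋₊ * Real.log 4) := by
        rw [Real.exp_nat_mul, Real.exp_log (by norm_num)]
    _ ≤ _ := by
        have := Nat.floor_le hx
        have := Real.log_nonneg (show (1 : ℝ) ≤ 4 by norm_num)
        gcongr

theorem log_eight_gt : 2.07 < Real.log 8 := by
  rw [show (8 : ℝ) = 2 ^ 3 by norm_num, Real.log_pow]
  have := Real.log_two_gt_d9
  norm_num at this ⊢
  linarith

theorem scale_bounds {v w x : ℝ} (hv : 1000 ≤ v) (hvw : 1000 * v ^ 2 ≤ w)
    (hwx : (w ^ 4) ^ 3 ≤ x) :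
    1000 ≤ w ∧ v ≤ w ∧ 15 ≤ x / w ^ 4 ∧ 15 ≤ x / w ∧ x / w ≤ 0.01 * (x / v) ∧
      w ^ 4 ≤ 0.01 * (x / v) ∧ 2 * (x / w ^ 4) * (10 + v) ≤ 0.5 * (x / v) ∧
      v * (x / w) + x / w ≤ 0.5 * (x / v) := by
  have hvw1 : 1000 * v ≤ w := by nlinarith
  have hw1 : 1000 ≤ w := by linarith
  have hw0 : 0 < w := by linarith
  have hv0 : 0 < v := by linarith
  have hu1 : w ≤ w ^ 4 := by
    calc w = w ^ 1 := (pow_one w).symm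
      _ ≤ w ^ 4 := pow_le_pow_right₀ (by linarith) (by norm_num)
  have hu0 : 0 < w ^ 4 := by positivity
  have hxu : w ^ 4 * w ≤ x := by
    refine le_trans ?_ hwx
    have h1 : (w ^ 4) ^ 3 = w ^ 4 * w ^ 8 := by ring
    have h2 : w ≤ w ^ 8 := by
      calc w = w ^ 1 := (pow_one w).symm
        _ ≤ w ^ 8 := pow_le_pow_right₀ (by linarith) (by norm_num)
    rw [h1]
    gcongr
  have hx0 : 0 < x := lt_of_lt_of_le (by positivity) hxu
  have h15 : 15 ≤ x / w ^ 4 := by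
    rw [le_div_iff₀ hu0, mul_comm]
    refine le_trans ?_ hxu
    gcongr
    linarith
  refine ⟨hw1, by linarith, h15, h15.trans (by gcongr), ?_, ?_, ?_, ?_⟩
  · rw [← mul_div_assoc, div_le_div_iff₀ hw0 hv0, mul_right_comm, mul_comm x v]
    gcongr
    linarith
  · rw [← mul_div_assoc, le_div_iff₀ hv0]
    have : w ^ 4 * v ≤ w ^ 4 * (0.01 * w) := by
      gcongr
      linarith
    linarith
  · rw [mul_right_comm, ← mul_div_assoc, ← mul_div_assoc, div_le_div_iff₀ hu0 hv0,
      mul_right_comm, mul_right_comm 0.5]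
    refine mul_le_mul_of_nonneg_right ?_ hx0.le
    nlinarith
  · rw [← add_one_mul, ← mul_div_assoc, ← mul_div_assoc, div_le_div_iff₀ hw0 hv0,
      mul_right_comm, mul_right_comm 0.5]
    refine mul_le_mul_of_nonneg_right ?_ hx0.le
    nlinarith

set_option maxHeartbeats 400000 in
theorem eventually_shortSumsLE_jacobiReal (C : ℝ) : ∀ᶠ x : ℝ in atTop, ∀ D : Finset ℕ,
    D ⊆ (primesUpTo x).erase 2 → D.Nonempty → ∀ L : ℝ,
    Real.exp (Real.log 8 * x / Real.log (Real.log x)) ≤ L →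
    ShortSumsLE L (Real.exp (-(C * (x / Real.log x)))) (jacobiReal (∏ p ∈ D, p)) := by
  filter_upwards [eventually_scales (|C| + 1), eventually_card_primesUpTo_le]
    with x ⟨v, w, hvC, hv, hvx, hw, hwx, hvw, hwx3, hxw⟩ hcard D hDx hne L hL
  rw [← hvx] at hL
  rw [← hwx] at hcard ⊢
  have hCv : C + 1 ≤ v := by linarith [le_abs_self C]
  obtain ⟨hw1, hvw1, hx4, hxw2, hxv1, hxv2, hxv3, hxv4⟩ := scale_bounds hv hvw hwx3
  have hw0 : 0 < w := by linarith
  have hx1 : 1 ≤ x := le_trans (one_le_pow₀ (one_le_pow₀ (by linarith))) hwx3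
  have hx0 : 0 < x := by linarith
  have hD : ∀ p ∈ D, p.Prime ∧ Odd p ∧ (p : ℝ) ≤ x := by
    intro p hp
    obtain ⟨h2, hp⟩ := Finset.mem_erase.mp (hDx hp)
    obtain ⟨hp1, hp2⟩ := (mem_primesUpTo hx0.le).mp hp
    exact ⟨hp1, hp1.odd_of_ne_two h2, hp2⟩
  have hDx' : D ⊆ primesUpTo x := hDx.trans (Finset.erase_subset _ _)
  have hcardD : (D.card : ℝ) ≤ 2 * (x / w ^ 4) :=
    le_trans (by exact_mod_cast Finset.card_le_card hDx') hcard
  set H : ℕ := ⌊Real.exp (x / w)⌋₊ with hHdef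
  have hexp4 : 4 ≤ Real.exp (x / w) := by linarith [Real.add_one_le_exp (x / w)]
  have hHle : (H : ℝ) ≤ Real.exp (x / w) := Nat.floor_le (Real.exp_pos _).le
  have hHge : Real.exp (x / w) / 2 ≤ H := by
    have := Nat.lt_floor_add_one (Real.exp (x / w))
    linarith
  have hH2 : 2 ≤ H := by
    have : (2 : ℝ) ≤ H := by linarith
    exact_mod_cast this
  have hlog2 : 0 < Real.log 2 := Real.log_pos (by norm_num)
  have hlog2' : Real.log 2 < 0.7 := by
    have := Real.log_two_lt_d9
    norm_num at this ⊢
    linarith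
  set K : ℕ := ⌊v * Real.log 2⌋₊ with hKdef
  have hKle : (K : ℝ) ≤ v * Real.log 2 := Nat.floor_le (by positivity)
  have hKv : (K : ℝ) ≤ v := hKle.trans (by nlinarith)
  have h2K : (2 : ℝ) ^ K ≤ w ^ 2 := by
    calc (2 : ℝ) ^ K = Real.exp (K * Real.log 2) := by
          rw [Real.exp_nat_mul, Real.exp_log (by norm_num)]
      _ ≤ Real.exp (2 * (v / 4)) := by
          refine Real.exp_le_exp.mpr ?_
          have : (K : ℝ) * Real.log 2 ≤ v * Real.log 2 * Real.log 2 := by gcongr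
          have : Real.log 2 * Real.log 2 ≤ 0.5 := by nlinarith
          nlinarith
      _ = w ^ 2 := by rw [hw, ← Real.exp_nat_mul]; norm_num
  have hxv : 0 ≤ x / v := by positivity
  have hyQ : x ≤ x * Real.exp (2 * x / v) := by
    have : 1 ≤ Real.exp (2 * x / v) := Real.one_le_exp (by positivity)
    nlinarith
  have hQx : x * Real.exp (2 * x / v) / x = Real.exp (2 * x / v) := by
    field_simp
  have key := shortSumsLE_jacobiReal (Q := x * Real.exp (2 * x / v)) (y := x) (L := L) (H := H)
    (K := K) hx1 hyQ hH2 ?_ hD hne ?_ ?_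
  · intro a b hab
    refine (key a b hab).trans ?_
    have hL0 : 0 ≤ L := (Real.exp_pos _).le.trans hL
    gcongr
    have hHpos : (0 : ℝ) < H := by positivity
    have hb0 : (0 : ℝ) < 2 / H := by positivity
    have hb1 : (2 / H : ℝ) ≤ 4 * Real.exp (-(x / w)) := by
      rw [Real.exp_neg, div_le_iff₀ hHpos, ← div_eq_mul_inv, div_mul_eq_mul_div,
        le_div_iff₀ (Real.exp_pos _)]
      linarith
    have hb2 : (2 / H : ℝ) ≤ 1 := (div_le_one hHpos).mpr (by exact_mod_cast hH2)
    have he : 1 / w ^ 2 ≤ (1 / 2 : ℝ) ^ K := by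
      rw [div_pow, one_pow]
      gcongr
    calc 4 * (2 / H : ℝ) ^ ((1 / 2 : ℝ) ^ K)
        ≤ 4 * (2 / H : ℝ) ^ (1 / w ^ 2) := by
          gcongr 4 * ?_
          exact Real.rpow_le_rpow_of_exponent_ge hb0 hb2 he
      _ ≤ 4 * (4 * Real.exp (-(x / w))) ^ (1 / w ^ 2) := by gcongr
      _ = 4 * ((4 : ℝ) ^ (1 / w ^ 2) * Real.exp (-(x / w) * (1 / w ^ 2))) := by
          rw [Real.mul_rpow (by norm_num) (Real.exp_pos _).le, ← Real.exp_mul]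
      _ ≤ 4 * (4 * Real.exp (-(x / w) * (1 / w ^ 2))) := by
          gcongr
          calc (4 : ℝ) ^ (1 / w ^ 2) ≤ (4 : ℝ) ^ (1 : ℝ) := by
                refine Real.rpow_le_rpow_of_exponent_le (by norm_num) ?_
                rw [div_le_one (by positivity)]
                exact one_le_pow₀ (by linarith)
            _ = 4 := Real.rpow_one 4
      _ = 16 * Real.exp (-(x / w ^ 4 * w)) := by
          rw [show -(x / w) * (1 / w ^ 2) = -(x / w ^ 4 * w) by field_simp]
          ring
      _ ≤ Real.exp 15 * Real.exp (-(x / w ^ 4 * w)) := by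
          gcongr
          linarith [Real.add_one_le_exp (15 : ℝ)]
      _ ≤ Real.exp (-(C * (x / w ^ 4))) := by
          rw [← Real.exp_add]
          refine Real.exp_le_exp.mpr ?_
          have h1 : x / w ^ 4 * (C + 1) ≤ x / w ^ 4 * w := by
            gcongr
            linarith
          linarith
  · refine le_trans ?_ hL
    calc (H : ℝ) * (x * Real.exp (2 * x / v))
        ≤ Real.exp (x / w) * (Real.exp (w ^ 4) * Real.exp (2 * x / v)) := by
          rw [← hxw]; gcongr
      _ = Real.exp (x / w + (w ^ 4 + 2 * x / v)) := by rw [Real.exp_add, Real.exp_add]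
      _ ≤ _ := by
          refine Real.exp_le_exp.mpr ?_
          have h3 : 2.07 * (x / v) ≤ Real.log 8 * (x / v) := by
            gcongr
            exact log_eight_gt.le
          rw [mul_div_assoc, mul_div_assoc]
          linarith
  · intro k hk
    rw [hQx, ← Real.exp_nat_mul] at hk
    have h1 := Real.exp_le_exp.mp (hk.trans (prod_le_four_rpow hx0.le hDx'))
    refine Nat.le_floor ?_
    rw [show (4 : ℝ) = 2 ^ 2 by norm_num, Real.log_pow, ← mul_div_assoc,
      div_le_iff₀ (by linarith)] at h1
    push_cast at h1
    have h2 : (2 * x) * k ≤ (2 * x) * (v * Real.log 2) := by linarith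
    exact le_of_mul_le_mul_left h2 (by linarith)
  · rw [hQx]
    have h4K : (11 * 4 ^ K : ℝ) ≤ Real.exp (10 + v) := by
      rw [Real.exp_add]
      have h1 : (4 : ℝ) ^ K = (2 ^ K) ^ 2 := by rw [← pow_mul, mul_comm, pow_mul]; norm_num
      have h2 : Real.exp v = (w ^ 2) ^ 2 := by
        rw [hw, ← pow_mul, ← Real.exp_nat_mul]
        norm_num
        ring
      rw [h1, h2]
      have : 11 ≤ Real.exp 10 := by linarith [Real.add_one_le_exp (10 : ℝ)]
      gcongr
    have hHK : Real.sqrt ((H : ℝ) ^ K) ≤ Real.exp (v * (x / w)) := by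
      have h1 : (1 : ℝ) ≤ (H : ℝ) ^ K := one_le_pow₀ (by exact_mod_cast (by omega : 1 ≤ H))
      calc Real.sqrt ((H : ℝ) ^ K) ≤ (H : ℝ) ^ K := by
            rw [Real.sqrt_le_left (by linarith)]
            nlinarith
        _ ≤ Real.exp (x / w) ^ K := by gcongr
        _ = Real.exp (K * (x / w)) := by rw [Real.exp_nat_mul]
        _ ≤ _ := by gcongr
    calc (11 * 4 ^ K : ℝ) ^ D.card * Real.sqrt (H ^ K) * H
        ≤ Real.exp (10 + v) ^ D.card * Real.exp (v * (x / w)) * Real.exp (x / w) := by gcongr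
      _ = Real.exp (D.card * (10 + v) + v * (x / w) + x / w) := by
          rw [← Real.exp_nat_mul, ← Real.exp_add, ← Real.exp_add]
      _ ≤ Real.exp (x / v) := by
          refine Real.exp_le_exp.mpr ?_
          have e1 : (D.card : ℝ) * (10 + v) ≤ 2 * (x / w ^ 4) * (10 + v) := by gcongr
          linarith
      _ = Real.sqrt (Real.exp (2 * x / v)) := by
          rw [show 2 * x / v = x / v + x / v by ring, Real.exp_add,
            Real.sqrt_mul_self (Real.exp_pos _).le]

end Asymptotics

section Counting

theorem jacobiReal_prod (D : Finset ℕ) (hD : ∀ p ∈ D, p ≠ 0) (n : ℤ) :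
    jacobiReal (∏ p ∈ D, p) n = ∏ p ∈ D, jacobiReal p n := by
  classical
  induction D using Finset.induction_on with
  | empty => simp [jacobiReal]
  | insert p D hp ih =>
    have hD' : ∀ p ∈ D, p ≠ 0 := fun q hq => hD q (Finset.mem_insert_of_mem hq)
    rw [Finset.prod_insert hp, Finset.prod_insert hp,
      jacobiReal_mul (hD p (Finset.mem_insert_self _ _)) (Finset.prod_ne_zero_iff.mpr hD'), ih hD']

theorem prod_one_sub_mul_one_add_jacobiReal (P : Finset ℕ) (hP : ∀ p ∈ P, p.Prime) (n : ℤ) :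
    (∏ p ∈ P, (1 + -(if (p : ℤ) ∣ n then 1 else 0 : ℝ))) * ∏ p ∈ P, (1 + jacobiReal p n) =
      if ∀ p ∈ P, jacobiSym n p = 1 then 2 ^ P.card else 0 := by
  rw [← Finset.prod_mul_distrib]
  have hzero : ∀ p ∈ P, jacobiSym n p = 0 ↔ (p : ℤ) ∣ n := by
    intro p hp
    have : Fact p.Prime := ⟨hP p hp⟩
    rw [← jacobiSym.legendreSym.to_jacobiSym, legendreSym.eq_zero_iff,
      ZMod.intCast_zmod_eq_zero_iff_dvd]
  split_ifs with h
  · rw [← Finset.prod_const]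
    refine Finset.prod_congr rfl fun p hp => ?_
    have h1 := h p hp
    have h2 : ¬ (p : ℤ) ∣ n := by
      rw [← hzero p hp, h1]
      exact one_ne_zero
    rw [if_neg h2, jacobiReal, h1]
    norm_num
  · push Not at h
    obtain ⟨p, hp, h1⟩ := h
    refine Finset.prod_eq_zero hp ?_
    rcases jacobiSym.trichotomy n p with h2 | h2 | h2
    · rw [if_pos ((hzero p hp).mp h2)]
      norm_num
    · exact absurd h2 h1
    · rw [jacobiReal, h2]
      norm_num

theorem prod_neg_ite_dvd (E : Finset ℕ) (hE : ∀ p ∈ E, p.Prime) (n : ℤ) :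
    ∏ p ∈ E, (-(if (p : ℤ) ∣ n then 1 else 0 : ℝ)) =
      (-1) ^ E.card * if ((∏ p ∈ E, p : ℕ) : ℤ) ∣ n then 1 else 0 := by
  rw [Finset.prod_neg]
  congr 1
  rw [Finset.prod_ite_zero, Finset.prod_const_one]
  congr 1
  simp only [Int.natCast_dvd, eq_iff_iff]
  exact ⟨fun h => Finset.prod_primes_dvd _ (fun p hp => (hE p hp).prime) h,
    fun h p hp => (Finset.dvd_prod_of_mem _ hp).trans h⟩

/-- The contribution of the divisor `e` and the modulus `d` to the count. -/
noncomputable def progressionSum (a b : ℤ) (e d : ℕ) : ℝ :=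
  ∑ n ∈ (Finset.Ioc a b).filter (· % 8 = 1), (if (e : ℤ) ∣ n then 1 else 0) * jacobiReal d n

theorem two_pow_mul_card_eq (P : Finset ℕ) (hP : ∀ p ∈ P, p.Prime) (a b : ℤ) :
    (2 : ℝ) ^ P.card *
      ((Finset.Ioc a b).filter fun n => n % 8 = 1 ∧ ∀ p ∈ P, jacobiSym n p = 1).card =
    ∑ E ∈ P.powerset, ∑ D ∈ P.powerset,
      (-1) ^ E.card * progressionSum a b (∏ p ∈ E, p) (∏ p ∈ D, p) := by
  rw [← Finset.filter_filter, Finset.card_filter, Nat.cast_sum, Finset.mul_sum]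
  have h : ∀ n : ℤ, (2 : ℝ) ^ P.card * ((if ∀ p ∈ P, jacobiSym n p = 1 then 1 else 0 : ℕ) : ℝ) =
      ∑ E ∈ P.powerset, ∑ D ∈ P.powerset, (-1) ^ E.card *
        ((if ((∏ p ∈ E, p : ℕ) : ℤ) ∣ n then 1 else 0) * jacobiReal (∏ p ∈ D, p) n) := by
    intro n
    have h1 := prod_one_sub_mul_one_add_jacobiReal P hP n
    rw [Finset.prod_one_add, Finset.prod_one_add, Finset.sum_mul_sum] at h1
    push_cast
    rw [mul_ite, mul_one, mul_zero, ← h1]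
    refine Finset.sum_congr rfl fun E hE => Finset.sum_congr rfl fun D hD => ?_
    rw [Finset.mem_powerset] at hE hD
    rw [prod_neg_ite_dvd E fun p hp => hP p (hE hp),
      jacobiReal_prod D fun p hp => (hP p (hD hp)).ne_zero, mul_assoc]
    push_cast
    rfl
  rw [Finset.sum_congr rfl fun n _ => h n, Finset.sum_comm]
  refine Finset.sum_congr rfl fun E _ => ?_
  rw [Finset.sum_comm]
  refine Finset.sum_congr rfl fun D _ => ?_
  rw [progressionSum, Finset.mul_sum]

theorem odd_sq_emod_eight {e : ℤ} (he : Odd e) : e * e % 8 = 1 := by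
  rcases he with ⟨k, rfl⟩
  obtain ⟨m, hm⟩ : ∃ m, k * (k + 1) = 2 * m := by
    obtain ⟨m, hm⟩ := Int.even_mul_succ_self k
    exact ⟨m, by rw [hm]; ring⟩
  have : (2 * k + 1) * (2 * k + 1) = 1 + 8 * m := by linear_combination 4 * hm
  rw [this]
  omega

theorem progressionSum_eq {e : ℕ} (he : Odd e) (a b : ℤ) (d : ℕ) :
    progressionSum a b e d =
      ∑ t ∈ Finset.Ioc ((a - e * e) / (8 * e)) ((b - e * e) / (8 * e)),
        jacobiReal d (e * e + 8 * e * t) := by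
  have hepos : (0 : ℤ) < e := by exact_mod_cast he.pos
  have h8e : (0 : ℤ) < 8 * e := by omega
  have hodd : Odd (e : ℤ) := by exact_mod_cast he
  have he8 := odd_sq_emod_eight hodd
  unfold progressionSum
  simp only [ite_mul, one_mul, zero_mul]
  rw [← Finset.sum_filter, Finset.filter_filter]
  have hdvd : ∀ n : ℤ, n % 8 = 1 → (e : ℤ) ∣ n → 8 * (e : ℤ) ∣ n - e * e := by
    intro n h1 h2
    have hco : IsCoprime (8 : ℤ) e := by
      rw [Int.isCoprime_iff_gcd_eq_one]
      have h3 : Nat.Coprime (2 ^ 3) e := Nat.Coprime.pow_left 3 (Nat.coprime_two_left.mpr he)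
      exact h3
    refine hco.mul_dvd ?_ (dvd_sub h2 (dvd_mul_right _ _))
    omega
  refine Finset.sum_nbij' (fun n => (n - e * e) / (8 * e)) (fun t => e * e + 8 * e * t) ?_ ?_ ?_ ?_
    ?_
  · intro n hn
    simp only [Finset.mem_filter, Finset.mem_Ioc] at hn ⊢
    obtain ⟨t, ht⟩ := hdvd n hn.2.1 hn.2.2
    rw [ht, Int.mul_ediv_cancel_left _ h8e.ne', Int.ediv_lt_iff_lt_mul h8e,
      Int.le_ediv_iff_mul_le h8e, mul_comm t, ← ht]
    omega
  · intro t ht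
    simp only [Finset.mem_filter, Finset.mem_Ioc] at ht ⊢
    rw [Int.ediv_lt_iff_lt_mul h8e, Int.le_ediv_iff_mul_le h8e, mul_comm t] at ht
    refine ⟨by omega, ?_, ?_⟩
    · rw [mul_assoc, Int.add_mul_emod_self_left, he8]
    · exact ⟨e + 8 * t, by ring⟩
  · intro n hn
    simp only [Finset.mem_filter, Finset.mem_Ioc] at hn
    have := Int.mul_ediv_cancel' (hdvd n hn.2.1 hn.2.2)
    omega
  · intro t _
    rw [add_sub_cancel_left, Int.mul_ediv_cancel_left _ h8e.ne']
  · intro n hn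
    simp only [Finset.mem_filter, Finset.mem_Ioc] at hn
    have := Int.mul_ediv_cancel' (hdvd n hn.2.1 hn.2.2)
    congr 1
    omega

theorem abs_ediv_sub_ediv_sub_le {a b r m : ℤ} (hm : 0 < m) :
    |(((b - r) / m - (a - r) / m : ℤ) : ℝ) - ((b : ℝ) - a) / m| ≤ 1 := by
  have hm' : (0 : ℝ) < m := by exact_mod_cast hm
  have key : |((b - r) / m - (a - r) / m) * m - (b - a)| ≤ m := by
    have h1 := Int.emod_add_mul_ediv (b - r) m
    have h2 := Int.emod_add_mul_ediv (a - r) m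
    have h3 := Int.emod_nonneg (b - r) hm.ne'
    have h4 := Int.emod_nonneg (a - r) hm.ne'
    have h5 := Int.emod_lt_of_pos (b - r) hm
    have h6 := Int.emod_lt_of_pos (a - r) hm
    rw [abs_le]
    constructor <;> nlinarith
  have key' : |(((b - r) / m - (a - r) / m : ℤ) : ℝ) * m - (b - a)| ≤ m := by exact_mod_cast key
  have : (((b - r) / m - (a - r) / m : ℤ) : ℝ) - ((b : ℝ) - a) / m =
      ((((b - r) / m - (a - r) / m : ℤ) : ℝ) * m - (b - a)) / m := by field_simp
  rw [this, abs_div, abs_of_pos hm']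
  exact (div_le_one hm').mpr key'

theorem abs_progressionSum_one_sub_le {e : ℕ} (he : Odd e) {a b : ℤ} (hab : a ≤ b) {N : ℝ}
    (hN : |(b : ℝ) - a - N| ≤ 1) : |progressionSum a b e 1 - N / (8 * e)| ≤ 2 := by
  have he1 : (1 : ℝ) ≤ e := by exact_mod_cast he.pos
  have hepos : (0 : ℤ) < 8 * e := by
    have := he.pos
    omega
  have hle : (a - e * e) / (8 * e) ≤ (b - e * e) / (8 * e) :=
    Int.ediv_le_ediv hepos (by omega)
  rw [progressionSum_eq he]
  have h1 : ∑ t ∈ Finset.Ioc ((a - e * e) / (8 * e)) ((b - e * e) / (8 * e)),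
      jacobiReal 1 (e * e + 8 * e * t) =
      (((b - e * e) / (8 * e) - (a - e * e) / (8 * e) : ℤ) : ℝ) := by
    simp only [jacobiReal, jacobiSym.one_right, Int.cast_one, Finset.sum_const, nsmul_eq_mul,
      mul_one, Int.card_Ioc]
    rw [← Int.cast_natCast, Int.toNat_of_nonneg (by omega)]
  rw [h1]
  have h2 := abs_ediv_sub_ediv_sub_le (a := a) (b := b) (r := e * e) hepos
  push_cast at h2 ⊢
  have h3 : |((b : ℝ) - a) / (8 * e) - N / (8 * e)| ≤ 1 := by
    rw [← sub_div, abs_div, abs_of_pos (by positivity : (0 : ℝ) < 8 * e),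
      div_le_one (by positivity)]
    linarith
  calc _ ≤ _ := abs_sub_le _ (((b : ℝ) - a) / (8 * e)) _
    _ ≤ 2 := by linarith

theorem abs_progressionSum_le {e d : ℕ} (he : Odd e) (hd : Odd d) {a b : ℤ} {N δ : ℝ}
    (hN : (b : ℝ) - a ≤ N + 1) (hN2 : 2 ≤ N) (hδ : ShortSumsLE N δ (jacobiReal d)) :
    |progressionSum a b e d| ≤ δ * N := by
  have he1 : (1 : ℝ) ≤ e := by exact_mod_cast he.pos
  have hepos : (0 : ℤ) < 8 * e := by
    have := he.pos
    omega
  have hco : IsCoprime (8 : ℤ) d := by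
    rw [Int.isCoprime_iff_gcd_eq_one]
    have h3 : Nat.Coprime (2 ^ 3) d := Nat.Coprime.pow_left 3 (Nat.coprime_two_left.mpr hd)
    exact h3
  obtain ⟨u, w, huw⟩ := hco
  have hterm : ∀ t : ℤ, jacobiReal d (e * e + 8 * e * t) =
      jacobiReal d (8 * e) * jacobiReal d (t + u * e) := by
    intro t
    unfold jacobiReal
    rw [← Int.cast_mul, ← jacobiSym.mul_left, jacobiSym.mod_left,
      jacobiSym.mod_left (8 * (e : ℤ) * _)]
    congr 2
    refine Int.ModEq.symm ((Int.modEq_iff_dvd).mpr ⟨e * e * w, ?_⟩)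
    linear_combination (-(e : ℤ) * e) * huw
  rw [progressionSum_eq he, Finset.sum_congr rfl fun t _ => hterm t, ← Finset.mul_sum, abs_mul]
  set A := (a - e * e) / (8 * (e : ℤ)) with hA
  set B := (b - e * e) / (8 * (e : ℤ)) with hB
  have hshift : ∑ t ∈ Finset.Ioc A B, jacobiReal d (t + u * e) =
      ∑ n ∈ Finset.Ico (A + 1 + u * e) (B + 1 + u * e), jacobiReal d n := by
    refine Finset.sum_nbij' (fun t => t + u * e) (fun n => n - u * e) ?_ ?_ ?_ ?_ ?_
    · intro t ht
      simp only [Finset.mem_Ioc, Finset.mem_Ico] at ht ⊢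
      omega
    · intro t ht
      simp only [Finset.mem_Ioc, Finset.mem_Ico] at ht ⊢
      omega
    · intro t _
      ring
    · intro t _
      ring
    · intro t _
      rfl
  rw [hshift]
  have hlen : ((B + 1 + u * e : ℤ) : ℝ) - ((A + 1 + u * e : ℤ) : ℝ) ≤ N := by
    have h2 := (abs_le.mp (abs_ediv_sub_ediv_sub_le (a := a) (b := b) (r := e * e) hepos)).2
    rw [← hA, ← hB] at h2
    have h3 : ((b : ℝ) - a) / ((8 * (e : ℤ) : ℤ) : ℝ) ≤ (N + 1) / 8 := by
      push_cast
      calc ((b : ℝ) - a) / (8 * e) ≤ (N + 1) / (8 * e) := by gcongr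
        _ ≤ (N + 1) / 8 := by
          refine div_le_div_of_nonneg_left (by linarith) (by norm_num) (by linarith)
    push_cast at h2 h3 ⊢
    linarith
  calc _ ≤ 1 * |∑ n ∈ Finset.Ico (A + 1 + u * e) (B + 1 + u * e), jacobiReal d n| := by
        gcongr
        exact abs_jacobiReal_le_one _ _
    _ ≤ δ * N := by
        rw [one_mul]
        exact hδ _ _ hlen

/-- The proportion of integers that are `1` modulo `8` and residues modulo all `p ∈ P`, up to
the factor `2 ^ #P`. -/
noncomputable def residueDensity (P : Finset ℕ) : ℝ := 1 / 8 * ∏ p ∈ P, (1 - 1 / (p : ℝ))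

theorem abs_two_pow_mul_card_sub_le {P : Finset ℕ} (hP : ∀ p ∈ P, p.Prime ∧ Odd p) {a b : ℤ}
    (hab : a ≤ b) {N δ : ℝ} (hN : |(b : ℝ) - a - N| ≤ 1) (hN2 : 2 ≤ N)
    (hδ : ∀ D ⊆ P, D.Nonempty → ShortSumsLE N δ (jacobiReal (∏ p ∈ D, p))) (hδ0 : 0 ≤ δ) :
    |(2 : ℝ) ^ P.card *
      ((Finset.Ioc a b).filter fun n => n % 8 = 1 ∧ ∀ p ∈ P, jacobiSym n p = 1).card -
      N * residueDensity P| ≤ 2 ^ P.card * (2 + 2 ^ P.card * (δ * N)) := by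
  classical
  have hodd : ∀ D ⊆ P, Odd (∏ p ∈ D, p) := fun D hD =>
    Finset.prod_induction _ Odd (fun _ _ => Odd.mul) odd_one fun p hp => (hP p (hD hp)).2
  have hmain : N * residueDensity P =
      ∑ E ∈ P.powerset, (-1) ^ E.card * (N / (8 * (∏ p ∈ E, p : ℕ))) := by
    have h1 : residueDensity P = 1 / 8 * ∏ p ∈ P, (1 + -(1 / (p : ℝ))) := rfl
    rw [h1, Finset.prod_one_add, ← mul_assoc, Finset.mul_sum]
    refine Finset.sum_congr rfl fun E _ => ?_
    rw [Finset.prod_neg, Finset.prod_div_distrib, Finset.prod_const_one, Nat.cast_prod]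
    ring
  rw [two_pow_mul_card_eq P (fun p hp => (hP p hp).1), hmain, ← Finset.sum_sub_distrib]
  refine (Finset.abs_sum_le_sum_abs _ _).trans ?_
  refine (Finset.sum_le_card_nsmul _ _ (2 + 2 ^ P.card * (δ * N)) ?_).trans ?_
  · intro E hE
    rw [Finset.mem_powerset] at hE
    rw [← Finset.mul_sum, ← mul_sub, abs_mul, abs_pow, abs_neg, abs_one, one_pow, one_mul,
      ← Finset.add_sum_erase _ _ (Finset.empty_mem_powerset P), Finset.prod_empty,
      add_sub_right_comm]
    refine (abs_add_le _ _).trans (add_le_add (abs_progressionSum_one_sub_le (hodd E hE) hab hN) ?_)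
    refine (Finset.abs_sum_le_sum_abs _ _).trans ?_
    refine (Finset.sum_le_card_nsmul _ _ (δ * N) ?_).trans ?_
    · intro D hD
      obtain ⟨hD1, hD2⟩ := Finset.mem_erase.mp hD
      rw [Finset.mem_powerset] at hD2
      exact abs_progressionSum_le (hodd E hE) (hodd D hD2) (by linarith [(abs_le.mp hN).2]) hN2
        (hδ D hD2 (Finset.nonempty_iff_ne_empty.mpr hD1))
    · rw [nsmul_eq_mul]
      have h2 : ((P.powerset.erase ∅).card : ℝ) ≤ 2 ^ P.card := by
        have := Finset.card_le_card (Finset.erase_subset ∅ P.powerset)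
        rw [Finset.card_powerset] at this
        exact_mod_cast this
      gcongr
  · rw [nsmul_eq_mul, Finset.card_powerset]
    push_cast
    rfl

theorem card_isSquare_Ioc_le (a b : ℕ) :
    ((Finset.Ioc a b).filter IsSquare).card ≤ Nat.sqrt (b - a) + 1 := by
  classical
  rcases le_or_gt b a with h | h
  · simp [Finset.Ioc_eq_empty_of_le h]
  have hsub : (Finset.Ioc a b).filter IsSquare ⊆
      (Finset.Ioc (Nat.sqrt a) (Nat.sqrt b)).image fun m => m * m := by
    intro n hn
    simp only [Finset.mem_filter, Finset.mem_Ioc, Finset.mem_image] at hn ⊢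
    obtain ⟨⟨h1, h2⟩, m, rfl⟩ := hn
    exact ⟨m, ⟨Nat.sqrt_lt.mpr h1, Nat.le_sqrt.mpr h2⟩, rfl⟩
  refine (Finset.card_le_card hsub).trans (Finset.card_image_le.trans ?_)
  rw [Nat.card_Ioc]
  have h1 := Nat.lt_succ_sqrt a
  have h2 := Nat.lt_succ_sqrt (b - a)
  have h3 : Nat.sqrt b < Nat.sqrt a + Nat.sqrt (b - a) + 2 := by
    rw [Nat.sqrt_lt]
    have : b = a + (b - a) := by omega
    simp only [Nat.succ_eq_add_one] at h1 h2
    nlinarith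
  omega

end Counting

section Equidistribution

open Filter

theorem isPseudosquare_iff {x : ℝ} (hx : 0 ≤ x) {n : ℕ} (hn : 0 < n) :
    IsPseudosquare x n ↔ ¬ IsSquare n ∧
      ((n : ℤ) % 8 = 1 ∧ ∀ p ∈ (primesUpTo x).erase 2, jacobiSym n p = 1) := by
  have h8 : n % 8 = 1 ↔ (n : ℤ) % 8 = 1 := by omega
  have hleg : ∀ p : ℕ, p.Prime → legendre p (n : ℤ) = jacobiSym n p := by
    intro p hp
    have : Fact p.Prime := ⟨hp⟩
    rw [legendre, dif_pos hp, ← jacobiSym.legendreSym.to_jacobiSym]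
  unfold IsPseudosquare
  rw [h8]
  constructor
  · rintro ⟨_, h1, h2, h3⟩
    refine ⟨h1, h2, fun p hp => ?_⟩
    obtain ⟨hp2, hp⟩ := Finset.mem_erase.mp hp
    obtain ⟨hpp, hpx⟩ := (mem_primesUpTo hx).mp hp
    rw [← hleg p hpp]
    exact h3 p hpp hp2 hpx
  · rintro ⟨h1, h2, h3⟩
    refine ⟨hn, h1, h2, fun p hpp hp2 hpx => ?_⟩
    rw [hleg p hpp]
    exact h3 p (Finset.mem_erase.mpr ⟨hp2, (mem_primesUpTo hx).mpr ⟨hpp, hpx⟩⟩)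

theorem abs_pseudosquaresIn_sub_card_le {x A N : ℝ} (hx : 0 ≤ x) (hA : 0 ≤ A) (hN : 0 ≤ N) :
    |(pseudosquaresIn x A N : ℝ) -
      ((Finset.Ioc (⌊A⌋₊ : ℤ) (⌊A + N⌋₊ : ℤ)).filter fun n => n % 8 = 1 ∧
        ∀ p ∈ (primesUpTo x).erase 2, jacobiSym n p = 1).card| ≤
      Real.sqrt (N + 1) + 1 := by
  classical
  set a := ⌊A⌋₊ with ha
  set b := ⌊A + N⌋₊ with hb
  set q : ℤ → Prop := fun n => n % 8 = 1 ∧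
    ∀ p ∈ (primesUpTo x).erase 2, jacobiSym n p = 1 with hq
  have hcard : ((Finset.Ioc (a : ℤ) (b : ℤ)).filter q).card =
      ((Finset.Ioc a b).filter fun n : ℕ => q n).card := by
    refine Finset.card_nbij' Int.toNat (fun n : ℕ => (n : ℤ)) ?_ ?_ ?_ ?_
    · intro n hn
      simp only [Finset.coe_filter, Finset.mem_Ioc, Set.mem_ofPred_eq] at hn ⊢
      refine ⟨by omega, ?_⟩
      rw [Int.toNat_of_nonneg (by omega)]
      exact hn.2
    · intro n hn
      simp only [Finset.coe_filter, Finset.mem_Ioc, Set.mem_ofPred_eq] at hn ⊢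
      exact ⟨by omega, hn.2⟩
    · intro n hn
      simp only [Finset.coe_filter, Finset.mem_Ioc, Set.mem_ofPred_eq] at hn
      exact Int.toNat_of_nonneg (by omega)
    · intro n _
      exact Int.toNat_natCast n
  have hps : pseudosquaresIn x A N =
      ((Finset.Ioc a b).filter fun n : ℕ => ¬ IsSquare n ∧ q n).card := by
    rw [pseudosquaresIn, ← Set.ncard_coe_finset]
    congr 1
    ext n
    simp only [Finset.coe_filter, Finset.mem_Ioc, Set.mem_ofPred_eq, ha, hb, Nat.floor_lt hA,
      Nat.le_floor_iff (add_nonneg hA hN)]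
    constructor
    · rintro ⟨h1, h2⟩
      exact ⟨h2, (isPseudosquare_iff hx h1.1).mp h1⟩
    · rintro ⟨h1, h2⟩
      have hn : 0 < n := by
        have : (0 : ℝ) < n := by linarith
        exact_mod_cast this
      exact ⟨(isPseudosquare_iff hx hn).mpr h2, h1⟩
  have hle1 : ((Finset.Ioc a b).filter fun n : ℕ => ¬ IsSquare n ∧ q n).card ≤
      ((Finset.Ioc a b).filter fun n : ℕ => q n).card :=
    Finset.card_le_card (Finset.monotone_filter_right _ fun n _ h => h.2)
  have hle2 : ((Finset.Ioc a b).filter fun n : ℕ => q n).card ≤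
      ((Finset.Ioc a b).filter fun n : ℕ => ¬ IsSquare n ∧ q n).card +
        ((Finset.Ioc a b).filter IsSquare).card := by
    refine (Finset.card_le_card ?_).trans (Finset.card_union_le _ _)
    intro n hn
    simp only [Finset.mem_union, Finset.mem_filter] at hn ⊢
    tauto
  have hsq := card_isSquare_Ioc_le a b
  have hba : ((b - a : ℕ) : ℝ) ≤ N + 1 := by
    have h1 : (b : ℝ) ≤ A + N := Nat.floor_le (add_nonneg hA hN)
    have h2 : A < a + 1 := Nat.lt_floor_add_one A
    have h3 : a ≤ b := Nat.floor_le_floor (by linarith)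
    rw [Nat.cast_sub h3]
    linarith
  have hsqrt : (Nat.sqrt (b - a) : ℝ) ≤ Real.sqrt (N + 1) :=
    Real.nat_sqrt_le_real_sqrt.trans (Real.sqrt_le_sqrt hba)
  rw [hps, hcard, abs_le]
  have h1 : (((Finset.Ioc a b).filter fun n : ℕ => ¬ IsSquare n ∧ q n).card : ℝ) ≤
      ((Finset.Ioc a b).filter fun n : ℕ => q n).card := by exact_mod_cast hle1
  have h2 : (((Finset.Ioc a b).filter fun n : ℕ => q n).card : ℝ) ≤
      ((Finset.Ioc a b).filter fun n : ℕ => ¬ IsSquare n ∧ q n).card +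
        (Nat.sqrt (b - a) + 1) := by exact_mod_cast hle2.trans (by omega)
  have h3 := Real.sqrt_nonneg (N + 1)
  constructor <;> linarith

theorem residueDensity_ge {P : Finset ℕ} (hP : ∀ p ∈ P, p.Prime) :
    1 / 8 * (1 / 2 : ℝ) ^ P.card ≤ residueDensity P := by
  unfold residueDensity
  gcongr
  rw [← Finset.prod_const]
  refine Finset.prod_le_prod (fun _ _ => by norm_num) fun p hp => ?_
  have h2 : (2 : ℝ) ≤ p := by exact_mod_cast (hP p hp).two_le
  have h3 : 1 / (p : ℝ) ≤ 1 / 2 := by gcongr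
  linarith

theorem abs_pseudosquaresIn_sub_le {x A N δ : ℝ} (hx : 0 ≤ x) (hA : 0 ≤ A) (hN : 2 ≤ N)
    (hδ0 : 0 ≤ δ)
    (hδ : ∀ D ⊆ (primesUpTo x).erase 2, D.Nonempty →
      ShortSumsLE N δ (jacobiReal (∏ p ∈ D, p))) :
    |(pseudosquaresIn x A N : ℝ) -
      N * (residueDensity ((primesUpTo x).erase 2) / 2 ^ ((primesUpTo x).erase 2).card)| ≤
      2 ^ ((primesUpTo x).erase 2).card * (δ * N) + 5 * Real.sqrt N := by
  set P := (primesUpTo x).erase 2 with hPdef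
  have hP : ∀ p ∈ P, p.Prime ∧ Odd p := by
    intro p hp
    obtain ⟨h2, hp⟩ := Finset.mem_erase.mp hp
    obtain ⟨hp1, hp2⟩ := (mem_primesUpTo hx).mp hp
    exact ⟨hp1, hp1.odd_of_ne_two h2⟩
  have h1 := abs_pseudosquaresIn_sub_card_le hx hA (by linarith : 0 ≤ N)
  have hAN : 0 ≤ A + N := by linarith
  have hfl : |((⌊A + N⌋₊ : ℤ) : ℝ) - ((⌊A⌋₊ : ℤ) : ℝ) - N| ≤ 1 := by
    have e1 := Nat.floor_le hAN
    have e2 := Nat.lt_floor_add_one (A + N)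
    have e3 := Nat.floor_le hA
    have e4 := Nat.lt_floor_add_one A
    push_cast
    rw [abs_le]
    constructor <;> linarith
  have h2 := abs_two_pow_mul_card_sub_le hP
    (by exact_mod_cast Nat.floor_le_floor (by linarith : A ≤ A + N)) hfl hN hδ hδ0
  rw [← hPdef] at h1
  set S : ℝ := (((Finset.Ioc (⌊A⌋₊ : ℤ) (⌊A + N⌋₊ : ℤ)).filter fun n => n % 8 = 1 ∧
        ∀ p ∈ P, jacobiSym n p = 1).card : ℝ) with hS
  set T : ℝ := 2 ^ P.card with hT
  have hT0 : 0 < T := by positivity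
  have h3 : |S - N * (residueDensity P / T)| ≤ 2 + T * (δ * N) := by
    have e : S - N * (residueDensity P / T) = (T * S - N * residueDensity P) / T := by
      field_simp
    rw [e, abs_div, abs_of_pos hT0, div_le_iff₀ hT0, mul_comm _ T]
    exact h2
  have h4 : Real.sqrt (N + 1) ≤ Real.sqrt N + 1 := by
    rw [Real.sqrt_le_left (by positivity)]
    have := Real.sq_sqrt (by linarith : 0 ≤ N)
    nlinarith [Real.sqrt_nonneg N]
  have h5 : 1 ≤ Real.sqrt N := by
    rw [Real.one_le_sqrt]
    linarith
  calc _ ≤ _ := abs_sub_le _ S _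
    _ ≤ _ := by linarith

/-- Uniform asymptotics for the number of pseudosquares in an interval. -/
theorem eventually_abs_pseudosquaresIn_sub_le {ε : ℝ} (hε : 0 < ε) : ∀ᶠ x : ℝ in atTop,
    ∃ ρ : ℝ, 0 < ρ ∧ ∀ A : ℝ, 0 ≤ A → ∀ N : ℝ,
      Real.exp (Real.log 8 * x / Real.log (Real.log x)) ≤ N →
      |(pseudosquaresIn x A N : ℝ) - N * ρ| ≤ ε * (N * ρ) := by
  have hexp : ∀ᶠ y : ℝ in atTop, Real.exp (-y) ≤ ε / 80 :=
    (Real.tendsto_exp_neg_atTop_nhds_zero.eventually (gt_mem_nhds (by positivity))).mono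
      fun y hy => hy.le
  obtain ⟨Y, hY⟩ := eventually_atTop.mp hexp
  filter_upwards [eventually_scales Y, eventually_card_primesUpTo_le,
    eventually_shortSumsLE_jacobiReal 10]
    with x ⟨v, w, hvY, hv, hvx, hw, hwx, hvw, hwx3, hxw⟩ hcard hshort
  rw [← hvx] at hshort ⊢
  rw [← hwx] at hcard hshort
  obtain ⟨hw1, hvw1, hx4, hxw2, hxv1, hxv2, hxv3, hxv4⟩ := scale_bounds hv hvw hwx3
  have hx0 : 0 < x := lt_of_lt_of_le (by positivity) hwx3
  have hu0 : 0 < w ^ 4 := by positivity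
  have hzY : Real.exp (-(x / w ^ 4)) ≤ ε / 80 := by
    refine hY _ (hvY.trans ?_)
    rw [le_div_iff₀ hu0]
    refine le_trans ?_ hwx3
    have h1 : (w ^ 4) ^ 3 = w ^ 8 * w ^ 4 := by ring
    have h2 : w ≤ w ^ 8 := by
      calc w = w ^ 1 := (pow_one w).symm
        _ ≤ w ^ 8 := pow_le_pow_right₀ (by linarith) (by norm_num)
    rw [h1]
    gcongr
    linarith
  set P := (primesUpTo x).erase 2 with hPdef
  have hP : ∀ p ∈ P, p.Prime := fun p hp =>
    ((mem_primesUpTo hx0.le).mp (Finset.mem_erase.mp hp).2).1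
  set z : ℝ := x / w ^ 4 with hz
  have hcardP : (P.card : ℝ) ≤ 2 * z :=
    le_trans (by exact_mod_cast Finset.card_le_card (Finset.erase_subset _ _)) hcard
  set T : ℝ := 2 ^ P.card with hT
  have hT0 : 0 < T := by positivity
  have hTz : T ≤ Real.exp (2 * z) := by
    calc T ≤ Real.exp 1 ^ P.card := by
          refine pow_le_pow_left₀ (by norm_num) ?_ _
          linarith [Real.add_one_le_exp (1 : ℝ)]
      _ = Real.exp P.card := by rw [← Real.exp_nat_mul, mul_one]
      _ ≤ _ := by gcongr
  have hρ : 1 / 8 / T ^ 2 ≤ residueDensity P / T := by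
    rw [pow_two, ← div_div]
    gcongr
    have := residueDensity_ge hP
    rwa [div_pow, one_pow, mul_one_div] at this
  have hρ0 : 0 < residueDensity P / T := lt_of_lt_of_le (by positivity) hρ
  refine ⟨residueDensity P / T, hρ0, fun A hA N hN => ?_⟩
  have hvz : 10 * z ≤ x / v := by
    rw [hz, ← mul_div_assoc, div_le_div_iff₀ hu0 (by linarith), mul_right_comm, mul_comm x]
    refine mul_le_mul_of_nonneg_right ?_ hx0.le
    calc 10 * v ≤ w := by nlinarith
      _ = w ^ 1 := (pow_one w).symm
      _ ≤ w ^ 4 := pow_le_pow_right₀ (by linarith) (by norm_num)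
  have hxv : 0 ≤ x / v := by positivity
  have hNexp : Real.exp (20 * z) ≤ N := by
    refine le_trans (Real.exp_le_exp.mpr ?_) hN
    rw [mul_div_assoc]
    have : 2 * (x / v) ≤ Real.log 8 * (x / v) := by
      gcongr
      linarith [log_eight_gt]
    linarith
  have hN2 : 2 ≤ N := by linarith [Real.add_one_le_exp (20 * z)]
  have hN0 : 0 < N := by linarith
  have hsqrt : Real.sqrt N ≤ N * Real.exp (-(10 * z)) := by
    have h1 : Real.exp (10 * z) ≤ Real.sqrt N := by
      refine Real.le_sqrt_of_sq_le ?_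
      rw [← Real.exp_nat_mul]
      refine le_trans (le_of_eq ?_) hNexp
      push_cast
      ring_nf
    rw [Real.exp_neg, ← div_eq_mul_inv, le_div_iff₀ (Real.exp_pos _)]
    calc Real.sqrt N * Real.exp (10 * z) ≤ Real.sqrt N * Real.sqrt N := by gcongr
      _ = N := Real.mul_self_sqrt hN0.le
  have main := abs_pseudosquaresIn_sub_le hx0.le hA hN2 (Real.exp_pos _).le
    fun D hD hne => hshort D hD hne N hN
  rw [← hPdef, ← hT] at main
  refine main.trans ?_
  have hT1 : 1 ≤ T := one_le_pow₀ (by norm_num)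
  calc T * (Real.exp (-(10 * z)) * N) + 5 * Real.sqrt N
      ≤ T * (Real.exp (-(10 * z)) * N) + 5 * (N * Real.exp (-(10 * z))) := by gcongr
    _ ≤ T * (Real.exp (-(10 * z)) * N) + 5 * (T * (N * Real.exp (-(10 * z)))) := by
        have := le_mul_of_one_le_left (by positivity : 0 ≤ N * Real.exp (-(10 * z))) hT1
        linarith
    _ = 48 * T ^ 3 * Real.exp (-(10 * z)) * (N * (1 / 8 / T ^ 2)) := by
        field_simp
        ring
    _ ≤ 48 * Real.exp (2 * z) ^ 3 * Real.exp (-(10 * z)) * (N * (residueDensity P / T)) := by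
        gcongr
    _ = 48 * Real.exp (-(4 * z)) * (N * (residueDensity P / T)) := by
        rw [← Real.exp_nat_mul, mul_assoc 48, ← Real.exp_add]
        push_cast
        ring_nf
    _ ≤ 48 * (ε / 80) * (N * (residueDensity P / T)) := by
        gcongr
        refine le_trans (Real.exp_le_exp.mpr ?_) hzY
        linarith
    _ ≤ ε * (N * (residueDensity P / T)) := by
        gcongr
        linarith

theorem eventually_exp_le_Mx :
    ∀ᶠ x : ℝ in atTop, Real.exp (Real.log 8 * x / Real.log (Real.log x)) ≤ Mx x := by
  filter_upwards [eventually_scales 0] with x ⟨v, w, _, hv, hvx, hw, hwx, hvw, hwx3, hxw⟩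
  rw [← hvx]
  obtain ⟨hw1, hvw1, hx4, hxw2, hxv1, hxv2, hxv3, hxv4⟩ := scale_bounds hv hvw hwx3
  have hu : 1000 ≤ w ^ 4 := by
    calc (1000 : ℝ) ≤ w := hw1
      _ = w ^ 1 := (pow_one w).symm
      _ ≤ w ^ 4 := pow_le_pow_right₀ (by linarith) (by norm_num)
  set u := w ^ 4 with hudef
  have hxu : u ≤ x := by linarith [Real.add_one_le_exp u]
  have hMpos : (0 : ℝ) < Mx x := by
    rw [Mx_eq_primorial]
    exact_mod_cast primorial_pos _
  rw [← Real.le_log_iff_exp_le hMpos, Mx_eq_primorial, ← Chebyshev.theta_eq_log_primorial]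
  have hθ := Chebyshev.theta_ge' (by linarith : 1 ≤ x)
  rw [← hwx] at hθ
  have hx0 : 0 < x := by linarith
  have hlog : Real.log (x + 2) ≤ 2 * u := by
    have h1 : x + 2 ≤ x ^ 2 := by nlinarith
    calc Real.log (x + 2) ≤ Real.log (x ^ 2) := Real.log_le_log (by linarith) h1
      _ = 2 * u := by rw [Real.log_pow, ← hwx]; norm_num
  set s := Real.sqrt x with hs
  have hss : s * s = x := Real.mul_self_sqrt hx0.le
  have hsu : u ^ 2 / 8 ≤ s := by
    have h1 : s = Real.exp (u / 2) := by
      rw [hs, hxw, Real.exp_half]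
    have h2 := Real.pow_div_factorial_le_exp (u / 2) (by linarith) 2
    rw [h1]
    refine le_trans (le_of_eq ?_) h2
    norm_num [Nat.factorial]
    ring
  have hsu2 : 100 * u ≤ s := by nlinarith
  have hs0 : 100 ≤ s := by linarith
  have h1 : s * u ≤ 0.01 * x := by nlinarith
  have h2 : u ≤ 0.01 * x := by nlinarith
  have hl2 : 0.69 < Real.log 2 := by
    have := Real.log_two_gt_d9
    norm_num at this ⊢
    linarith
  have hl8 : Real.log 8 < 3 := by
    rw [show (8 : ℝ) = 2 ^ 3 by norm_num, Real.log_pow]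
    have := Real.log_two_lt_d9
    norm_num at this ⊢
    linarith
  have h3 : Real.log 8 * x / v ≤ 0.1 * x := by
    rw [div_le_iff₀ (by linarith)]
    calc Real.log 8 * x ≤ 3 * x := by gcongr
      _ ≤ 0.1 * x * 1000 := by linarith
      _ ≤ 0.1 * x * v := by gcongr
  have h4 : (x - 1) * 0.69 ≤ (x - 1) * Real.log 2 :=
    mul_le_mul_of_nonneg_left hl2.le (by linarith)
  linarith

end Equidistribution

/-- For any fixed `c > log 8`, the equidistribution of `x`-pseudosquares holds uniformly
in intervals `(A, A+N]` of length `N ≥ exp(c·x / log log x)`. -/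
theorem pseudosquares_equidistributed_log8 (c : ℝ) (hc : Real.log 8 < c) :
    ∀ ε : ℝ, 0 < ε → ∃ x₀ : ℝ, ∀ x : ℝ, x₀ ≤ x → ∀ A : ℝ, 0 ≤ A →
      ∀ N : ℝ, Real.exp (c * x / Real.log (Real.log x)) ≤ N →
        |(pseudosquaresIn x A N : ℝ) -
            N / (Mx x : ℝ) * (pseudosquaresIn x 0 (Mx x) : ℝ)| ≤
          ε * (N / (Mx x : ℝ) * (pseudosquaresIn x 0 (Mx x) : ℝ)) := by
  intro ε hε
  set η := min ε 1 / 4 with hη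
  have hη0 : 0 < η := by positivity
  have hηε : 4 * η ≤ ε := by
    have := min_le_left ε 1
    linarith
  have hη1 : 4 * η ≤ 1 := by
    have := min_le_right ε 1
    linarith
  obtain ⟨x₀, hx₀⟩ := Filter.eventually_atTop.mp
    (((eventually_abs_pseudosquaresIn_sub_le hη0).and eventually_exp_le_Mx).and
      (eventually_scales 0))
  refine ⟨x₀, fun x hx A hA N hN => ?_⟩
  obtain ⟨⟨⟨ρ, hρ, hcount⟩, hM⟩, v, w, _, hv, hvx, _, _, _, hwx3, _⟩ := hx₀ x hx
  have hx0 : 0 ≤ x := le_trans (by positivity) hwx3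
  have hN' : Real.exp (Real.log 8 * x / Real.log (Real.log x)) ≤ N := by
    refine le_trans (Real.exp_le_exp.mpr ?_) hN
    rw [← hvx]
    gcongr
  have hN0 : 0 < N := lt_of_lt_of_le (Real.exp_pos _) hN
  have hM0 : (0 : ℝ) < Mx x := lt_of_lt_of_le (Real.exp_pos _) hM
  have h1 := hcount A hA N hN'
  have h2 := hcount 0 le_rfl (Mx x) hM
  have h3 : |N / (Mx x : ℝ) * (pseudosquaresIn x 0 (Mx x) : ℝ) - N * ρ| ≤ η * (N * ρ) := by
    have e : N / (Mx x : ℝ) * (pseudosquaresIn x 0 (Mx x) : ℝ) - N * ρ =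
        N / (Mx x : ℝ) * ((pseudosquaresIn x 0 (Mx x) : ℝ) - Mx x * ρ) := by field_simp
    rw [e, abs_mul, abs_of_pos (div_pos hN0 hM0)]
    calc N / (Mx x : ℝ) * |(pseudosquaresIn x 0 (Mx x) : ℝ) - Mx x * ρ|
        ≤ N / (Mx x : ℝ) * (η * (Mx x * ρ)) := by gcongr
      _ = η * (N * ρ) := by field_simp
  set X := N / (Mx x : ℝ) * (pseudosquaresIn x 0 (Mx x) : ℝ) with hX
  have hNρ : 0 < N * ρ := mul_pos hN0 hρ
  have h4 : 3 / 4 * (N * ρ) ≤ X := by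
    have := (abs_le.mp h3).1
    nlinarith
  have h5 : ε * (3 / 4 * (N * ρ)) ≤ ε * X := by gcongr
  calc |(pseudosquaresIn x A N : ℝ) - X|
      ≤ |(pseudosquaresIn x A N : ℝ) - N * ρ| + |N * ρ - X| := abs_sub_le _ _ _
    _ ≤ η * (N * ρ) + η * (N * ρ) := by
        rw [abs_sub_comm (N * ρ)]
        exact add_le_add h1 h3
    _ ≤ ε * (3 / 4 * (N * ρ)) := by nlinarith
    _ ≤ ε * X := h5
end

section
/- For every ε > 0 there exists x₀ such that for all real x ≥ x₀, every real A ≥ 0, and every real N ≥ exp(x^{1/2}), the number of positive integers n with A < 8n+1 ≤ A+N and gcd(8n+1, M(x)/2) = 1 lies within a factor (1 ± ε) of N/(4 e^γ log x). -/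
open scoped BigOperators

open Finset Filter Topology MeasureTheory

open Nat in
theorem log_factorial_eq_sum_primesLE (n : ℕ) :
    Real.log (n ! : ℕ) = ∑ p ∈ primesLE n, (padicValNat p (n !) : ℝ) * Real.log p := by
  rw [Real.log_nat_eq_sum_factorization, Finsupp.sum_of_support_subset (s := primesLE n)]
  · refine Finset.sum_congr rfl fun p hp => ?_
    rw [Nat.factorization_def _ (prime_of_mem_primesLE hp)]
  · intro p hp
    rw [Nat.support_factorization, Nat.mem_primeFactors] at hp
    exact mem_primesLE.2 ⟨hp.1.dvd_factorial.1 hp.2.1, hp.1⟩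
  · simp

theorem summable_log_div_mul_sub_one :
    Summable fun n : ℕ => Real.log n / ((n : ℝ) * ((n : ℝ) - 1)) := by
  have h : Summable fun n : ℕ => 4 * (1 / (n : ℝ) ^ (3 / 2 : ℝ)) :=
    (Real.summable_one_div_nat_rpow.2 (by norm_num)).mul_left 4
  refine h.of_nonneg_of_le (fun n => ?_) (fun n => ?_)
  · rcases Nat.lt_or_ge n 2 with hn | hn
    · interval_cases n <;> simp
    · have : (2 : ℝ) ≤ n := by exact_mod_cast hn
      exact div_nonneg (Real.log_natCast_nonneg n) (mul_nonneg (by linarith) (by linarith))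
  · rcases Nat.lt_or_ge n 2 with hn | hn
    · interval_cases n <;> simp
    · have h2 : (2 : ℝ) ≤ n := by exact_mod_cast hn
      have hn0 : (0 : ℝ) < n := by linarith
      have hl : Real.log n ≤ 2 * (n : ℝ) ^ (1 / 2 : ℝ) := by
        have := Real.log_le_rpow_div hn0.le (show (0 : ℝ) < 1 / 2 by norm_num)
        linarith
      have hs : (n : ℝ) ^ (1 / 2 : ℝ) * (n : ℝ) ^ (3 / 2 : ℝ) = n * n := by
        rw [← Real.rpow_add hn0]; norm_num; ring
      have h3 : 0 < (n : ℝ) ^ (3 / 2 : ℝ) := Real.rpow_pos_of_pos hn0 _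
      rw [mul_one_div, div_le_div_iff₀ (mul_pos hn0 (by linarith)) h3]
      calc Real.log n * (n : ℝ) ^ (3 / 2 : ℝ) ≤ 2 * (n : ℝ) ^ (1 / 2 : ℝ) * (n : ℝ) ^ (3 / 2 : ℝ) := by
            gcongr
        _ = 2 * (n * n) := by rw [mul_assoc, hs]
        _ ≤ 4 * (n * (n - 1)) := by nlinarith

open Nat in
theorem log_factorial_ge_sum (n : ℕ) :
    ∑ p ∈ primesLE n, ((n : ℝ) / p - 1) * Real.log p ≤ Real.log (n ! : ℕ) := by
  rw [log_factorial_eq_sum_primesLE]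
  refine Finset.sum_le_sum fun p hp => mul_le_mul_of_nonneg_right ?_ (Real.log_natCast_nonneg p)
  have hpp := prime_of_mem_primesLE hp
  have h1 : n / p ≤ padicValNat p (n !) := by
    rw [← Nat.factorization_def _ hpp, ← hpp.pow_dvd_iff_le_factorization (Nat.factorial_ne_zero n)]
    have h2 : p ^ (n / p) ∣ (p * (n / p))! := by
      generalize n / p = k
      induction k with
      | zero => simp
      | succ k ih =>
        rw [pow_succ, Nat.mul_succ]
        refine (Nat.mul_dvd_mul ih ?_).trans (Nat.factorial_mul_factorial_dvd_factorial_add _ _)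
        exact Nat.dvd_factorial hpp.pos le_rfl
    exact h2.trans (Nat.factorial_dvd_factorial (Nat.mul_div_le n p))
  have h3 : (n : ℝ) / p < (n / p : ℕ) + 1 := by
    have hp0 : (0 : ℝ) < p := by exact_mod_cast hpp.pos
    rw [div_lt_iff₀ hp0]
    rw [mul_comm]
    exact_mod_cast Nat.lt_mul_div_succ n hpp.pos
  have h4 : ((n / p : ℕ) : ℝ) ≤ padicValNat p (n !) := by exact_mod_cast h1
  linarith

open Nat in
theorem log_factorial_le_sum (n : ℕ) :
    Real.log (n ! : ℕ) ≤ ∑ p ∈ primesLE n, ((n : ℝ) / (p - 1)) * Real.log p := by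
  rw [log_factorial_eq_sum_primesLE]
  refine Finset.sum_le_sum fun p hp => mul_le_mul_of_nonneg_right ?_ (Real.log_natCast_nonneg p)
  have hpp := prime_of_mem_primesLE hp
  have : Fact p.Prime := ⟨hpp⟩
  have h1 : (1 : ℝ) < p := by exact_mod_cast hpp.one_lt
  have h2 : (p - 1) * padicValNat p (n !) ≤ n := by
    rw [sub_one_mul_padicValNat_factorial]; exact Nat.sub_le _ _
  rw [le_div_iff₀ (by linarith), mul_comm]
  have := (Nat.cast_le (α := ℝ)).2 h2
  rwa [Nat.cast_mul, Nat.cast_sub hpp.one_lt.le, Nat.cast_one] at this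

theorem exists_abs_sum_log_div_sub_log_le :
    ∃ C : ℝ, ∀ n : ℕ, 1 ≤ n →
      |∑ p ∈ Nat.primesLE n, Real.log p / p - Real.log n| ≤ C := by
  set K := ∑' n : ℕ, Real.log n / ((n : ℝ) * ((n : ℝ) - 1)) with hK
  refine ⟨max (Real.log 4) (1 + K), fun n hn => ?_⟩
  have hn0 : (0 : ℝ) < n := by exact_mod_cast hn
  have hup : (n : ℝ) * ∑ p ∈ Nat.primesLE n, Real.log p / p ≤
      n * (Real.log n + Real.log 4) := by
    have h1 := log_factorial_ge_sum n
    have h2 : Real.log (n.factorial : ℕ) ≤ n * Real.log n := by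
      rw [← Real.log_pow]
      exact Real.log_le_log (by exact_mod_cast n.factorial_pos)
        (by exact_mod_cast Nat.factorial_le_pow n)
    have h3 := Chebyshev.theta_le_log4_mul_x hn0.le
    rw [Chebyshev.theta_eq_sum_primesLE_log] at h3
    have h4 : ∑ p ∈ Nat.primesLE n, ((n : ℝ) / p - 1) * Real.log p =
        n * ∑ p ∈ Nat.primesLE n, Real.log p / p - ∑ p ∈ Nat.primesLE n, Real.log p := by
      rw [Finset.mul_sum, ← Finset.sum_sub_distrib]
      exact Finset.sum_congr rfl fun p _ => by ring
    linarith
  have hlow : (n : ℝ) * (Real.log n - 1 - K) ≤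
      n * ∑ p ∈ Nat.primesLE n, Real.log p / p := by
    have h1 := log_factorial_le_sum n
    have h2 : (n : ℝ) * Real.log n - n ≤ Real.log (n.factorial : ℕ) := by
      have := Stirling.le_log_factorial_stirling (n := n) (by omega)
      have h3 : 0 ≤ Real.log n := Real.log_natCast_nonneg n
      have h4 : 0 ≤ Real.log (2 * Real.pi) := Real.log_nonneg (by linarith [Real.pi_gt_three])
      linarith
    have h3 : ∑ p ∈ Nat.primesLE n, ((n : ℝ) / (p - 1)) * Real.log p =
        n * ∑ p ∈ Nat.primesLE n, Real.log p / p +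
          n * ∑ p ∈ Nat.primesLE n, Real.log p / ((p : ℝ) * ((p : ℝ) - 1)) := by
      rw [Finset.mul_sum, Finset.mul_sum, ← Finset.sum_add_distrib]
      refine Finset.sum_congr rfl fun p hp => ?_
      have hp1 : (1 : ℝ) < p := by exact_mod_cast Nat.one_lt_of_mem_primesLE hp
      have : (p : ℝ) - 1 ≠ 0 := by linarith
      field_simp
      ring
    have h4 : ∑ p ∈ Nat.primesLE n, Real.log p / ((p : ℝ) * ((p : ℝ) - 1)) ≤ K := by
      refine summable_log_div_mul_sub_one.sum_le_tsum _ fun p _ => ?_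
      rcases Nat.lt_or_ge p 2 with hp | hp
      · interval_cases p <;> simp
      · have : (2 : ℝ) ≤ p := by exact_mod_cast hp
        exact div_nonneg (Real.log_natCast_nonneg p) (mul_nonneg (by linarith) (by linarith))
    have := mul_le_mul_of_nonneg_left h4 hn0.le
    linarith
  have hup' := le_of_mul_le_mul_left hup hn0
  have hlow' := le_of_mul_le_mul_left hlow hn0
  rw [abs_le]
  constructor
  · linarith [le_max_right (Real.log 4) (1 + K)]
  · linarith [le_max_left (Real.log 4) (1 + K)]

theorem exists_abs_sum_log_div_sub_log_le_real :
    ∃ C : ℝ, ∀ x : ℝ, 2 ≤ x →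
      |∑ p ∈ Nat.primesLE ⌊x⌋₊, Real.log p / p - Real.log x| ≤ C := by
  obtain ⟨C, hC⟩ := exists_abs_sum_log_div_sub_log_le
  refine ⟨C + Real.log 2, fun x hx => ?_⟩
  have hn : 1 ≤ ⌊x⌋₊ := Nat.le_floor (by norm_num; linarith)
  have hn' : (1 : ℝ) ≤ (⌊x⌋₊ : ℝ) := by exact_mod_cast hn
  have h1 : Real.log ⌊x⌋₊ ≤ Real.log x :=
    Real.log_le_log (by linarith) (Nat.floor_le (by linarith))
  have h2 : Real.log x ≤ Real.log 2 + Real.log ⌊x⌋₊ := by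
    rw [← Real.log_mul (by norm_num) (by linarith)]
    exact Real.log_le_log (by linarith) (by linarith [Nat.lt_floor_add_one x])
  have h3 := abs_le.1 (hC _ hn)
  rw [abs_le]
  constructor <;> linarith [Real.log_pos one_lt_two]

theorem hasDerivAt_inv_log {t : ℝ} (ht : 1 < t) :
    HasDerivAt (fun t => (Real.log t)⁻¹) (-(t⁻¹ / Real.log t ^ 2)) t := by
  exact ((Real.hasDerivAt_log (by linarith : t ≠ 0)).fun_inv (Real.log_pos ht).ne').congr_deriv
    (neg_div _ _)

theorem continuousOn_inv_div_log_sq (b : ℝ) :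
    ContinuousOn (fun t : ℝ => t⁻¹ / Real.log t ^ 2) (Set.Icc 2 b) := by
  intro t ht
  have h2 := ht.1
  have h0 : t ≠ 0 := by linarith
  have hl : Real.log t ^ 2 ≠ 0 := pow_ne_zero 2 (Real.log_pos (by linarith)).ne'
  exact (ContinuousAt.div (continuousAt_inv₀ h0) ((Real.continuousAt_log h0).pow 2)
    hl).continuousWithinAt

theorem integrableOn_inv_div_log_sq :
    IntegrableOn (fun t : ℝ => t⁻¹ / Real.log t ^ 2) (Set.Ioi 2) := by
  refine integrableOn_Ioi_deriv_of_nonneg' (g := fun t => -(Real.log t)⁻¹) (l := 0)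
    (fun t ht => ?_) (fun t ht => ?_) ?_
  · exact (hasDerivAt_inv_log (by linarith [Set.mem_Ici.1 ht])).fun_neg.congr_deriv (neg_neg _)
  · have : (2 : ℝ) < t := ht
    positivity
  · simpa using (tendsto_inv_atTop_zero.comp Real.tendsto_log_atTop).neg

theorem sum_primesLE_one_div_eq {x : ℝ} :
    ∑ p ∈ Nat.primesLE ⌊x⌋₊, 1 / (p : ℝ) =
      (Real.log x)⁻¹ * ∑ p ∈ Nat.primesLE ⌊x⌋₊, Real.log p / p +
        ∫ t in Set.Ioc 2 x, t⁻¹ / Real.log t ^ 2 * ∑ p ∈ Nat.primesLE ⌊t⌋₊, Real.log p / p := by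
  have key := sum_mul_eq_sub_integral_mul₁ (f := fun t => (Real.log t)⁻¹)
    (fun k : ℕ => if k.Prime then Real.log k / k else 0) (by simp) (by simp) x
    (fun t ht => (hasDerivAt_inv_log (by linarith [ht.1])).differentiableAt) ?_
  · simp only [mul_ite, mul_zero, ← Finset.sum_filter, ← Nat.primesLE_eq_filter_Icc_zero] at key
    have h1 : ∑ p ∈ Nat.primesLE ⌊x⌋₊, 1 / (p : ℝ) =
        ∑ p ∈ Nat.primesLE ⌊x⌋₊, (Real.log p)⁻¹ * (Real.log p / p) := by
      refine Finset.sum_congr rfl fun p hp => ?_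
      have hp1 : (1 : ℝ) < p := by exact_mod_cast Nat.one_lt_of_mem_primesLE hp
      have := (Real.log_pos hp1).ne'
      field_simp
    rw [h1, key, sub_eq_add_neg, ← integral_neg]
    congr 1
    refine setIntegral_congr_fun measurableSet_Ioc fun t ht => ?_
    rw [(hasDerivAt_inv_log (by linarith [ht.1])).deriv]
    ring
  · refine ContinuousOn.integrableOn_Icc ((continuousOn_inv_div_log_sq x).neg.congr fun t ht => ?_)
    exact (hasDerivAt_inv_log (by linarith [ht.1])).deriv

theorem integral_inv_mul_inv_log {x : ℝ} (hx : 2 ≤ x) :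
    IntegrableOn (fun t : ℝ => t⁻¹ / Real.log t ^ 2 * Real.log t) (Set.Ioc 2 x) ∧
      ∫ t in Set.Ioc 2 x, t⁻¹ / Real.log t ^ 2 * Real.log t =
        Real.log (Real.log x) - Real.log (Real.log 2) := by
  have hcont : ContinuousOn (fun t : ℝ => t⁻¹ / Real.log t ^ 2 * Real.log t) (Set.Icc 2 x) :=
    (continuousOn_inv_div_log_sq x).mul
      (Real.continuousOn_log.mono fun t ht => by
        have := ht.1
        simp only [Set.mem_compl_iff, Set.mem_singleton_iff]
        linarith)
  refine ⟨hcont.integrableOn_Icc.mono_set Set.Ioc_subset_Icc_self, ?_⟩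
  rw [← intervalIntegral.integral_of_le hx]
  refine intervalIntegral.integral_eq_sub_of_hasDerivAt (f := fun t => Real.log (Real.log t))
    (fun t ht => ?_) ?_
  · rw [Set.uIcc_of_le hx] at ht
    have h1 : 1 < t := by linarith [ht.1]
    have h2 := (Real.log_pos h1).ne'
    refine ((Real.hasDerivAt_log (by linarith : t ≠ 0)).log h2).congr_deriv ?_
    field_simp
  · refine ContinuousOn.intervalIntegrable ?_
    rwa [Set.uIcc_of_le hx]

theorem exists_tendsto_sum_one_div_sub_log_log :
    ∃ b : ℝ, Tendsto (fun x : ℝ => ∑ p ∈ Nat.primesLE ⌊x⌋₊, 1 / (p : ℝ) - Real.log (Real.log x))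
      atTop (𝓝 b) := by
  obtain ⟨C, hC⟩ := exists_abs_sum_log_div_sub_log_le_real
  set R : ℝ → ℝ := fun x => ∑ p ∈ Nat.primesLE ⌊x⌋₊, Real.log p / p - Real.log x with hR
  have hRm : Measurable R := by
    refine Measurable.sub ?_ Real.measurable_log
    exact (measurable_from_top (f := fun n : ℕ => ∑ p ∈ Nat.primesLE n, Real.log p / p)).comp
      Nat.measurable_floor
  have hInt : IntegrableOn (fun t : ℝ => t⁻¹ / Real.log t ^ 2 * R t) (Set.Ioi 2) := by
    refine Integrable.mul_bdd (c := C) integrableOn_inv_div_log_sq hRm.aestronglyMeasurable ?_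
    refine (ae_restrict_iff' measurableSet_Ioi).2 (Eventually.of_forall fun t ht => ?_)
    exact hC t (le_of_lt ht)
  have hlim := intervalIntegral_tendsto_integral_Ioi 2 hInt tendsto_id
  have hRl : Tendsto (fun x => (Real.log x)⁻¹ * R x) atTop (𝓝 0) := by
    refine (tendsto_inv_atTop_zero.comp Real.tendsto_log_atTop).zero_mul_isBoundedUnder_le ?_
    refine ⟨C, ?_⟩
    rw [eventually_map]
    filter_upwards [eventually_ge_atTop 2] with x hx using hC x hx
  refine ⟨1 + 0 + (∫ t in Set.Ioi 2, t⁻¹ / Real.log t ^ 2 * R t) - Real.log (Real.log 2), ?_⟩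
  refine ((((tendsto_const_nhds (x := (1 : ℝ))).add hRl).add hlim).sub
    (tendsto_const_nhds (x := Real.log (Real.log 2)))).congr' ?_
  filter_upwards [eventually_ge_atTop 2] with x hx
  have hl : Real.log x ≠ 0 := (Real.log_pos (by linarith)).ne'
  obtain ⟨hi, he⟩ := integral_inv_mul_inv_log hx
  have h1 : ∫ t in Set.Ioc 2 x, t⁻¹ / Real.log t ^ 2 * ∑ p ∈ Nat.primesLE ⌊t⌋₊, Real.log p / p =
      (Real.log (Real.log x) - Real.log (Real.log 2)) +
        ∫ t in Set.Ioc 2 x, t⁻¹ / Real.log t ^ 2 * R t := by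
    rw [← he, ← integral_add hi (hInt.mono_set Set.Ioc_subset_Ioi_self)]
    refine integral_congr_ae (Eventually.of_forall fun t => ?_)
    simp only [hR]
    ring
  rw [sum_primesLE_one_div_eq, h1, id, intervalIntegral.integral_of_le hx]
  simp only [hR]
  field_simp
  ring

theorem hasSum_neg_log_one_sub_rpow {s : ℝ} (hs : 0 < s) :
    HasSum (fun p : Nat.Primes => -Real.log (1 - (p : ℝ) ^ (-(1 + s))))
      (Real.log (∑' n : ℕ, 1 / (n : ℝ) ^ (1 + s))) := by
  let f : ℕ →*₀ ℝ :=
    { toFun := fun n => (n : ℝ) ^ (-(1 + s))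
      map_zero' := by rw [Nat.cast_zero, Real.zero_rpow (by linarith)]
      map_one' := by simp
      map_mul' := fun m n => by rw [Nat.cast_mul, Real.mul_rpow m.cast_nonneg n.cast_nonneg] }
  have hfe : ∀ n : ℕ, f n = 1 / (n : ℝ) ^ (1 + s) := fun n => by
    rw [one_div, ← Real.rpow_neg n.cast_nonneg]; rfl
  have hsum : Summable fun n : ℕ => 1 / (n : ℝ) ^ (1 + s) :=
    Real.summable_one_div_nat_rpow.2 (by linarith)
  have hprod := EulerProduct.eulerProduct_completely_multiplicative_hasProd (f := f)
    (by simp only [hfe]; exact hsum.norm)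
  simp only [hfe] at hprod
  have hpos : 0 < ∑' n : ℕ, 1 / (n : ℝ) ^ (1 + s) :=
    hsum.tsum_pos (fun n => by positivity) 1 (by simp)
  have hlt : ∀ p : Nat.Primes, (p : ℝ) ^ (-(1 + s)) < 1 := fun p =>
    Real.rpow_lt_one_of_one_lt_of_neg (by exact_mod_cast p.2.one_lt) (by linarith)
  have hlog := (Real.continuousAt_log hpos.ne').tendsto.comp hprod
  refine hlog.congr fun S => ?_
  simp only [Function.comp]
  rw [Real.log_prod]
  · refine Finset.sum_congr rfl fun p _ => ?_
    rw [Real.log_inv, Real.rpow_neg (Nat.cast_nonneg _), one_div]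
  · intro p _
    have := hlt p
    rw [Real.rpow_neg (Nat.cast_nonneg _), ← one_div] at this
    exact inv_ne_zero (by linarith)

theorem tendsto_log_tsum_one_div_rpow_add_log :
    Tendsto (fun s : ℝ => Real.log (∑' n : ℕ, 1 / (n : ℝ) ^ (1 + s)) + Real.log s)
      (𝓝[>] 0) (𝓝 0) := by
  have h1 : Tendsto (fun s : ℝ => 1 + s) (𝓝[>] 0) (𝓝[>] 1) := by
    refine tendsto_nhdsWithin_iff.2 ⟨?_, ?_⟩
    · refine tendsto_nhdsWithin_of_tendsto_nhds ?_
      simpa using (by fun_prop : Continuous fun s : ℝ => 1 + s).tendsto 0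
    · filter_upwards [self_mem_nhdsWithin] with s hs
      simpa using hs
  have h2 := ((Real.continuousAt_log one_ne_zero).tendsto.comp
    (tendsto_sub_mul_tsum_nat_rpow.comp h1))
  rw [Real.log_one] at h2
  refine h2.congr' ?_
  filter_upwards [self_mem_nhdsWithin] with s hs
  have hs : 0 < s := hs
  have hsum : Summable fun n : ℕ => 1 / (n : ℝ) ^ (1 + s) :=
    Real.summable_one_div_nat_rpow.2 (by linarith)
  have hpos : 0 < ∑' n : ℕ, 1 / (n : ℝ) ^ (1 + s) :=
    hsum.tsum_pos (fun n => by positivity) 1 (by simp)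
  simp only [Function.comp]
  rw [add_sub_cancel_left, Real.log_mul hs.ne' hpos.ne', add_comm]

theorem abs_neg_log_one_sub_sub_le {y : ℝ} (h0 : 0 ≤ y) (h1 : y ≤ 1 / 2) :
    |-Real.log (1 - y) - y| ≤ 2 * y ^ 2 := by
  have h := Real.abs_log_sub_add_sum_range_le (x := y) (by rw [abs_of_nonneg h0]; linarith) 1
  simp only [Finset.sum_range_one, zero_add, pow_one, Nat.cast_zero, div_one,
    abs_of_nonneg h0] at h
  calc |-Real.log (1 - y) - y| = |y + Real.log (1 - y)| := by rw [← abs_neg]; ring_nf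
    _ ≤ y ^ 2 / (1 - y) := h
    _ ≤ 2 * y ^ 2 := by
      rw [div_le_iff₀ (by linarith)]
      nlinarith [mul_nonneg (sq_nonneg y) (by linarith : 0 ≤ 1 - 2 * y)]

theorem summable_primes_two_mul_inv_sq :
    Summable fun p : Nat.Primes => 2 * ((p : ℝ)⁻¹) ^ 2 := by
  have h : Summable fun n : ℕ => 2 * ((n : ℝ)⁻¹) ^ 2 := by
    simpa [inv_pow] using (Real.summable_nat_pow_inv.2 (by norm_num : 1 < 2)).mul_left 2
  exact h.comp_injective Subtype.val_injective

theorem tendsto_tsum_neg_log_one_sub_rpow_sub :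
    Tendsto (fun s : ℝ => ∑' p : Nat.Primes,
        (-Real.log (1 - (p : ℝ) ^ (-(1 + s))) - (p : ℝ) ^ (-(1 + s))))
      (𝓝[>] 0) (𝓝 (∑' p : Nat.Primes, (-Real.log (1 - (p : ℝ)⁻¹) - (p : ℝ)⁻¹))) := by
  refine tendsto_tsum_of_dominated_convergence summable_primes_two_mul_inv_sq (fun p => ?_) ?_
  · have hp : (1 : ℝ) < p := by exact_mod_cast p.2.one_lt
    have h1 : Tendsto (fun s : ℝ => (p : ℝ) ^ (-(1 + s))) (𝓝[>] 0) (𝓝 (p : ℝ)⁻¹) := by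
      refine tendsto_nhdsWithin_of_tendsto_nhds ?_
      have hc : Continuous fun s : ℝ => (p : ℝ) ^ (-(1 + s)) :=
        Continuous.rpow continuous_const (by fun_prop) fun _ => Or.inl (by linarith)
      simpa [Real.rpow_neg_one] using hc.tendsto 0
    have h2 : (1 : ℝ) - (p : ℝ)⁻¹ ≠ 0 := by
      have := inv_lt_one_of_one_lt₀ hp
      linarith
    exact ((h1.const_sub 1).log h2).neg.sub h1
  · filter_upwards [self_mem_nhdsWithin] with s hs p
    have hs : 0 < s := hs
    have hp : (2 : ℝ) ≤ p := by exact_mod_cast p.2.two_le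
    have h1 : (p : ℝ) ^ (-(1 + s)) ≤ (p : ℝ)⁻¹ := by
      rw [← Real.rpow_neg_one]
      exact Real.rpow_le_rpow_of_exponent_le (by linarith) (by linarith)
    have h2 : (p : ℝ)⁻¹ ≤ 1 / 2 := by
      rw [inv_le_comm₀ (by linarith) (by norm_num)]; simpa using hp
    have h0 : 0 ≤ (p : ℝ) ^ (-(1 + s)) := Real.rpow_nonneg (by linarith) _
    refine (abs_neg_log_one_sub_sub_le h0 (h1.trans h2)).trans ?_
    gcongr

theorem integral_log_mul_exp_neg :
    ∫ t in Set.Ioi (0 : ℝ), Real.log t * Real.exp (-t) = -Real.eulerMascheroniConstant := by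
  have h1 := Complex.hasDerivAt_GammaIntegral (s := 1) (by simp)
  have h2 : HasDerivAt Complex.GammaIntegral (-Real.eulerMascheroniConstant : ℂ) 1 := by
    refine Complex.hasDerivAt_Gamma_one.congr_of_eventuallyEq ?_
    have : {s : ℂ | 0 < s.re} ∈ 𝓝 (1 : ℂ) :=
      (isOpen_lt continuous_const Complex.continuous_re).mem_nhds (by simp)
    filter_upwards [this] with s hs
    exact (Complex.Gamma_eq_integral hs).symm
  have h3 := h1.unique h2
  simp only [sub_self, Complex.cpow_zero, one_mul] at h3
  have h4 : ((∫ t in Set.Ioi (0 : ℝ), Real.log t * Real.exp (-t) : ℝ) : ℂ) =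
      (-Real.eulerMascheroniConstant : ℝ) := by
    rw [← integral_complex_ofReal]
    push_cast
    push_cast at h3
    exact h3
  exact_mod_cast h4

theorem integrableOn_log_mul_exp_neg :
    IntegrableOn (fun t : ℝ => Real.log t * Real.exp (-t)) (Set.Ioi 0) := by
  refine Integrable.of_integral_ne_zero ?_
  rw [integral_log_mul_exp_neg]
  linarith [Real.one_half_lt_eulerMascheroniConstant]

theorem tsum_primes_rpow_eq_integral {s : ℝ} (hs : 0 < s) :
    ∑' p : Nat.Primes, (p : ℝ) ^ (-(1 + s)) =
      ∫ t in Set.Ioi (0 : ℝ),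
        (∑ p ∈ Nat.primesLE ⌊Real.exp (t / s)⌋₊, 1 / (p : ℝ)) * Real.exp (-t) := by
  set F : Nat.Primes → ℝ → ℝ := fun p =>
    (Set.Ici (s * Real.log p)).indicator fun t => 1 / (p : ℝ) * Real.exp (-t) with hF
  have hlog : ∀ p : Nat.Primes, 0 < s * Real.log p := fun p =>
    mul_pos hs (Real.log_pos (by exact_mod_cast p.2.one_lt))
  have hexp : ∀ p : Nat.Primes, IntegrableOn (fun t => 1 / (p : ℝ) * Real.exp (-t)) (Set.Ioi 0) :=
    fun p => (integrableOn_exp_neg_Ioi 0).const_mul _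
  have hFi : ∀ p, Integrable (F p) (volume.restrict (Set.Ioi 0)) := fun p =>
    (hexp p).indicator measurableSet_Ici
  have hFint : ∀ p, ∫ t in Set.Ioi 0, F p t = (p : ℝ) ^ (-(1 + s)) := fun p => by
    have hp0 : (0 : ℝ) < p := by exact_mod_cast p.2.pos
    rw [setIntegral_indicator measurableSet_Ici,
      (Set.inter_eq_right.2 fun t ht => (hlog p).trans_le ht :
        Set.Ioi 0 ∩ Set.Ici (s * Real.log p) = Set.Ici (s * Real.log p)), integral_Ici_eq_integral_Ioi,
      integral_const_mul, integral_exp_neg_Ioi, Real.rpow_def_of_pos hp0, neg_add, mul_add,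
      Real.exp_add, mul_neg_one, Real.exp_neg (Real.log p), Real.exp_log hp0, one_div]
    congr 2
    ring
  have hFn : ∀ p t, ‖F p t‖ = F p t := fun p t =>
    Real.norm_of_nonneg (Set.indicator_nonneg (fun _ _ => by positivity) t)
  have hsum : Summable fun p => ∫ t in Set.Ioi 0, ‖F p t‖ := by
    simp only [hFn, hFint]
    exact Nat.Primes.summable_rpow.2 (by linarith)
  have key := (hasSum_integral_of_summable_integral_norm hFi hsum).tsum_eq
  simp only [hFint] at key
  rw [key]
  refine integral_congr_ae (Eventually.of_forall fun t => ?_)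
  have h1 : ∀ p : Nat.Primes, F p t =
      if (p : ℕ) ∈ Nat.primesLE ⌊Real.exp (t / s)⌋₊ then 1 / (p : ℝ) * Real.exp (-t) else 0 := by
    intro p
    have hp0 : (0 : ℝ) < p := by exact_mod_cast p.2.pos
    have : t ∈ Set.Ici (s * Real.log p) ↔ (p : ℕ) ∈ Nat.primesLE ⌊Real.exp (t / s)⌋₊ := by
      rw [Nat.mem_primesLE, Nat.le_floor_iff (Real.exp_pos _).le, ← Real.log_le_iff_le_exp hp0,
        le_div_iff₀ hs, Set.mem_Ici, mul_comm]
      exact ⟨fun h => ⟨h, p.2⟩, fun h => h.1⟩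
    simp only [hF, Set.indicator_apply, this]
  simp only [h1]
  rw [Finset.sum_mul]
  have h2 : ∑' p : Nat.Primes, (if (p : ℕ) ∈ Nat.primesLE ⌊Real.exp (t / s)⌋₊ then
      1 / (p : ℝ) * Real.exp (-t) else 0) = ∑' n : ℕ,
        if n ∈ Nat.primesLE ⌊Real.exp (t / s)⌋₊ then 1 / (n : ℝ) * Real.exp (-t) else 0 := by
    rw [Nat.Primes.tsum_eq_tsum_ite (f := fun n : ℕ =>
      if n ∈ Nat.primesLE ⌊Real.exp (t / s)⌋₊ then 1 / (n : ℝ) * Real.exp (-t) else 0)]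
    refine tsum_congr fun n => ite_eq_left_iff.2 fun h => (if_neg fun h' => ?_).symm
    exact h (Nat.prime_of_mem_primesLE h')
  rw [h2, tsum_eq_sum (s := Nat.primesLE ⌊Real.exp (t / s)⌋₊) fun n hn => if_neg hn]
  exact Finset.sum_congr rfl fun n hn => if_pos hn

theorem tendsto_tsum_primes_rpow_add_log {b : ℝ}
    (hb : Tendsto (fun x : ℝ => ∑ p ∈ Nat.primesLE ⌊x⌋₊, 1 / (p : ℝ) - Real.log (Real.log x))
      atTop (𝓝 b)) :
    Tendsto (fun s : ℝ => ∑' p : Nat.Primes, (p : ℝ) ^ (-(1 + s)) + Real.log s) (𝓝[>] 0)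
      (𝓝 (b - Real.eulerMascheroniConstant)) := by
  set B : ℝ → ℝ := fun u => ∑ p ∈ Nat.primesLE ⌊Real.exp u⌋₊, 1 / (p : ℝ) with hB
  set E : ℝ → ℝ := fun u => B u - Real.log u with hE
  have hBmono : Monotone B := fun u v huv =>
    Finset.sum_le_sum_of_subset_of_nonneg
      (Nat.primesLE_mono (Nat.floor_mono (Real.exp_le_exp.2 huv))) fun _ _ _ => by positivity
  have hB0 : ∀ u, 0 ≤ B u := fun u => Finset.sum_nonneg fun _ _ => by positivity
  have hEm : Measurable E := hBmono.measurable.sub Real.measurable_log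
  have hElim : Tendsto E atTop (𝓝 b) := by
    refine (hb.comp Real.tendsto_exp_atTop).congr fun u => ?_
    simp only [Function.comp, Real.log_exp, hE, hB]
  obtain ⟨U, hU1, hU⟩ : ∃ U : ℝ, 1 ≤ U ∧ ∀ u, U ≤ u → |E u| ≤ |b| + 1 := by
    have := hElim.abs.eventually (eventually_le_nhds (lt_add_one |b|))
    obtain ⟨U, hU⟩ := eventually_atTop.1 this
    exact ⟨max 1 U, le_max_left _ _, fun u hu => hU u ((le_max_right _ _).trans hu)⟩
  set C : ℝ := |b| + 1 + B U + Real.log U with hC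
  have hlogU : 0 ≤ Real.log U := Real.log_nonneg hU1
  have hbound : ∀ s : ℝ, 0 < s → s < 1 → ∀ t : ℝ, 0 < t → |E (t / s)| ≤ C + |Real.log t| := by
    intro s hs hs1 t ht
    have hu : 0 < t / s := div_pos ht hs
    rcases le_or_gt U (t / s) with h | h
    · linarith [hU _ h, hB0 U, abs_nonneg (Real.log t)]
    · have h1 : |E (t / s)| ≤ B (t / s) + |Real.log (t / s)| := by
        refine (abs_sub _ _).trans ?_
        rw [abs_of_nonneg (hB0 _)]
      have h2 : B (t / s) ≤ B U := hBmono h.le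
      have h3 : |Real.log (t / s)| ≤ Real.log U + |Real.log t| := by
        rcases le_or_gt 1 (t / s) with h4 | h4
        · rw [abs_of_nonneg (Real.log_nonneg h4)]
          linarith [Real.log_le_log hu h.le, abs_nonneg (Real.log t)]
        · rw [abs_of_nonpos (Real.log_nonpos hu.le h4.le), Real.log_div ht.ne' hs.ne']
          linarith [Real.log_neg hs hs1, neg_le_abs (Real.log t)]
      linarith [abs_nonneg b]
  have hexp : IntegrableOn (fun t : ℝ => Real.exp (-t)) (Set.Ioi 0) := integrableOn_exp_neg_Ioi 0
  have hdom : IntegrableOn (fun t : ℝ => (C + |Real.log t|) * Real.exp (-t)) (Set.Ioi 0) := by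
    have h := (hexp.const_mul C).add integrableOn_log_mul_exp_neg.abs
    refine h.congr (Eventually.of_forall fun t => ?_)
    simp only [Pi.add_apply, abs_mul, abs_of_pos (Real.exp_pos _)]
    ring
  have hmeas : ∀ s : ℝ, AEStronglyMeasurable (fun t => E (t / s) * Real.exp (-t))
      (volume.restrict (Set.Ioi 0)) := fun s =>
    ((hEm.comp (measurable_id.div_const s)).mul
      (Real.measurable_exp.comp measurable_neg)).aestronglyMeasurable
  have hle : ∀ s : ℝ, 0 < s → s < 1 → ∀ᵐ t ∂(volume.restrict (Set.Ioi (0 : ℝ))),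
      ‖E (t / s) * Real.exp (-t)‖ ≤ (C + |Real.log t|) * Real.exp (-t) := fun s hs hs1 => by
    refine (ae_restrict_iff' measurableSet_Ioi).2 (Eventually.of_forall fun t ht => ?_)
    rw [norm_mul, Real.norm_eq_abs, Real.norm_of_nonneg (Real.exp_pos _).le]
    exact mul_le_mul_of_nonneg_right (hbound s hs hs1 t ht) (Real.exp_pos _).le
  have hsmall : ∀ᶠ s : ℝ in 𝓝[>] 0, 0 < s ∧ s < 1 := by
    filter_upwards [Ioo_mem_nhdsGT (zero_lt_one' ℝ)] with s hs using hs
  have hlim : Tendsto (fun s : ℝ => ∫ t in Set.Ioi (0 : ℝ), E (t / s) * Real.exp (-t)) (𝓝[>] 0)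
      (𝓝 (∫ t in Set.Ioi (0 : ℝ), b * Real.exp (-t))) := by
    refine tendsto_integral_filter_of_dominated_convergence _ (Eventually.of_forall hmeas)
      (hsmall.mono fun s hs => hle s hs.1 hs.2) hdom ?_
    refine (ae_restrict_iff' measurableSet_Ioi).2 (Eventually.of_forall fun t ht => ?_)
    refine (hElim.comp ?_).mul_const _
    exact (tendsto_inv_nhdsGT_zero.const_mul_atTop ht).congr fun s => (div_eq_mul_inv t s).symm
  rw [integral_const_mul, integral_exp_neg_Ioi_zero, mul_one] at hlim
  refine (hlim.sub_const Real.eulerMascheroniConstant).congr' ?_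
  filter_upwards [hsmall] with s hs
  have hi1 : IntegrableOn (fun t => E (t / s) * Real.exp (-t)) (Set.Ioi 0) :=
    hdom.mono' (hmeas s) (hle s hs.1 hs.2)
  have hi2 := integrableOn_log_mul_exp_neg
  have hi3 : IntegrableOn (fun t : ℝ => Real.log s * Real.exp (-t)) (Set.Ioi 0) :=
    hexp.const_mul _
  have h1 : ∫ t in Set.Ioi (0 : ℝ), B (t / s) * Real.exp (-t) =
      (∫ t in Set.Ioi (0 : ℝ), E (t / s) * Real.exp (-t)) +
        (∫ t in Set.Ioi (0 : ℝ), Real.log t * Real.exp (-t)) -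
        ∫ t in Set.Ioi (0 : ℝ), Real.log s * Real.exp (-t) := by
    rw [← integral_add hi1 hi2, ← integral_sub (hi1.fun_add hi2) hi3]
    refine setIntegral_congr_fun measurableSet_Ioi fun t ht => ?_
    have ht : 0 < t := ht
    simp only [hE, Real.log_div ht.ne' hs.1.ne']
    ring
  rw [tsum_primes_rpow_eq_integral hs.1]
  change _ = (∫ t in Set.Ioi (0 : ℝ), B (t / s) * Real.exp (-t)) + Real.log s
  rw [h1, integral_log_mul_exp_neg, integral_const_mul, integral_exp_neg_Ioi_zero]
  ring

theorem summable_neg_log_one_sub_inv_sub :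
    Summable fun p : Nat.Primes => -Real.log (1 - (p : ℝ)⁻¹) - (p : ℝ)⁻¹ := by
  refine summable_primes_two_mul_inv_sq.of_norm_bounded fun p => ?_
  have hp : (2 : ℝ) ≤ p := by exact_mod_cast p.2.two_le
  refine abs_neg_log_one_sub_sub_le (by positivity) ?_
  rw [inv_le_comm₀ (by linarith) (by norm_num)]
  simpa using hp

theorem tsum_neg_log_one_sub_inv_sub_eq {b : ℝ}
    (hb : Tendsto (fun x : ℝ => ∑ p ∈ Nat.primesLE ⌊x⌋₊, 1 / (p : ℝ) - Real.log (Real.log x))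
      atTop (𝓝 b)) :
    ∑' p : Nat.Primes, (-Real.log (1 - (p : ℝ)⁻¹) - (p : ℝ)⁻¹) =
      Real.eulerMascheroniConstant - b := by
  have h1 := tendsto_tsum_neg_log_one_sub_rpow_sub.add (tendsto_tsum_primes_rpow_add_log hb)
  have h2 := tendsto_log_tsum_one_div_rpow_add_log
  have h3 := tendsto_nhds_unique (h1.congr' ?_) h2
  · linarith
  · filter_upwards [self_mem_nhdsWithin] with s hs
    have hs : 0 < s := hs
    have hsum : Summable fun p : Nat.Primes => (p : ℝ) ^ (-(1 + s)) :=
      Nat.Primes.summable_rpow.2 (by linarith)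
    have h := hasSum_neg_log_one_sub_rpow hs
    rw [h.summable.tsum_sub hsum, h.tsum_eq]
    ring

/-- The third theorem of Mertens, with its constant. -/
theorem tendsto_prod_one_sub_inv_mul_log :
    Tendsto (fun x : ℝ => (∏ p ∈ Nat.primesLE ⌊x⌋₊, (1 - 1 / (p : ℝ))) * Real.log x) atTop
      (𝓝 (Real.exp (-Real.eulerMascheroniConstant))) := by
  obtain ⟨b, hb⟩ := exists_tendsto_sum_one_div_sub_log_log
  have h1 : Tendsto (fun x : ℝ => ∑ p ∈ Nat.primesLE ⌊x⌋₊,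
      (-Real.log (1 - (p : ℝ)⁻¹) - (p : ℝ)⁻¹)) atTop (𝓝 (Real.eulerMascheroniConstant - b)) := by
    have h := summable_neg_log_one_sub_inv_sub.hasSum
    rw [tsum_neg_log_one_sub_inv_sub_eq hb, Nat.Primes.hasSum_iff_hasSum_ite
      (f := fun n : ℕ => -Real.log (1 - (n : ℝ)⁻¹) - (n : ℝ)⁻¹)] at h
    refine (h.tendsto_sum_nat.comp ((tendsto_add_atTop_nat 1).comp tendsto_nat_floor_atTop)).congr
      fun x => ?_
    simp only [Function.comp, ← Finset.sum_filter, Nat.primesLE_eq_filter_range]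
  have h2 := (Real.continuous_exp.tendsto _).comp (h1.add hb).neg
  rw [sub_add_cancel] at h2
  refine h2.congr' ?_
  filter_upwards [eventually_gt_atTop 1] with x hx
  have hpos : ∀ p ∈ Nat.primesLE ⌊x⌋₊, 0 < 1 - 1 / (p : ℝ) := fun p hp => by
    have hp1 : (1 : ℝ) < p := by exact_mod_cast Nat.one_lt_of_mem_primesLE hp
    rw [one_div]
    linarith [inv_lt_one_of_one_lt₀ hp1]
  rw [← Real.exp_log (Finset.prod_pos hpos), ← Real.exp_log (Real.log_pos hx), ← Real.exp_add,
    Real.log_prod fun p hp => (hpos p hp).ne']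
  simp only [Function.comp, Finset.sum_sub_distrib, Finset.sum_neg_distrib, one_div]
  congr 1
  ring

theorem abs_ite_empty_sub_sum_powerset_le {α : Type*} [DecidableEq α] (S : Finset α) (r : ℕ) :
    |(if S = ∅ then (1 : ℝ) else 0) -
        ∑ D ∈ S.powerset, (if #D ≤ r then (-1 : ℝ) ^ #D else 0)| ≤
      ∑ D ∈ S.powerset, if #D = r then (1 : ℝ) else 0 := by
  rcases S.eq_empty_or_nonempty with rfl | ⟨a, ha⟩
  · simp
  · rw [if_neg (ne_empty_of_mem ha), ← insert_erase ha]
    have hT : a ∉ S.erase a := notMem_erase a S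
    set T := S.erase a
    have hins : ∀ D ∈ T.powerset, #(insert a D) = #D + 1 := fun D hD =>
      card_insert_of_notMem fun h => hT (mem_powerset.1 hD h)
    have h1 : ∑ D ∈ (insert a T).powerset, (if #D ≤ r then (-1 : ℝ) ^ #D else 0) =
        ∑ D ∈ T.powerset, if #D = r then (-1 : ℝ) ^ #D else 0 := by
      rw [sum_powerset_insert hT, ← sum_add_distrib]
      refine sum_congr rfl fun D hD => ?_
      rw [hins D hD]
      rcases lt_trichotomy (#D) r with h | h | h
      · rw [if_pos h.le, if_pos (by omega), if_neg h.ne, pow_succ]; ring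
      · rw [if_pos h.le, if_neg (by omega), if_pos h, add_zero]
      · rw [if_neg (by omega), if_neg (by omega), if_neg h.ne', add_zero]
    rw [h1, zero_sub, abs_neg, sum_powerset_insert hT]
    refine (abs_sum_le_sum_abs _ _).trans ?_
    have h2 : ∑ D ∈ T.powerset, |if #D = r then (-1 : ℝ) ^ #D else 0| =
        ∑ D ∈ T.powerset, if #D = r then (1 : ℝ) else 0 :=
      sum_congr rfl fun D _ => by split_ifs <;> simp
    rw [h2]
    exact le_add_of_nonneg_right (sum_nonneg fun D _ => by positivity)

/-- Brun's pure sieve, truncated at sets of `r` sifting conditions. -/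
theorem abs_card_sifted_sub_le {ι α : Type*} [DecidableEq α] (I : Finset ι) (P : Finset α)
    (Q : α → ι → Prop) [∀ p n, Decidable (Q p n)] (g : α → ℝ) {X c : ℝ} (hX : 0 ≤ X)
    (hg : ∀ p ∈ P, 0 ≤ g p) (r : ℕ)
    (hcount : ∀ D ⊆ P, |(#{n ∈ I | ∀ p ∈ D, Q p n} : ℝ) - X * ∏ p ∈ D, g p| ≤ c) :
    |(#{n ∈ I | ∀ p ∈ P, ¬ Q p n} : ℝ) - X * ∏ p ∈ P, (1 - g p)| ≤
      X * ∑ D ∈ P.powerset with r ≤ #D, ∏ p ∈ D, g p +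
        2 * c * #{D ∈ P.powerset | #D ≤ r} := by
  set f : ℕ → ℝ := fun k => if k ≤ r then (-1) ^ k else 0 with hf
  have hc : 0 ≤ c := (abs_nonneg _).trans (hcount ∅ (empty_subset P))
  have hpow : ∀ n, ({p ∈ P | Q p n}).powerset = {D ∈ P.powerset | ∀ p ∈ D, Q p n} := fun n => by
    ext D
    simp only [mem_powerset, mem_filter, subset_iff]
    exact forall₂_and
  have hswap : ∀ φ : ℕ → ℝ, ∑ n ∈ I, ∑ D ∈ ({p ∈ P | Q p n}).powerset, φ #D =
      ∑ D ∈ P.powerset, φ #D * #{n ∈ I | ∀ p ∈ D, Q p n} := fun φ => by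
    simp only [hpow, sum_filter, card_filter, Nat.cast_sum, mul_sum]
    rw [sum_comm]
    refine sum_congr rfl fun D _ => sum_congr rfl fun n _ => ?_
    split_ifs <;> simp
  have hexp : ∏ p ∈ P, (1 - g p) = ∑ D ∈ P.powerset, (-1) ^ #D * ∏ p ∈ D, g p := by
    simp only [sub_eq_add_neg, prod_one_add, prod_neg]
  have h1 : |(#{n ∈ I | ∀ p ∈ P, ¬ Q p n} : ℝ) -
      ∑ D ∈ P.powerset, f #D * #{n ∈ I | ∀ p ∈ D, Q p n}| ≤
      ∑ D ∈ P.powerset, (if #D = r then (1 : ℝ) else 0) * #{n ∈ I | ∀ p ∈ D, Q p n} := by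
    rw [← hswap f, ← hswap fun k => if k = r then (1 : ℝ) else 0, card_filter, Nat.cast_sum,
      ← sum_sub_distrib]
    refine (abs_sum_le_sum_abs _ _).trans (sum_le_sum fun n _ => ?_)
    have h := abs_ite_empty_sub_sum_powerset_le ({p ∈ P | Q p n}) r
    simpa only [filter_eq_empty_iff, Nat.cast_ite, Nat.cast_one, Nat.cast_zero] using h
  have h2 : |∑ D ∈ P.powerset, f #D * #{n ∈ I | ∀ p ∈ D, Q p n} -
      X * ∑ D ∈ P.powerset, f #D * ∏ p ∈ D, g p| ≤ c * #{D ∈ P.powerset | #D ≤ r} := by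
    rw [mul_sum, ← sum_sub_distrib, card_filter, Nat.cast_sum, mul_sum]
    refine (abs_sum_le_sum_abs _ _).trans (sum_le_sum fun D hD => ?_)
    have h := hcount D (mem_powerset.1 hD)
    by_cases hr : #D ≤ r
    · simp only [hf, if_pos hr, Nat.cast_one, mul_one]
      rw [mul_left_comm, ← mul_sub, abs_mul, abs_pow, abs_neg, abs_one, one_pow, one_mul]
      exact h
    · simp [hf, hr]
  have h3 : |∑ D ∈ P.powerset, f #D * ∏ p ∈ D, g p - ∏ p ∈ P, (1 - g p)| ≤
      ∑ D ∈ P.powerset, (if r < #D then 1 else 0) * ∏ p ∈ D, g p := by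
    rw [hexp, ← sum_sub_distrib]
    refine (abs_sum_le_sum_abs _ _).trans (sum_le_sum fun D hD => ?_)
    have hD0 : 0 ≤ ∏ p ∈ D, g p := prod_nonneg fun p hp => hg p (mem_powerset.1 hD hp)
    by_cases hr : #D ≤ r
    · simp [hf, hr, not_lt.2 hr]
    · simp [hf, hr, not_le.1 hr, abs_mul, abs_of_nonneg hD0]
  have h4 : ∑ D ∈ P.powerset, (if #D = r then (1 : ℝ) else 0) * #{n ∈ I | ∀ p ∈ D, Q p n} ≤
      X * ∑ D ∈ P.powerset, (if #D = r then (1 : ℝ) else 0) * ∏ p ∈ D, g p +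
        c * #{D ∈ P.powerset | #D ≤ r} := by
    rw [mul_sum, card_filter, Nat.cast_sum, mul_sum, ← sum_add_distrib]
    refine sum_le_sum fun D hD => ?_
    have h := (abs_le.1 (hcount D (mem_powerset.1 hD))).2
    by_cases hr : #D = r
    · simp only [if_pos hr, if_pos hr.le, one_mul, Nat.cast_one, mul_one]
      linarith
    · simp only [if_neg hr, zero_mul, mul_zero, zero_add]
      positivity
  have h5 : ∑ D ∈ P.powerset with r ≤ #D, ∏ p ∈ D, g p =
      ∑ D ∈ P.powerset, (if #D = r then (1 : ℝ) else 0) * ∏ p ∈ D, g p +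
        ∑ D ∈ P.powerset, (if r < #D then 1 else 0) * ∏ p ∈ D, g p := by
    rw [sum_filter, ← sum_add_distrib]
    refine sum_congr rfl fun D _ => ?_
    rcases lt_trichotomy (#D) r with h | h | h
    · simp [h.ne, h.not_gt, h.not_ge]
    · simp [h]
    · simp [h.ne', h, h.le]
  have h6 : |X * ∑ D ∈ P.powerset, f #D * ∏ p ∈ D, g p - X * ∏ p ∈ P, (1 - g p)| ≤
      X * ∑ D ∈ P.powerset, (if r < #D then 1 else 0) * ∏ p ∈ D, g p := by
    rw [← mul_sub, abs_mul, abs_of_nonneg hX]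
    exact mul_le_mul_of_nonneg_left h3 hX
  rw [h5, mul_add]
  rw [abs_le] at h1 h2 h6 ⊢
  constructor <;> linarith

theorem sum_powerset_card_ge_le {α : Type*} (P : Finset α) (g : α → ℝ)
    (hg : ∀ p ∈ P, 0 ≤ g p) (r : ℕ) :
    ∑ D ∈ P.powerset with r ≤ #D, ∏ p ∈ D, g p ≤
      (2 ^ r)⁻¹ * Real.exp (2 * ∑ p ∈ P, g p) := by
  have h1 : ∏ p ∈ P, (1 + 2 * g p) ≤ Real.exp (∑ p ∈ P, 2 * g p) := by
    rw [Real.exp_sum]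
    refine prod_le_prod (fun p hp => by linarith [hg p hp]) fun p _ => ?_
    rw [add_comm]
    exact Real.add_one_le_exp _
  rw [← div_eq_inv_mul, le_div_iff₀ (by positivity), sum_mul, mul_sum]
  refine le_trans ?_ h1
  classical
  rw [prod_one_add, sum_filter]
  refine sum_le_sum fun D hD => ?_
  have hD0 : 0 ≤ ∏ p ∈ D, g p := prod_nonneg fun p hp => hg p (mem_powerset.1 hD hp)
  rw [prod_mul_distrib, prod_const, mul_comm]
  split_ifs with h
  · exact mul_le_mul_of_nonneg_right (pow_le_pow_right₀ one_le_two h) hD0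
  · positivity

theorem card_powerset_card_le_le {α : Type*} (P : Finset α) {y : ℝ} (hy : 1 ≤ y)
    (hP : (#P : ℝ) ≤ y) (r : ℕ) :
    (#{D ∈ P.powerset | #D ≤ r} : ℝ) ≤ y ^ r * Real.exp 1 := by
  have hy0 : 0 < y := by linarith
  have h1 : ∏ p ∈ P, (1 + y⁻¹) ≤ Real.exp 1 := by
    calc ∏ p ∈ P, (1 + y⁻¹) ≤ ∏ p ∈ P, Real.exp y⁻¹ :=
          prod_le_prod (fun _ _ => by positivity) fun _ _ => by
            rw [add_comm]; exact Real.add_one_le_exp _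
      _ = Real.exp (#P * y⁻¹) := by rw [prod_const, ← Real.exp_nat_mul]
      _ ≤ Real.exp 1 := by
        rw [Real.exp_le_exp, ← div_eq_mul_inv]
        exact div_le_one_of_le₀ hP hy0.le
  refine le_trans ?_ (mul_le_mul_of_nonneg_left h1 (by positivity))
  classical
  rw [prod_one_add, card_filter, Nat.cast_sum, mul_sum]
  refine sum_le_sum fun D _ => ?_
  rw [prod_const, inv_pow, ← div_eq_mul_inv]
  split_ifs with h
  · rw [le_div_iff₀ (by positivity), Nat.cast_one, one_mul]
    exact pow_le_pow_right₀ hy h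
  · rw [Nat.cast_zero]; positivity

theorem abs_card_Ioc_dvd_sub_le {a b d : ℕ} (hab : a ≤ b) (hd : 0 < d) (hd8 : Nat.Coprime 8 d) :
    |(#{n ∈ Ioc a b | d ∣ 8 * n + 1} : ℝ) - ((b : ℝ) - a) / d| ≤ 1 := by
  obtain ⟨v, hv⟩ : ∃ v : ℕ, d ∣ 8 * v + 1 := by
    obtain ⟨k, hk8, hkd⟩ := Nat.chineseRemainder hd8 1 0
    have hk : 8 * (k / 8) + 1 = k := by
      have : k % 8 = 1 := hk8
      omega
    exact ⟨k / 8, by rw [hk]; exact Nat.modEq_zero_iff_dvd.1 hkd⟩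
  have hset : {n ∈ Ioc a b | d ∣ 8 * n + 1} = {n ∈ Ioc a b | n ≡ v [MOD d]} := by
    refine filter_congr fun n _ => ?_
    constructor
    · intro h
      have h1 : 8 * n + 1 ≡ 8 * v + 1 [MOD d] :=
        ((Nat.modEq_zero_iff_dvd.2 h).trans (Nat.modEq_zero_iff_dvd.2 hv).symm)
      exact Nat.ModEq.cancel_left_of_coprime hd8.symm (Nat.ModEq.add_right_cancel' 1 h1)
    · intro h
      exact Nat.modEq_zero_iff_dvd.1
        (((h.mul_left 8).add_right 1).trans (Nat.modEq_zero_iff_dvd.2 hv))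
  have hcard := Nat.Ioc_filter_modEq_card a b hd v
  rw [← hset] at hcard
  have hdq : (0 : ℚ) < d := by exact_mod_cast hd
  have hmono : ⌊((a : ℚ) - v) / d⌋ ≤ ⌊((b : ℚ) - v) / d⌋ := by
    have : (a : ℚ) ≤ b := by exact_mod_cast hab
    exact Int.floor_mono (by gcongr)
  rw [max_eq_left (by linarith)] at hcard
  have hq : |(#{n ∈ Ioc a b | d ∣ 8 * n + 1} : ℚ) - ((b : ℚ) - a) / d| ≤ 1 := by
    have h1 : (#{n ∈ Ioc a b | d ∣ 8 * n + 1} : ℚ) =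
        ⌊((b : ℚ) - v) / d⌋ - ⌊((a : ℚ) - v) / d⌋ := by exact_mod_cast hcard
    have h2 : ((b : ℚ) - a) / d = ((b : ℚ) - v) / d - ((a : ℚ) - v) / d := by ring
    rw [h1, h2, abs_le]
    have := Int.floor_le (((b : ℚ) - v) / d)
    have := Int.lt_floor_add_one (((b : ℚ) - v) / d)
    have := Int.floor_le (((a : ℚ) - v) / d)
    have := Int.lt_floor_add_one (((a : ℚ) - v) / d)
    constructor <;> linarith
  have hr := (Rat.cast_le (K := ℝ)).2 hq
  push_cast at hr
  exact hr

theorem gcd_Mx_div_two_eq_one_iff {x : ℝ} (hx : 2 ≤ x) (n : ℕ) :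
    Nat.gcd (8 * n + 1) (Mx x / 2) = 1 ↔
      ∀ p ∈ (Nat.primesLE ⌊x⌋₊).erase 2, ¬ p ∣ 8 * n + 1 := by
  have h1 : primesUpTo x = Nat.primesLE ⌊x⌋₊ := by
    ext p
    simp [primesUpTo, Nat.mem_primesLE]
  have h2 : 2 ∈ Nat.primesLE ⌊x⌋₊ := Nat.mem_primesLE.2 ⟨Nat.le_floor (by exact_mod_cast hx),
    Nat.prime_two⟩
  rw [Mx, h1, ← mul_prod_erase _ _ h2, Nat.mul_div_cancel_left _ two_pos,
    ← Nat.coprime_iff_gcd_eq_one, Nat.coprime_prod_right_iff]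
  refine forall₂_congr fun p hp => ?_
  rw [Nat.coprime_comm, (Nat.prime_of_mem_primesLE (mem_of_mem_erase hp)).coprime_iff_not_dvd]

theorem setOf_sieve_eq {x A N : ℝ} (hx : 2 ≤ x) (hA : 0 ≤ A) (hN : 1 ≤ N) :
    {n : ℕ | 0 < n ∧ A < ((8 * n + 1 : ℕ) : ℝ) ∧ ((8 * n + 1 : ℕ) : ℝ) ≤ A + N ∧
        Nat.gcd (8 * n + 1) (Mx x / 2) = 1} =
      ({n ∈ Ioc ⌊(A - 1) / 8⌋₊ ⌊(A + N - 1) / 8⌋₊ |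
        ∀ p ∈ (Nat.primesLE ⌊x⌋₊).erase 2, ¬ p ∣ 8 * n + 1} : Finset ℕ) := by
  ext n
  rw [Set.mem_ofPred_eq, gcd_Mx_div_two_eq_one_iff hx, mem_coe, mem_filter, mem_Ioc,
    Nat.le_floor_iff (by linarith), and_assoc, ← and_assoc]
  push_cast
  refine and_congr ?_ (and_congr ⟨fun h => by linarith, fun h => by linarith⟩ Iff.rfl)
  constructor
  · rintro ⟨h0, h⟩
    rw [Nat.floor_lt' h0.ne']
    linarith
  · intro h
    have h0 : 0 < n := Nat.zero_lt_of_lt h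
    rw [Nat.floor_lt' h0.ne'] at h
    exact ⟨h0, by linarith⟩

theorem abs_card_Ioc_forall_dvd_sub_le {A N : ℝ} (hA : 0 ≤ A) (hN : 1 ≤ N) {D : Finset ℕ}
    (hD : ∀ p ∈ D, p.Prime ∧ p ≠ 2) :
    |(#{n ∈ Ioc ⌊(A - 1) / 8⌋₊ ⌊(A + N - 1) / 8⌋₊ | ∀ p ∈ D, p ∣ 8 * n + 1} : ℝ) -
      N / 8 * ∏ p ∈ D, 1 / (p : ℝ)| ≤ 3 := by
  set a := ⌊(A - 1) / 8⌋₊ with ha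
  set b := ⌊(A + N - 1) / 8⌋₊ with hb
  set d := ∏ p ∈ D, p with hd
  have hd0 : 0 < d := prod_pos fun p hp => (hD p hp).1.pos
  have hset : {n ∈ Ioc a b | ∀ p ∈ D, p ∣ 8 * n + 1} = {n ∈ Ioc a b | d ∣ 8 * n + 1} := by
    refine filter_congr fun n _ => ⟨fun h => ?_, fun h p hp => (dvd_prod_of_mem _ hp).trans h⟩
    exact prod_primes_dvd _ (fun p hp => (hD p hp).1.prime) h
  have hcop : Nat.Coprime 8 d := by
    refine Nat.Coprime.prod_right fun p hp => ?_
    have h2 : Nat.Coprime 2 p := (Nat.coprime_primes Nat.prime_two (hD p hp).1).2 (hD p hp).2.symm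
    exact Nat.Coprime.pow_left 3 h2
  have hab : a ≤ b := Nat.floor_mono (by linarith)
  have h1 := abs_card_Ioc_dvd_sub_le hab hd0 hcop
  have hdR : (1 : ℝ) ≤ d := by exact_mod_cast hd0
  have h2 : |((b : ℝ) - a) - N / 8| ≤ 2 := by
    have hb1 : (b : ℝ) ≤ (A + N - 1) / 8 := Nat.floor_le (by linarith)
    have hb2 := Nat.lt_floor_add_one ((A + N - 1) / 8)
    have ha1 : (a : ℝ) ≤ (A - 1) / 8 + 1 := by
      rcases le_total 1 A with h | h
      · linarith [Nat.floor_le (show 0 ≤ (A - 1) / 8 by linarith)]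
      · rw [ha, Nat.floor_of_nonpos (by linarith), Nat.cast_zero]
        linarith
    have ha2 := Nat.lt_floor_add_one ((A - 1) / 8)
    rw [abs_le]
    constructor <;> linarith
  have h3 : |((b : ℝ) - a) / d - N / 8 / d| ≤ 2 := by
    rw [← sub_div, abs_div, abs_of_pos (by linarith : (0 : ℝ) < d)]
    exact (div_le_self (abs_nonneg _) hdR).trans h2
  have h4 : N / 8 * ∏ p ∈ D, 1 / (p : ℝ) = N / 8 / d := by
    rw [prod_div_distrib, prod_const_one, hd, Nat.cast_prod, mul_one_div]
  rw [hset, h4]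
  rw [abs_le] at h1 h3 ⊢
  constructor <;> linarith

theorem sum_primesLE_one_div_le {x : ℝ} (hx : 1 ≤ x) :
    ∑ p ∈ (Nat.primesLE ⌊x⌋₊).erase 2, 1 / (p : ℝ) ≤ 1 + Real.log x := by
  refine le_trans ?_ (harmonic_floor_le_one_add_log x hx)
  rw [harmonic_eq_sum_Icc, Rat.cast_sum]
  push_cast
  simp only [one_div]
  refine sum_le_sum_of_subset_of_nonneg (fun p hp => ?_) fun _ _ _ => by positivity
  have hp := mem_of_mem_erase hp
  exact mem_Icc.2 ⟨(Nat.one_lt_of_mem_primesLE hp).le, Nat.le_of_mem_primesLE hp⟩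

theorem abs_sieve_count_sub_le {x A N : ℝ} (hx : Real.exp 1000 ≤ x) (hA : 0 ≤ A)
    (hN : Real.exp (Real.sqrt x) ≤ N) :
    |(Set.ncard {n : ℕ | 0 < n ∧ A < ((8 * n + 1 : ℕ) : ℝ) ∧
        ((8 * n + 1 : ℕ) : ℝ) ≤ A + N ∧ Nat.gcd (8 * n + 1) (Mx x / 2) = 1} : ℝ) -
      N / 8 * ∏ p ∈ (Nat.primesLE ⌊x⌋₊).erase 2, (1 - 1 / (p : ℝ))| ≤
        17 * N / (x * Real.log x) := by
  set u := Real.log x with hu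
  have hx0 : 0 < x := (Real.exp_pos _).trans_le hx
  have hxu : x = Real.exp u := (Real.exp_log hx0).symm
  have hu1 : 1000 ≤ u := (Real.le_log_iff_exp_le hx0).2 hx
  have hx2 : 2 ≤ x := by linarith [Real.add_one_le_exp (1000 : ℝ)]
  have hN1 : 1 ≤ N := by linarith [Real.add_one_le_exp (Real.sqrt x), Real.sqrt_nonneg x]
  set P := (Nat.primesLE ⌊x⌋₊).erase 2 with hP
  set r := ⌈u ^ 2⌉₊ with hr
  have hcardP : (#P : ℝ) ≤ x := by
    refine le_trans (Nat.cast_le.2 ?_) (Nat.floor_le hx0.le)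
    refine (card_le_card fun p hp => ?_).trans (Nat.card_Icc 1 ⌊x⌋₊).le
    have hp := mem_of_mem_erase hp
    exact mem_Icc.2 ⟨(Nat.one_lt_of_mem_primesLE hp).le, Nat.le_of_mem_primesLE hp⟩
  have hmain := abs_card_sifted_sub_le (Ioc ⌊(A - 1) / 8⌋₊ ⌊(A + N - 1) / 8⌋₊) P
    (fun p n => p ∣ 8 * n + 1) (fun p => 1 / (p : ℝ)) (X := N / 8) (c := 3) (by linarith)
    (fun p _ => by positivity) r fun D hD => abs_card_Ioc_forall_dvd_sub_le hA hN1 fun p hp =>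
      ⟨Nat.prime_of_mem_primesLE (mem_of_mem_erase (hD hp)), ne_of_mem_erase (hD hp)⟩
  rw [setOf_sieve_eq hx2 hA hN1, Set.ncard_coe_finset]
  refine hmain.trans ?_
  have hsum : ∑ D ∈ P.powerset with r ≤ #D, ∏ p ∈ D, 1 / (p : ℝ) ≤ 1 / (x * u) := by
    refine (sum_powerset_card_ge_le P _ (fun p _ => by positivity) r).trans ?_
    have h1 : ((2 : ℝ) ^ r)⁻¹ ≤ Real.exp (-(u ^ 2 / 2)) := by
      rw [Real.exp_neg]
      refine inv_anti₀ (Real.exp_pos _) ?_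
      rw [← Real.exp_log (show (0 : ℝ) < 2 ^ r by positivity), Real.exp_le_exp, Real.log_pow]
      have h2 : u ^ 2 ≤ r := Nat.le_ceil _
      nlinarith [Real.log_two_gt_d9, sq_nonneg u]
    have h2 : Real.exp (2 * ∑ p ∈ P, 1 / (p : ℝ)) ≤ Real.exp (2 * (1 + u)) :=
      Real.exp_le_exp.2 (by linarith [sum_primesLE_one_div_le (show 1 ≤ x by linarith)])
    have h3 : x * u ≤ Real.exp (2 * u) := by
      rw [two_mul, Real.exp_add, ← hxu]
      exact mul_le_mul_of_nonneg_left (by linarith [Real.add_one_le_exp u]) hx0.le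
    rw [le_div_iff₀ (by positivity)]
    calc _ ≤ Real.exp (-(u ^ 2 / 2)) * Real.exp (2 * (1 + u)) * Real.exp (2 * u) := by gcongr
      _ = Real.exp (-(u ^ 2 / 2) + 2 * (1 + u) + 2 * u) := by rw [Real.exp_add, Real.exp_add]
      _ ≤ 1 := Real.exp_le_one_iff.2 (by nlinarith)
  have hcard : (#{D ∈ P.powerset | #D ≤ r} : ℝ) ≤ Real.exp 1 * (N / (x * u)) := by
    refine (card_powerset_card_le_le P (by linarith) hcardP r).trans ?_
    rw [mul_comm]
    refine mul_le_mul_of_nonneg_left ?_ (Real.exp_pos _).le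
    rw [le_div_iff₀ (by positivity)]
    refine le_trans ?_ hN
    have h1 : x ^ r ≤ Real.exp (u * (u ^ 2 + 1)) := by
      rw [hxu, ← Real.exp_nat_mul, Real.exp_le_exp, mul_comm]
      exact mul_le_mul_of_nonneg_left (Nat.ceil_lt_add_one (sq_nonneg u)).le (by linarith)
    have h3 : x * u ≤ Real.exp (2 * u) := by
      rw [two_mul, Real.exp_add, ← hxu]
      exact mul_le_mul_of_nonneg_left (by linarith [Real.add_one_le_exp u]) hx0.le
    have h4 : Real.sqrt x = Real.exp (u / 2) := by rw [Real.exp_half, ← hxu]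
    have h5 : (u / 2) ^ 4 / 24 ≤ Real.exp (u / 2) := by
      have := Real.pow_div_factorial_le_exp (u / 2) (by linarith) 4
      simpa [Nat.factorial] using this
    calc x ^ r * (x * u) ≤ Real.exp (u * (u ^ 2 + 1)) * Real.exp (2 * u) := by gcongr
      _ = Real.exp (u * (u ^ 2 + 1) + 2 * u) := by rw [Real.exp_add]
      _ ≤ Real.exp (Real.sqrt x) := by
        rw [Real.exp_le_exp, h4]
        refine le_trans ?_ h5
        have h6 : 1000 * u ^ 3 ≤ u ^ 4 := by
          rw [pow_succ u 3, mul_comm]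
          exact mul_le_mul_of_nonneg_left hu1 (by positivity)
        have h7 : 1000 * 1000 * u ≤ u ^ 3 := by nlinarith
        nlinarith
  have hpos : 0 ≤ N / (x * u) := by positivity
  calc _ ≤ N / 8 * (1 / (x * u)) + 2 * 3 * (Real.exp 1 * (N / (x * u))) := by gcongr
    _ = (1 / 8 + 6 * Real.exp 1) * (N / (x * u)) := by ring
    _ ≤ 17 * (N / (x * u)) := by
      refine mul_le_mul_of_nonneg_right ?_ hpos
      linarith [Real.exp_one_lt_d9]
    _ = 17 * N / (x * u) := by ring

theorem tendsto_prod_odd_primes_mul_log :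
    Tendsto (fun x : ℝ => (∏ p ∈ (Nat.primesLE ⌊x⌋₊).erase 2, (1 - 1 / (p : ℝ))) * Real.log x)
      atTop (𝓝 (2 * Real.exp (-Real.eulerMascheroniConstant))) := by
  refine (tendsto_prod_one_sub_inv_mul_log.const_mul 2).congr' ?_
  filter_upwards [eventually_ge_atTop 2] with x hx
  have h2 : 2 ∈ Nat.primesLE ⌊x⌋₊ := Nat.mem_primesLE.2 ⟨Nat.le_floor (by exact_mod_cast hx),
    Nat.prime_two⟩
  rw [← mul_prod_erase _ _ h2]
  push_cast
  ring

/-- Uniformly for `A ≥ 0` and `N ≥ exp(√x)`, the number of positive integers `n` with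
`A < 8n+1 ≤ A+N` and `gcd(8n+1, M(x)/2) = 1` is `(1+o(1)) · N / (4 e^γ log x)`. -/
theorem sieve_count_asymptotic :
    ∀ ε : ℝ, 0 < ε → ∃ x₀ : ℝ, ∀ x : ℝ, x₀ ≤ x → ∀ A : ℝ, 0 ≤ A →
      ∀ N : ℝ, Real.exp (Real.sqrt x) ≤ N →
        |(Set.ncard {n : ℕ | 0 < n ∧ A < ((8 * n + 1 : ℕ) : ℝ) ∧
              ((8 * n + 1 : ℕ) : ℝ) ≤ A + N ∧ Nat.gcd (8 * n + 1) (Mx x / 2) = 1} : ℝ) -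
            N / (4 * Real.exp Real.eulerMascheroniConstant * Real.log x)| ≤
          ε * (N / (4 * Real.exp Real.eulerMascheroniConstant * Real.log x)) := by
  intro ε hε
  set G := Real.exp Real.eulerMascheroniConstant with hG
  have hG0 : 0 < G := Real.exp_pos _
  have hlim := tendsto_prod_odd_primes_mul_log
  rw [Real.exp_neg, ← hG] at hlim
  obtain ⟨x₁, hx₁⟩ := eventually_atTop.1
    ((Metric.tendsto_nhds.1 hlim) (ε / G) (div_pos hε hG0))
  refine ⟨max (max x₁ (Real.exp 1000)) (136 * G / ε), fun x hx A hA N hN => ?_⟩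
  have hxe : Real.exp 1000 ≤ x := (le_max_right _ _).trans ((le_max_left _ _).trans hx)
  have hxG : 136 * G / ε ≤ x := (le_max_right _ _).trans hx
  have hprod := hx₁ x ((le_max_left _ _).trans ((le_max_left _ _).trans hx))
  have hx0 : 0 < x := (Real.exp_pos _).trans_le hxe
  have hN0 : 0 < N := (Real.exp_pos _).trans_le hN
  have hcount := abs_sieve_count_sub_le hxe hA hN
  have hu0 : 0 < Real.log x := by
    linarith [(Real.le_log_iff_exp_le hx0).2 hxe]
  set u := Real.log x
  set V := ∏ p ∈ (Nat.primesLE ⌊x⌋₊).erase 2, (1 - 1 / (p : ℝ))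
  have h1 : |N / 8 * V - N / (4 * G * u)| ≤ ε / 2 * (N / (4 * G * u)) := by
    have h : N / 8 * V - N / (4 * G * u) = N / (8 * u) * (V * u - 2 * G⁻¹) := by
      field_simp
      ring
    rw [h, abs_mul, abs_of_pos (by positivity)]
    rw [Real.dist_eq] at hprod
    calc N / (8 * u) * |V * u - 2 * G⁻¹| ≤ N / (8 * u) * (ε / G) := by gcongr
      _ = ε / 2 * (N / (4 * G * u)) := by field_simp; ring
  have h2 : 17 * N / (x * u) ≤ ε / 2 * (N / (4 * G * u)) := by
    rw [div_le_iff₀ hε] at hxG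
    have h : ε / 2 * (N / (4 * G * u)) = N * (x * ε) / (8 * G * (x * u)) := by
      field_simp
      ring
    rw [h, div_le_div_iff₀ (by positivity) (by positivity)]
    have := mul_le_mul_of_nonneg_left hxG (show 0 ≤ N * (x * u) by positivity)
    linarith
  rw [abs_le] at hcount h1 ⊢
  constructor <;> linarith
end
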